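/- arXiv:1305.6053 — 4 statements merged into one kernel-verified Lean document; each statement's English description precedes it below -/
import Mathlib

section
/- For every s ∈ ℝ, (1/(2π)) ∫_{u=−∞}^{∞} [ ∫_{y=0}^{∞} e^{−2^{1/3}s(iu+y)} Ai(iu+y) dy ] / Ai(iu)² du = e^{−(2/3)s³}. -/
open MeasureTheory ProbabilityTheory Filter Set

noncomputable section

/-- `Ai, Bi` form the standard pair of Airy functions: entire solutions of `w'' = z·w`,
real on the real axis, normalized there by the classical improper integral representations
`Ai x = (1/π) ∫₀^∞ cos(t³/3 + xt) dt` and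
`Bi x = (1/π) ∫₀^∞ (exp(-t³/3 + xt) + sin(t³/3 + xt)) dt`. -/
def IsAiry (Ai Bi : ℂ → ℂ) : Prop :=
  Differentiable ℂ Ai ∧ Differentiable ℂ Bi ∧
  (∀ z : ℂ, deriv (deriv Ai) z = z * Ai z) ∧
  (∀ z : ℂ, deriv (deriv Bi) z = z * Bi z) ∧
  (∀ x : ℝ, (Ai (x : ℂ)).im = 0) ∧
  (∀ x : ℝ, (Bi (x : ℂ)).im = 0) ∧
  (∀ x : ℝ, Tendsto (fun R : ℝ => ∫ t in (0:ℝ)..R, Real.cos (t ^ 3 / 3 + x * t))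
      atTop (nhds (Real.pi * (Ai (x : ℂ)).re))) ∧
  (∀ x : ℝ, Tendsto
      (fun R : ℝ => ∫ t in (0:ℝ)..R,
        (Real.exp (-(t ^ 3) / 3 + x * t) + Real.sin (t ^ 3 / 3 + x * t)))
      atTop (nhds (Real.pi * (Bi (x : ℂ)).re)))

theorem norm_cexp_airyPhase (t y : ℝ) (z : ℂ) :
    ‖Complex.exp (Complex.I * ((t + y * Complex.I) ^ 3 / 3 + z * (t + y * Complex.I)))‖ =
      Real.exp (-y * t ^ 2 - z.im * t + y ^ 3 / 3 - z.re * y) := by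
  rw [Complex.norm_exp]
  congr 1
  have h : ((t + y * Complex.I) ^ 3 / 3 : ℂ) =
      ((t ^ 3 / 3 - t * y ^ 2 : ℝ) : ℂ) + ((t ^ 2 * y - y ^ 3 / 3 : ℝ) : ℂ) * Complex.I := by
    push_cast
    linear_combination (t * y ^ 2 + y ^ 3 * Complex.I / 3) * Complex.I_sq
  rw [h]
  simp only [Complex.mul_re, Complex.add_re, Complex.add_im, Complex.mul_im, Complex.ofReal_re,
    Complex.ofReal_im, Complex.I_re, Complex.I_im]
  ring

theorem norm_airyPhase_primitive_sub_le {G : ℂ → ℂ} {x R Y : ℝ}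
    (hG : ∀ z, HasDerivAt G (Complex.exp (Complex.I * (z ^ 3 / 3 + x * z))) z)
    (hY : 0 ≤ Y) (hR : R ≠ 0) (h : Y ^ 2 / 3 + |x| ≤ R ^ 2 / 2) :
    ‖G (R + Y * Complex.I) - G R‖ ≤ 2 / R ^ 2 := by
  have hR2 : 0 < R ^ 2 := by positivity
  have hd : ∀ y : ℝ, HasDerivAt (fun y : ℝ => G (R + y * Complex.I) - G R)
      (Complex.exp (Complex.I * ((R + y * Complex.I) ^ 3 / 3 + x * (R + y * Complex.I)))
        * Complex.I) y := by
    intro y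
    have h1 : HasDerivAt (fun y : ℝ => (R + y * Complex.I : ℂ)) Complex.I y := by
      simpa using ((Complex.ofRealCLM.hasDerivAt (x := y)).mul_const Complex.I).const_add (R : ℂ)
    exact ((hG _).comp y h1).sub_const _
  have hB : ∀ y : ℝ, HasDerivAt (fun y : ℝ => 2 / R ^ 2 * (1 - Real.exp (-(R ^ 2 / 2) * y)))
      (Real.exp (-(R ^ 2 / 2) * y)) y := by
    intro y
    have h1 : HasDerivAt (fun y : ℝ => -(R ^ 2 / 2) * y) (-(R ^ 2 / 2)) y := by
      simpa using (hasDerivAt_id y).const_mul (-(R ^ 2 / 2))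
    convert! ((h1.exp.const_sub 1).const_mul (2 / R ^ 2)) using 1
    field_simp
  have key := image_norm_le_of_norm_deriv_right_le_deriv_boundary (a := 0) (b := Y)
    (fun y _ => (hd y).continuousAt.continuousWithinAt)
    (fun y _ => (hd y).hasDerivWithinAt) (by simp) hB ?_ (right_mem_Icc.2 hY)
  · refine key.trans ?_
    rw [mul_sub, mul_one]
    have : 0 ≤ 2 / R ^ 2 * Real.exp (-(R ^ 2 / 2) * Y) := by positivity
    linarith
  · intro y hy
    rw [norm_mul, Complex.norm_I, mul_one, norm_cexp_airyPhase, Real.exp_le_exp]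
    simp only [Complex.ofReal_im, Complex.ofReal_re, zero_mul, sub_zero]
    have h1 : y ^ 2 ≤ Y ^ 2 := pow_le_pow_left₀ hy.1 hy.2.le 2
    have h2 : 0 ≤ y * (R ^ 2 / 2 - y ^ 2 / 3 - |x|) := mul_nonneg hy.1 (by linarith)
    have h3 : 0 ≤ y * (x + |x|) := mul_nonneg hy.1 (by linarith [neg_abs_le x])
    nlinarith

theorem exists_airyPhase_primitive (x : ℝ) :
    ∃ G : ℂ → ℂ, G 0 = 0 ∧
      ∀ z, HasDerivAt G (Complex.exp (Complex.I * (z ^ 3 / 3 + x * z))) z := by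
  have hd : Differentiable ℂ fun z : ℂ => Complex.exp (Complex.I * (z ^ 3 / 3 + x * z)) := by
    fun_prop
  have h := Complex.IsConservativeOn.isExactOn_univ hd.continuous
    (hd.differentiableOn.isConservativeOn)
  obtain ⟨g, h0, hg⟩ := h.with_val_at 0 0
  exact ⟨g, h0, fun z => hg z (mem_univ z)⟩

/-- The truncated Airy integral in terms of a primitive of the phase. -/
theorem integral_cos_airyPhase {G : ℂ → ℂ} {x : ℝ}
    (hG : ∀ z, HasDerivAt G (Complex.exp (Complex.I * (z ^ 3 / 3 + x * z))) z) (R : ℝ) :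
    ((∫ t in (0 : ℝ)..R, Real.cos (t ^ 3 / 3 + x * t) : ℝ) : ℂ) = (G R - G (-R)) / 2 := by
  rw [← intervalIntegral.integral_ofReal]
  have hd : ∀ t : ℝ, HasDerivAt (fun t : ℝ => (G t - G (-t)) / 2)
      (Real.cos (t ^ 3 / 3 + x * t) : ℂ) t := by
    intro t
    have h1 := (hG t).comp_ofReal
    have h2 : HasDerivAt (fun t : ℝ => G (-t)) _ t :=
      (hG (-t)).comp t ((Complex.ofRealCLM.hasDerivAt (x := t)).neg)
    convert! (h1.sub h2).div_const 2 using 1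
    rw [Complex.ofReal_cos, Complex.cos]
    push_cast
    simp only [Complex.ofRealCLM_apply, Complex.ofReal_one]
    ring_nf
  rw [intervalIntegral.integral_eq_sub_of_hasDerivAt (fun t _ => hd t)]
  · simp
  · apply Continuous.intervalIntegrable
    fun_prop

theorem norm_cexp_airyPhase_le {y : ℝ} (hy : 0 < y) (t : ℝ) (z : ℂ) :
    ‖Complex.exp (Complex.I * ((t + y * Complex.I) ^ 3 / 3 + z * (t + y * Complex.I)))‖ ≤
      Real.exp (y ^ 3 / 3 - z.re * y + z.im ^ 2 / (2 * y)) * Real.exp (-(y / 2) * t ^ 2) := by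
  rw [norm_cexp_airyPhase, ← Real.exp_add, Real.exp_le_exp]
  have h : 0 ≤ (y * t + z.im) ^ 2 / (2 * y) := by positivity
  have h2 : (y * t + z.im) ^ 2 / (2 * y) = y / 2 * t ^ 2 + z.im * t + z.im ^ 2 / (2 * y) := by
    field_simp
    ring
  linarith

theorem integrable_airyPhase {y : ℝ} (hy : 0 < y) (z : ℂ) :
    Integrable fun t : ℝ =>
      Complex.exp (Complex.I * ((t + y * Complex.I) ^ 3 / 3 + z * (t + y * Complex.I))) := by
  refine Integrable.mono' ((integrable_exp_neg_mul_sq (half_pos hy)).const_mul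
    (Real.exp (y ^ 3 / 3 - z.re * y + z.im ^ 2 / (2 * y)))) ?_
    (Eventually.of_forall fun t => norm_cexp_airyPhase_le hy t z)
  exact Continuous.aestronglyMeasurable (by fun_prop)

theorem differentiable_integral_airyPhase {y : ℝ} (hy : 0 < y) :
    Differentiable ℂ fun z : ℂ => ∫ t : ℝ,
      Complex.exp (Complex.I * ((t + y * Complex.I) ^ 3 / 3 + z * (t + y * Complex.I))) := by
  intro z₀
  set M : ℝ := ‖z₀‖ + 1
  have hM : 0 < M := by positivity
  refine (hasDerivAt_integral_of_dominated_loc_of_deriv_le (Metric.ball_mem_nhds z₀ one_pos)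
    (F' := fun z t => Complex.exp (Complex.I * ((t + y * Complex.I) ^ 3 / 3 +
      z * (t + y * Complex.I))) * (Complex.I * (t + y * Complex.I)))
    (bound := fun t => Real.exp (y ^ 3 / 3 + M * y + M ^ 2 / (2 * y)) *
      (‖t * Real.exp (-(y / 2) * t ^ 2)‖ + y * Real.exp (-(y / 2) * t ^ 2)))
    ?_ (integrable_airyPhase hy z₀) ?_ ?_ ?_ ?_).2.differentiableAt
  · exact Eventually.of_forall fun z => Continuous.aestronglyMeasurable (by fun_prop)
  · exact Continuous.aestronglyMeasurable (by fun_prop)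
  · refine Eventually.of_forall fun t z hz => ?_
    have hzM : ‖z‖ ≤ M := by
      have h1 := norm_add_le (z - z₀) z₀
      rw [Metric.mem_ball, dist_eq_norm] at hz
      rw [sub_add_cancel] at h1
      linarith
    have hre : -z.re ≤ M := (neg_le_abs _).trans ((Complex.abs_re_le_norm z).trans hzM)
    have him : z.im ^ 2 ≤ M ^ 2 :=
      sq_le_sq' (by linarith [neg_abs_le z.im, (Complex.abs_im_le_norm z)])
        ((le_abs_self _).trans ((Complex.abs_im_le_norm z).trans hzM))
    have h1 : ‖Complex.I * (t + y * Complex.I)‖ ≤ |t| + y := by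
      rw [norm_mul, Complex.norm_I, one_mul]
      refine (norm_add_le _ _).trans (le_of_eq ?_)
      simp [abs_of_pos hy]
    have h2 : Real.exp (y ^ 3 / 3 - z.re * y + z.im ^ 2 / (2 * y)) ≤
        Real.exp (y ^ 3 / 3 + M * y + M ^ 2 / (2 * y)) := by
      rw [Real.exp_le_exp]
      have : z.im ^ 2 / (2 * y) ≤ M ^ 2 / (2 * y) := by gcongr
      nlinarith
    rw [norm_mul]
    calc _ ≤ (Real.exp (y ^ 3 / 3 + M * y + M ^ 2 / (2 * y)) * Real.exp (-(y / 2) * t ^ 2)) *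
          (|t| + y) := by
          refine mul_le_mul ((norm_cexp_airyPhase_le hy t z).trans ?_) h1 (norm_nonneg _)
            (by positivity)
          gcongr
      _ = _ := by
          rw [norm_mul, Real.norm_eq_abs, Real.norm_eq_abs, Real.abs_exp]
          ring
  · exact ((integrable_mul_exp_neg_mul_sq (half_pos hy)).norm.add
      ((integrable_exp_neg_mul_sq (half_pos hy)).const_mul y)).const_mul _
  · refine Eventually.of_forall fun t z _ => ?_
    have h1 : HasDerivAt (fun z : ℂ => Complex.I * ((t + y * Complex.I) ^ 3 / 3 +
        z * (t + y * Complex.I))) (Complex.I * (t + y * Complex.I)) z := by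
      simpa using (((hasDerivAt_id z).mul_const (t + y * Complex.I)).const_add
        ((t + y * Complex.I) ^ 3 / 3)).const_mul Complex.I
    exact h1.cexp

section

variable {Ai : ℂ → ℂ} (hd : Differentiable ℂ Ai) (him : ∀ x : ℝ, (Ai x).im = 0)
  (hlim : ∀ x : ℝ, Tendsto (fun R : ℝ => ∫ t in (0 : ℝ)..R, Real.cos (t ^ 3 / 3 + x * t))
    atTop (nhds (Real.pi * (Ai x).re)))

include him hlim in
theorem tendsto_airyPhase_primitive {G : ℂ → ℂ} {x : ℝ}
    (hG : ∀ z, HasDerivAt G (Complex.exp (Complex.I * (z ^ 3 / 3 + x * z))) z) :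
    Tendsto (fun R : ℝ => G R - G (-R)) atTop (nhds (2 * Real.pi * Ai x)) := by
  have h1 := ((Complex.continuous_ofReal.tendsto _).comp (hlim x)).const_mul 2
  have h2 : (2 : ℂ) * ((Real.pi * (Ai x).re : ℝ) : ℂ) = 2 * Real.pi * Ai x := by
    have : ((Ai x).re : ℂ) = Ai x := Complex.ext (by simp) (by simp [him x])
    rw [Complex.ofReal_mul, this, mul_assoc]
  rw [h2] at h1
  refine h1.congr fun R => ?_
  simp only [Function.comp_apply]
  rw [integral_cos_airyPhase hG]
  ring

theorem tendsto_two_div_sq : Tendsto (fun R : ℝ => 2 / R ^ 2) atTop (nhds 0) :=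
  tendsto_const_nhds.div_atTop (tendsto_pow_atTop two_ne_zero)

include him hlim in
theorem airy_eq_integral_ofReal {y : ℝ} (hy : 0 < y) (x : ℝ) :
    2 * Real.pi * Ai x = ∫ t : ℝ,
      Complex.exp (Complex.I * ((t + y * Complex.I) ^ 3 / 3 + x * (t + y * Complex.I))) := by
  obtain ⟨G, -, hG⟩ := exists_airyPhase_primitive x
  have hT := tendsto_airyPhase_primitive him hlim hG
  have hbig : ∀ᶠ R : ℝ in atTop, y ^ 2 / 3 + |x| ≤ R ^ 2 / 2 ∧ 0 < R := by
    refine Eventually.and ?_ (eventually_gt_atTop 0)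
    exact ((tendsto_pow_atTop two_ne_zero).atTop_div_const two_pos).eventually_ge_atTop _
  have hp : Tendsto (fun R : ℝ => G (R + y * Complex.I) - G R) atTop (nhds 0) := by
    refine squeeze_zero_norm' ?_ tendsto_two_div_sq
    filter_upwards [hbig] with R hR
    exact norm_airyPhase_primitive_sub_le hG hy.le hR.2.ne' hR.1
  have hm : Tendsto (fun R : ℝ => G (-R + y * Complex.I) - G (-R)) atTop (nhds 0) := by
    refine squeeze_zero_norm' ?_ tendsto_two_div_sq
    filter_upwards [hbig] with R hR
    have := norm_airyPhase_primitive_sub_le (R := -R) hG hy.le (neg_ne_zero.2 hR.2.ne')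
      (by simpa using hR.1)
    simpa using this
  have hI := intervalIntegral_tendsto_integral (integrable_airyPhase hy x) tendsto_neg_atTop_atBot
    tendsto_id
  refine tendsto_nhds_unique ?_ hI
  have hsum := (hT.add hp).sub hm
  rw [add_zero, sub_zero] at hsum
  refine hsum.congr fun R => ?_
  have hder : ∀ t : ℝ, HasDerivAt (fun t : ℝ => G (t + y * Complex.I)) (Complex.exp (Complex.I *
      ((t + y * Complex.I) ^ 3 / 3 + x * (t + y * Complex.I)))) t := by
    intro t
    have h1 : HasDerivAt (fun t : ℝ => (t + y * Complex.I : ℂ)) 1 t := by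
      simpa using (Complex.ofRealCLM.hasDerivAt (x := t)).add_const (y * Complex.I)
    have h2 := (hG _).comp t h1
    rw [mul_one] at h2
    exact h2
  rw [intervalIntegral.integral_eq_sub_of_hasDerivAt (fun t _ => hder t)]
  · push_cast [id]
    ring
  · apply Continuous.intervalIntegrable
    fun_prop

include hd him hlim in
theorem airy_eq_integral {y : ℝ} (hy : 0 < y) (z : ℂ) :
    2 * Real.pi * Ai z = ∫ t : ℝ,
      Complex.exp (Complex.I * ((t + y * Complex.I) ^ 3 / 3 + z * (t + y * Complex.I))) := by
  have key := AnalyticOnNhd.eq_of_frequently_eq (z₀ := (0 : ℂ))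
    (f := fun z => 2 * Real.pi * Ai z) (fun w _ => (hd.const_mul _).analyticAt w)
    (fun w _ => (differentiable_integral_airyPhase hy).analyticAt w) ?_
  · exact congrFun key z
  · have hT : Tendsto (fun n : ℕ => (((1 / ((n : ℝ) + 1) : ℝ)) : ℂ)) atTop (nhdsWithin 0 {0}ᶜ) := by
      refine tendsto_nhdsWithin_iff.2 ⟨?_, Eventually.of_forall fun n => ?_⟩
      · simpa only [Complex.ofReal_zero, Function.comp_def] using
          (Complex.continuous_ofReal.tendsto 0).comp tendsto_one_div_add_atTop_nhds_zero_nat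
      · have : (1 / ((n : ℝ) + 1)) ≠ 0 := by positivity
        exact Complex.ofReal_ne_zero.2 this
    exact hT.frequently (Frequently.of_forall fun n =>
      airy_eq_integral_ofReal him hlim hy _)

end

/-- The moments `∫₀^∞ r ^ k * exp (-r³/3) dr`. -/
def cubicMoment (k : ℕ) : ℝ := ∫ r in Ioi (0 : ℝ), r ^ k * Real.exp (-(r ^ 3) / 3)

theorem integrableOn_cubicMoment (k : ℕ) :
    IntegrableOn (fun r : ℝ => r ^ k * Real.exp (-(r ^ 3) / 3)) (Ioi 0) := by
  have h := integrableOn_rpow_mul_exp_neg_mul_rpow (p := 3) (s := k) (b := 1 / 3)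
    (by linarith [(Nat.cast_nonneg k : (0 : ℝ) ≤ k)]) (by norm_num) (by norm_num)
  refine h.congr_fun (fun r _ => ?_) measurableSet_Ioi
  have h3 : r ^ (3 : ℝ) = r ^ 3 := by exact_mod_cast Real.rpow_natCast r 3
  simp only [Real.rpow_natCast, h3]
  ring_nf

theorem cubicMoment_pos (k : ℕ) : 0 < cubicMoment k := by
  refine (setIntegral_pos_iff_support_of_nonneg_ae ?_ (integrableOn_cubicMoment k)).2 ?_
  · filter_upwards [ae_restrict_mem measurableSet_Ioi] with r hr
    have : 0 < r := hr
    simp only [Pi.zero_apply]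
    positivity
  · have : Ioi (0 : ℝ) ⊆ (Function.support fun r : ℝ => r ^ k * Real.exp (-(r ^ 3) / 3)) ∩
        Ioi 0 := by
      intro r hr
      have h0 : 0 < r := hr
      exact ⟨by rw [Function.mem_support]; positivity, hr⟩
    refine lt_of_lt_of_le ?_ (measure_mono this)
    simp

theorem tendsto_airyPhase_primitive_ray {G : ℂ → ℂ} (hG0 : G 0 = 0)
    (hG : ∀ z, HasDerivAt G (Complex.exp (Complex.I * (z ^ 3 / 3 + (0 : ℝ) * z))) z)
    {e : ℂ} (he : e ^ 3 = Complex.I) :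
    Tendsto (fun r : ℝ => G (r * e)) atTop (nhds (e * cubicMoment 0)) := by
  have hI := (integrableOn_cubicMoment 0).ofReal (𝕜 := ℂ)
  have h := (intervalIntegral_tendsto_integral_Ioi 0 hI tendsto_id).const_mul e
  rw [integral_ofReal] at h
  refine h.congr fun R => ?_
  have hder : ∀ r : ℝ, HasDerivAt (fun r : ℝ => G (r * e))
      (e * ((r ^ 0 * Real.exp (-(r ^ 3) / 3) : ℝ) : ℂ)) r := by
    intro r
    have h1 : HasDerivAt (fun r : ℝ => (r * e : ℂ)) e r := by
      simpa using (Complex.ofRealCLM.hasDerivAt (x := r)).mul_const e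
    convert! (hG _).comp r h1 using 1
    rw [mul_comm]
    congr 1
    push_cast
    rw [pow_zero, one_mul]
    congr 1
    linear_combination (-(r : ℂ) ^ 3 * Complex.I / 3) * he - ((r : ℂ) ^ 3 / 3) * Complex.I_sq
  have hc : IntervalIntegrable (fun r : ℝ => e * ((r ^ 0 * Real.exp (-(r ^ 3) / 3) : ℝ) : ℂ))
      volume 0 R := Continuous.intervalIntegrable (by fun_prop) _ _
  have := intervalIntegral.integral_eq_sub_of_hasDerivAt (fun t _ => hder t) hc
  rw [intervalIntegral.integral_const_mul] at this
  simp only [id, Complex.ofReal_zero, zero_mul, hG0, sub_zero] at this ⊢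
  exact this

theorem tendsto_airyPhase_primitive_real {G : ℂ → ℂ} (hG0 : G 0 = 0)
    (hG : ∀ z, HasDerivAt G (Complex.exp (Complex.I * (z ^ 3 / 3 + (0 : ℝ) * z))) z)
    {a : ℝ} (ha : a ^ 2 = 3 / 4) :
    Tendsto (fun r : ℝ => G ((r * a : ℝ))) atTop
      (nhds ((a + Complex.I / 2) * cubicMoment 0)) := by
  have ha0 : a ≠ 0 := by rintro rfl; norm_num at ha
  have hac : (a : ℂ) ^ 2 = 3 / 4 := by
    rw [← Complex.ofReal_pow, ha]
    push_cast
    rfl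
  have he : (a + Complex.I / 2 : ℂ) ^ 3 = Complex.I := by
    linear_combination (a + 3 * Complex.I / 2) * hac + (3 * a / 4 + Complex.I / 8) * Complex.I_sq
  have h1 := tendsto_airyPhase_primitive_ray hG0 hG he
  have h2 : Tendsto (fun r : ℝ => G ((r * a : ℝ) + (r / 2 : ℝ) * Complex.I) - G ((r * a : ℝ)))
      atTop (nhds 0) := by
    have h3 : Tendsto (fun r : ℝ => 2 / (r * a) ^ 2) atTop (nhds 0) := by
      have := tendsto_two_div_sq.div_const (a ^ 2)
      rw [zero_div] at this
      refine this.congr fun r => ?_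
      rw [mul_pow, div_div]
    refine squeeze_zero_norm' ?_ h3
    filter_upwards [eventually_gt_atTop 0] with r hr
    refine norm_airyPhase_primitive_sub_le hG (by positivity) (by positivity) ?_
    rw [mul_pow, ha, abs_zero]
    nlinarith [sq_nonneg r]
  have h3 := h1.sub h2
  rw [sub_zero] at h3
  refine h3.congr fun r => ?_
  have : (r * (a + Complex.I / 2) : ℂ) = (r * a : ℝ) + (r / 2 : ℝ) * Complex.I := by
    push_cast
    ring
  rw [this]
  ring

section

variable {Ai : ℂ → ℂ} (hd : Differentiable ℂ Ai) (him : ∀ x : ℝ, (Ai x).im = 0)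
  (hlim : ∀ x : ℝ, Tendsto (fun R : ℝ => ∫ t in (0 : ℝ)..R, Real.cos (t ^ 3 / 3 + x * t))
    atTop (nhds (Real.pi * (Ai x).re)))

include him hlim in
theorem airy_zero : Ai 0 = (√3 / (2 * Real.pi) * cubicMoment 0 : ℝ) := by
  obtain ⟨G, hG0, hG⟩ := exists_airyPhase_primitive 0
  have h1 := tendsto_airyPhase_primitive him hlim hG
  have hs : (√3 / 2) ^ 2 = 3 / 4 := by
    rw [div_pow, Real.sq_sqrt (by norm_num)]
    norm_num
  have hs0 : 0 < √3 / 2 := by positivity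
  have h2 := h1.comp (tendsto_id.atTop_mul_const hs0)
  have hp := tendsto_airyPhase_primitive_real hG0 hG hs
  have hm := tendsto_airyPhase_primitive_real hG0 hG (a := -(√3 / 2)) (by rw [neg_sq, hs])
  have h3 := tendsto_nhds_unique h2 ((hp.sub hm).congr fun r => by simp)
  have hpi : (Real.pi : ℂ) ≠ 0 := Complex.ofReal_ne_zero.2 Real.pi_ne_zero
  rw [Complex.ofReal_zero] at h3
  push_cast at h3 ⊢
  field_simp
  linear_combination h3

include hd him hlim in
theorem norm_airy_le {y : ℝ} (hy : 1 ≤ y) (z : ℂ) :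
    ‖Ai z‖ ≤ √(2 * Real.pi) * Real.exp (y ^ 3 / 3 - z.re * y + z.im ^ 2 / (2 * y)) := by
  have hy0 : 0 < y := by linarith
  have h := airy_eq_integral hd him hlim hy0 z
  set C := Real.exp (y ^ 3 / 3 - z.re * y + z.im ^ 2 / (2 * y)) with hC
  have h1 : ‖2 * Real.pi * Ai z‖ ≤ C * √(Real.pi / (y / 2)) := by
    rw [h, ← integral_gaussian, ← integral_const_mul]
    exact norm_integral_le_of_norm_le ((integrable_exp_neg_mul_sq (half_pos hy0)).const_mul C)
      (Eventually.of_forall fun t => norm_cexp_airyPhase_le hy0 t z)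
  have h2 : ‖Ai z‖ ≤ ‖2 * Real.pi * Ai z‖ := by
    have h3 : (1 : ℝ) ≤ 2 * Real.pi := by linarith [Real.pi_gt_three]
    have h4 : ‖(2 * Real.pi : ℂ)‖ = 2 * Real.pi := by
      simp [abs_of_pos Real.pi_pos]
    rw [norm_mul, h4]
    exact le_mul_of_one_le_left (norm_nonneg _) h3
  have h5 : √(Real.pi / (y / 2)) ≤ √(2 * Real.pi) := by
    apply Real.sqrt_le_sqrt
    rw [div_le_iff₀ (by positivity)]
    nlinarith [Real.pi_pos]
  calc _ ≤ _ := h2.trans h1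
    _ ≤ C * √(2 * Real.pi) := by gcongr
    _ = _ := mul_comm _ _

include hd him hlim in
/-- Superexponential decay of the Airy function in a sector of half-angle `π / 6`, widened by a
bounded amount. -/
theorem exists_norm_airy_le_sector (m : ℝ) : ∃ C : ℝ, ∀ z : ℂ,
    -1 ≤ z.re → z.im ^ 2 ≤ (z.re + 2) ^ 2 / 2 + 12 → ‖Ai z‖ ≤ C * Real.exp (-m * z.re) := by
  refine ⟨√(2 * Real.pi) * Real.exp (16 * |m| ^ 3 + 2 * |m| + 100), fun z hre him2 => ?_⟩
  have hx2 : 1 ≤ z.re + 2 := by linarith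
  set y := √(z.re + 2) with hy
  have hy1 : 1 ≤ y := Real.one_le_sqrt.2 hx2
  have hysq : y ^ 2 = z.re + 2 := Real.sq_sqrt (by linarith)
  refine (norm_airy_le hd him hlim hy1 z).trans ?_
  rw [mul_assoc, ← Real.exp_add]
  refine mul_le_mul_of_nonneg_left (Real.exp_le_exp.2 ?_) (Real.sqrt_nonneg _)
  have h1 : z.im ^ 2 / (2 * y) ≤ y ^ 3 / 4 + 6 := by
    rw [div_le_iff₀ (by positivity)]
    have : z.im ^ 2 ≤ y ^ 4 / 2 + 12 := by
      calc _ ≤ _ := him2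
        _ = _ := by rw [← hysq]; ring
    nlinarith
  have hre' : z.re = y ^ 2 - 2 := by linarith
  rw [hre']
  have h2 : m * y ^ 2 ≤ y ^ 3 / 4 + 16 * |m| ^ 3 := by
    have hm : m * y ^ 2 ≤ |m| * y ^ 2 := by gcongr; exact le_abs_self m
    have hm0 := abs_nonneg m
    rcases le_total y (4 * |m|) with h | h
    · have h3 : |m| * y ^ 2 ≤ |m| * (4 * |m|) ^ 2 := by gcongr
      have h4 : 0 ≤ y ^ 3 := by positivity
      nlinarith
    · have h3 : 0 ≤ (y - 4 * |m|) * y ^ 2 := mul_nonneg (by linarith) (sq_nonneg y)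
      have h4 : 0 ≤ |m| ^ 3 := by positivity
      nlinarith
  have h3 : 2 * y ≤ y ^ 3 / 6 + 94 := by
    have h : 0 ≤ (y - 1) * (y - 4) ^ 2 := mul_nonneg (by linarith) (sq_nonneg _)
    nlinarith [sq_nonneg (y - 4)]
  have h4 : -|m| ≤ m := neg_abs_le m
  nlinarith

end

theorem integrableOn_ofReal_cubicMoment (k : ℕ) :
    IntegrableOn (fun r : ℝ => ((r ^ k * Real.exp (-(r ^ 3) / 3) : ℝ) : ℂ)) (Ioi 0) :=
  (integrableOn_cubicMoment k).ofReal

/-- Superexponential decay of a function and its derivative along the ray of direction `d`. -/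
def RayDecay (w : ℂ → ℂ) (d : ℂ) : Prop :=
  ∀ m : ℝ, ∃ C : ℝ, ∀ y : ℝ, 0 ≤ y →
    ‖w (y * d)‖ ≤ C * Real.exp (-m * y) ∧ ‖deriv w (y * d)‖ ≤ C * Real.exp (-m * y)

/-- The Laplace transform of `w` along the ray of direction `d`. -/
def rayLaplace (w : ℂ → ℂ) (d c : ℂ) : ℂ :=
  ∫ y in Ioi (0 : ℝ), Complex.exp (-c * (y * d)) * w (y * d) * d

theorem hasDerivAt_comp_ray {w : ℂ → ℂ} (hw : Differentiable ℂ w) (d : ℂ) (y : ℝ) :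
    HasDerivAt (fun y : ℝ => w (y * d)) (deriv w (y * d) * d) y := by
  have h1 : HasDerivAt (fun y : ℝ => (y * d : ℂ)) d y := by
    simpa using (Complex.ofRealCLM.hasDerivAt (x := y)).mul_const d
  exact (hw (y * d)).hasDerivAt.comp y h1

theorem norm_cexp_ray_le {c d : ℂ} (hd1 : ‖d‖ = 1) {M y : ℝ} (hc : ‖c‖ ≤ M) (hy : 0 ≤ y) :
    ‖Complex.exp (-c * (y * d))‖ ≤ Real.exp (M * y) := by
  refine (Complex.norm_exp_le_exp_norm _).trans (Real.exp_le_exp.2 ?_)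
  rw [norm_mul, norm_mul, norm_neg, hd1, mul_one, Complex.norm_real, Real.norm_of_nonneg hy]
  gcongr

section

variable {w : ℂ → ℂ} {d : ℂ} (hw : Differentiable ℂ w) (hd1 : ‖d‖ = 1) (hdec : RayDecay w d)

theorem integrableOn_exp_neg_Ioi_zero : IntegrableOn (fun y : ℝ => Real.exp (-y)) (Ioi 0) :=
  integrableOn_exp_neg_Ioi 0

include hd1 hdec in
theorem exists_norm_rayLaplace_integrand_le (M : ℝ) : ∃ C : ℝ, ∀ c : ℂ, ‖c‖ ≤ M →
    ∀ y : ℝ, 0 ≤ y → ‖Complex.exp (-c * (y * d))‖ * ‖w (y * d)‖ * (1 + y) ≤ C * Real.exp (-y) ∧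
      ‖Complex.exp (-c * (y * d))‖ * ‖deriv w (y * d)‖ * (1 + y) ≤ C * Real.exp (-y) := by
  obtain ⟨C, hC⟩ := hdec (M + 2)
  refine ⟨C, fun c hc y hy => ?_⟩
  have h1 := norm_cexp_ray_le hd1 hc hy
  have h2 : 1 + y ≤ Real.exp y := by linarith [Real.add_one_le_exp y]
  have key : ∀ a : ℝ, 0 ≤ a → a ≤ C * Real.exp (-(M + 2) * y) →
      ‖Complex.exp (-c * (y * d))‖ * a * (1 + y) ≤ C * Real.exp (-y) := by
    intro a ha0 ha
    calc _ ≤ Real.exp (M * y) * (C * Real.exp (-(M + 2) * y)) * Real.exp y := by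
          have : 0 ≤ C * Real.exp (-(M + 2) * y) := ha0.trans ha
          gcongr
      _ = C * (Real.exp (M * y) * Real.exp (-(M + 2) * y) * Real.exp y) := by ring
      _ = _ := by
          rw [← Real.exp_add, ← Real.exp_add]
          ring_nf
  exact ⟨key _ (norm_nonneg _) (hC y hy).1, key _ (norm_nonneg _) (hC y hy).2⟩

include hw hd1 hdec in
theorem integrableOn_rayLaplace (c : ℂ) :
    IntegrableOn (fun y : ℝ => Complex.exp (-c * (y * d)) * w (y * d) * d) (Ioi 0) := by
  obtain ⟨C, hC⟩ := exists_norm_rayLaplace_integrand_le hd1 hdec ‖c‖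
  refine Integrable.mono' (integrableOn_exp_neg_Ioi_zero.const_mul C) ?_ ?_
  · have := hw.continuous
    exact Continuous.aestronglyMeasurable (by fun_prop)
  · filter_upwards [ae_restrict_mem measurableSet_Ioi] with y hy
    have hy0 : 0 < y := hy
    refine le_trans ?_ (hC c le_rfl y hy0.le).1
    rw [norm_mul, norm_mul, hd1]
    gcongr
    linarith

include hw hd1 hdec in
theorem hasDerivAt_rayLaplace (hode : ∀ z, deriv (deriv w) z = z * w z) (c : ℂ) :
    HasDerivAt (rayLaplace w d) (deriv w 0 + c * w 0 - c ^ 2 * rayLaplace w d c) c := by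
  have hcw := hw.continuous
  have hw' : Differentiable ℂ (deriv w) := hw.deriv
  obtain ⟨C, hC⟩ := exists_norm_rayLaplace_integrand_le hd1 hdec (‖c‖ + 1)
  have hder := hasDerivAt_integral_of_dominated_loc_of_deriv_le
    (μ := volume.restrict (Ioi (0 : ℝ)))
    (F := fun (c : ℂ) (y : ℝ) => Complex.exp (-c * (y * d)) * w (y * d) * d)
    (F' := fun (c : ℂ) (y : ℝ) => (Complex.exp (-c * (y * d)) * (-(y * d))) * w (y * d) * d)
    (bound := fun y => C * Real.exp (-y))
    (Metric.ball_mem_nhds c one_pos)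
    (Eventually.of_forall fun c => Continuous.aestronglyMeasurable (by fun_prop))
    (integrableOn_rayLaplace hw hd1 hdec c)
    (Continuous.aestronglyMeasurable (by fun_prop)) ?_
    (integrableOn_exp_neg_Ioi_zero.const_mul C) ?_
  · obtain ⟨hI, hder⟩ := hder
    convert! hder using 1
    set P : ℝ → ℂ := fun y => Complex.exp (-c * (y * d)) * (deriv w (y * d) + c * w (y * d))
    have hP : ∀ y : ℝ, HasDerivAt P (Complex.exp (-c * (y * d)) * (y * d) * w (y * d) * d
        - c ^ 2 * (Complex.exp (-c * (y * d)) * w (y * d) * d)) y := by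
      intro y
      have h1 : HasDerivAt (fun y : ℝ => Complex.exp (-c * (y * d)))
          (Complex.exp (-c * (y * d)) * (-c * d)) y := by
        have : HasDerivAt (fun y : ℝ => (-c * (y * d) : ℂ)) (-c * d) y := by
          simpa using ((Complex.ofRealCLM.hasDerivAt (x := y)).mul_const d).const_mul (-c)
        exact this.cexp
      have h2 := hasDerivAt_comp_ray hw d y
      have h3 := hasDerivAt_comp_ray hw' d y
      convert! h1.mul (h3.add (h2.const_mul c)) using 1
      rw [hode]
      simp only [Pi.add_apply]
      ring
    have hPlim : Tendsto P atTop (nhds 0) := by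
      have hb : Tendsto (fun y : ℝ => (C + ‖c‖ * C) * Real.exp (-y)) atTop (nhds 0) := by
        simpa using (Real.tendsto_exp_atBot.comp tendsto_neg_atTop_atBot).const_mul (C + ‖c‖ * C)
      refine squeeze_zero_norm' ?_ hb
      filter_upwards [eventually_ge_atTop 0] with y hy
      obtain ⟨ha, hb⟩ := hC c (by linarith) y hy
      have h1 := norm_add_le (deriv w (y * d)) (c * w (y * d))
      rw [norm_mul c] at h1
      have hc0 := norm_nonneg c
      have h4 : ‖Complex.exp (-c * (y * d))‖ * ‖w (y * d)‖ ≤ C * Real.exp (-y) :=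
        (le_mul_of_one_le_right (by positivity) (by linarith)).trans ha
      have h5 : ‖Complex.exp (-c * (y * d))‖ * ‖deriv w (y * d)‖ ≤ C * Real.exp (-y) :=
        (le_mul_of_one_le_right (by positivity) (by linarith)).trans hb
      calc ‖P y‖ = ‖Complex.exp (-c * (y * d))‖ * ‖deriv w (y * d) + c * w (y * d)‖ := norm_mul _ _
        _ ≤ ‖Complex.exp (-c * (y * d))‖ * (‖deriv w (y * d)‖ + ‖c‖ * ‖w (y * d)‖) := by gcongr
        _ = ‖Complex.exp (-c * (y * d))‖ * ‖deriv w (y * d)‖ +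
            ‖c‖ * (‖Complex.exp (-c * (y * d))‖ * ‖w (y * d)‖) := by ring
        _ ≤ C * Real.exp (-y) + ‖c‖ * (C * Real.exp (-y)) := by gcongr
        _ = _ := by ring
    have hI2 : IntegrableOn (fun y : ℝ =>
        Complex.exp (-c * (y * d)) * (y * d) * w (y * d) * d) (Ioi 0) := by
      refine hI.neg.congr (Eventually.of_forall fun y => ?_)
      simp only [Pi.neg_apply]
      ring
    have hI3 := (integrableOn_rayLaplace hw hd1 hdec c).const_mul (c ^ 2)
    have hI := integral_Ioi_of_hasDerivAt_of_tendsto' (fun y _ => hP y) (hI2.sub hI3) hPlim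
    rw [integral_sub hI2 hI3, integral_const_mul] at hI
    have hneg : ∫ y in Ioi (0 : ℝ), Complex.exp (-c * (y * d)) * (-(y * d)) * w (y * d) * d =
        -∫ y in Ioi (0 : ℝ), Complex.exp (-c * (y * d)) * (y * d) * w (y * d) * d := by
      rw [← integral_neg]
      congr 1
      ext y
      ring
    have hP0 : P 0 = deriv w 0 + c * w 0 := by simp [P]
    rw [hneg, rayLaplace]
    rw [hP0] at hI
    linear_combination hI
  · filter_upwards [ae_restrict_mem measurableSet_Ioi] with y hy z hz
    have hy0 : 0 < y := hy
    have hzM : ‖z‖ ≤ ‖c‖ + 1 := by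
      have h1 := norm_add_le (z - c) c
      rw [Metric.mem_ball, dist_eq_norm] at hz
      rw [sub_add_cancel] at h1
      linarith
    refine le_trans ?_ (hC z hzM y hy0.le).1
    rw [norm_mul, norm_mul, norm_mul, norm_neg, norm_mul, hd1, Complex.norm_real,
      Real.norm_of_nonneg hy0.le]
    have : 0 ≤ ‖Complex.exp (-z * (y * d))‖ * ‖w (y * d)‖ := by positivity
    nlinarith
  · refine Eventually.of_forall fun y z _ => ?_
    have h1 : HasDerivAt (fun z : ℂ => -z * (y * d)) (-(y * d)) z := by
      simpa using (hasDerivAt_id z).neg.mul_const (y * d)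
    exact (h1.cexp.mul_const _).mul_const _

include hw hd1 hdec in
/-- Along a direction `κ` in which `exp (c³/3)` decays and `rayLaplace w d` stays bounded, the
first-order equation of the Laplace transform can be integrated explicitly. -/
theorem rayLaplace_zero (hode : ∀ z, deriv (deriv w) z = z * w z) {κ : ℂ} (hκ : κ ^ 3 = -1)
    (hκd : 0 ≤ (κ * d).re) :
    rayLaplace w d 0 =
      -(κ * deriv w 0 * cubicMoment 0 + κ ^ 2 * w 0 * cubicMoment 1) := by
  set M : ℝ → ℂ := fun r => Real.exp (-(r ^ 3) / 3) * rayLaplace w d (r * κ)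
  have hM : ∀ r : ℝ, HasDerivAt M (κ * deriv w 0 * ((r ^ 0 * Real.exp (-(r ^ 3) / 3) : ℝ) : ℂ) +
      κ ^ 2 * w 0 * ((r ^ 1 * Real.exp (-(r ^ 3) / 3) : ℝ) : ℂ)) r := by
    intro r
    have h1 : HasDerivAt (fun r : ℝ => (r * κ : ℂ)) κ r := by
      simpa using (Complex.ofRealCLM.hasDerivAt (x := r)).mul_const κ
    have h2 := (hasDerivAt_rayLaplace hw hd1 hdec hode (r * κ)).comp r h1
    have h3 : HasDerivAt (fun r : ℝ => Real.exp (-(r ^ 3) / 3))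
        (Real.exp (-(r ^ 3) / 3) * -(r ^ 2)) r := by
      have : HasDerivAt (fun r : ℝ => -(r ^ 3) / 3) (-(r ^ 2)) r := by
        convert! ((hasDerivAt_pow 3 r).neg.div_const 3) using 1
        push_cast
        ring
      exact this.exp
    convert! h3.ofReal_comp.mul h2 using 1
    simp only [Function.comp_apply]
    push_cast
    linear_combination (Complex.exp (-(r ^ 3) / 3) * r ^ 2 * rayLaplace w d (r * κ)) * hκ
  obtain ⟨C, hC⟩ := hdec 1
  have hLb : ∀ r : ℝ, 0 ≤ r → ‖rayLaplace w d (r * κ)‖ ≤ ∫ y in Ioi (0 : ℝ),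
      C * Real.exp (-y) := by
    intro r hr
    refine norm_integral_le_of_norm_le (integrableOn_exp_neg_Ioi_zero.const_mul C) ?_
    filter_upwards [ae_restrict_mem measurableSet_Ioi] with y hy
    have hy0 : 0 < y := hy
    have h1 : ‖Complex.exp (-(r * κ) * (y * d))‖ ≤ 1 := by
      rw [Complex.norm_exp, Real.exp_le_one_iff]
      have : (-(r * κ) * (y * d)) = ((-(r * y) : ℝ) : ℂ) * (κ * d) := by push_cast; ring
      rw [this, Complex.re_ofReal_mul]
      nlinarith [mul_nonneg hr hy0.le]
    rw [norm_mul, norm_mul, hd1, mul_one]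
    have h2 := (hC y hy0.le).1
    rw [neg_one_mul] at h2
    calc _ ≤ 1 * ‖w (y * d)‖ := by gcongr
      _ ≤ _ := by rw [one_mul]; exact h2
  have hMlim : Tendsto M atTop (nhds 0) := by
    have hb : Tendsto (fun r : ℝ => Real.exp (-(r ^ 3) / 3) *
        ∫ y in Ioi (0 : ℝ), C * Real.exp (-y)) atTop (nhds 0) := by
      have : Tendsto (fun r : ℝ => -(r ^ 3) / 3) atTop atBot :=
        (tendsto_neg_atTop_atBot.comp
          (tendsto_pow_atTop (α := ℝ) three_ne_zero)).atBot_div_const three_pos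
      simpa using (Real.tendsto_exp_atBot.comp this).mul_const
        (∫ y in Ioi (0 : ℝ), C * Real.exp (-y))
    refine squeeze_zero_norm' ?_ hb
    filter_upwards [eventually_ge_atTop 0] with r hr
    rw [norm_mul, Complex.norm_real, Real.norm_of_nonneg (Real.exp_pos _).le]
    exact mul_le_mul_of_nonneg_left (hLb r hr) (Real.exp_pos _).le
  have hi0 := (integrableOn_ofReal_cubicMoment 0).const_mul (κ * deriv w 0)
  have hi1 := (integrableOn_ofReal_cubicMoment 1).const_mul (κ ^ 2 * w 0)
  have hI := integral_Ioi_of_hasDerivAt_of_tendsto' (fun y _ => hM y) (hi0.add hi1) hMlim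
  rw [integral_add hi0 hi1, integral_const_mul, integral_const_mul, integral_complex_ofReal,
    integral_complex_ofReal] at hI
  have hM0 : M 0 = rayLaplace w d 0 := by simp [M]
  rw [hM0] at hI
  simp only [cubicMoment]
  linear_combination hI

end

theorem le_of_hasDerivAt_nonneg {f f' : ℝ → ℝ} {a b : ℝ} (hab : a ≤ b)
    (hf : ∀ x, HasDerivAt f (f' x) x) (h : ∀ x, a ≤ x → x ≤ b → 0 ≤ f' x) : f a ≤ f b := by
  refine monotoneOn_of_hasDerivWithinAt_nonneg (convex_Icc a b)
    (fun x _ => (hf x).continuousAt.continuousWithinAt) (fun x _ => (hf x).hasDerivWithinAt)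
    (fun x hx => ?_) (left_mem_Icc.2 hab) (right_mem_Icc.2 hab) hab
  rw [interior_Icc] at hx
  exact h x hx.1.le hx.2.le

/-- Growth of solutions of `v'' = -ε i u v`, written in real and imaginary parts. -/
theorem airy_imaginary_growth {p q p' q' : ℝ → ℝ} {ε α β : ℝ} (hε : ε ^ 2 = 1)
    (hp : ∀ u, HasDerivAt p (p' u) u) (hq : ∀ u, HasDerivAt q (q' u) u)
    (hp' : ∀ u, HasDerivAt p' (ε * u * q u) u) (hq' : ∀ u, HasDerivAt q' (-(ε * u * p u)) u)
    (hp0 : p 0 = α) (hq0 : q 0 = 0) (hp'0 : p' 0 = 0) (hq'0 : q' 0 = ε * β) (hαβ : α * β ≤ 0)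
    {u : ℝ} (hu : 0 ≤ u) :
    α ^ 2 ≤ p u ^ 2 + q u ^ 2 ∧ α ^ 4 * u ^ 6 / 60 ≤ (p u ^ 2 + q u ^ 2) ^ 2 := by
  set h : ℝ → ℝ := fun u => p u ^ 2 + q u ^ 2 with hh
  have hhd : ∀ u, HasDerivAt h (2 * (p u * p' u + q u * q' u)) u := fun u => by
    convert! ((hp u).pow 2).add ((hq u).pow 2) using 1
    push_cast
    ring
  have hhd' : ∀ u, HasDerivAt (fun u => 2 * (p u * p' u + q u * q' u))
      (2 * (p' u ^ 2 + q' u ^ 2)) u := fun u => by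
    convert! (((hp u).mul (hp' u)).add ((hq u).mul (hq' u))).const_mul 2 using 1
    ring
  have hθ : ∀ u, HasDerivAt (fun u => ε * (q' u * p u - p' u * q u)) (-(u * h u)) u := fun u => by
    convert! (((hq' u).mul (hp u)).sub ((hp' u).mul (hq u))).const_mul ε using 1
    simp only [hh]
    linear_combination (-u * (p u ^ 2 + q u ^ 2)) * (-hε)
  have hh0 : h 0 = α ^ 2 := by simp [hh, hp0, hq0]
  have hh'nn : ∀ u, 0 ≤ u → 0 ≤ 2 * (p u * p' u + q u * q' u) := fun u hu => by
    have := le_of_hasDerivAt_nonneg hu hhd' fun x _ _ => by positivity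
    simpa [hp'0, hq0] using this
  have hmono : ∀ a b, 0 ≤ a → a ≤ b → h a ≤ h b := fun a b ha hab =>
    le_of_hasDerivAt_nonneg hab hhd fun x hx _ => hh'nn x (ha.trans hx)
  have hlow : ∀ u, 0 ≤ u → α ^ 2 ≤ h u := fun u hu => hh0 ▸ hmono 0 u le_rfl hu
  refine ⟨hlow u hu, ?_⟩
  have hθle : ∀ u, 0 ≤ u → ε * (q' u * p u - p' u * q u) ≤ -(α ^ 2 * u ^ 2 / 2) := fun u hu => by
    have hder : ∀ u, HasDerivAt (fun u => -(α ^ 2 * u ^ 2 / 2) - ε * (q' u * p u - p' u * q u))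
        (u * (h u - α ^ 2)) u := fun u => by
      convert! (((((hasDerivAt_id u).pow 2).const_mul (α ^ 2)).div_const 2).neg).sub (hθ u) using 1
      simp only [id]
      push_cast
      ring
    have := le_of_hasDerivAt_nonneg hu hder fun x hx _ =>
      mul_nonneg hx (sub_nonneg.2 (hlow x hx))
    simp only [hp0, hq0, hp'0, hq'0] at this
    nlinarith
  have hhh : ∀ u, 0 ≤ u → α ^ 4 * u ^ 4 / 2 ≤ h u * (2 * (p' u ^ 2 + q' u ^ 2)) := fun u hu => by
    have h1 : (α ^ 2 * u ^ 2 / 2) ^ 2 ≤ (ε * (q' u * p u - p' u * q u)) ^ 2 := by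
      have := hθle u hu
      have h2 : 0 ≤ α ^ 2 * u ^ 2 / 2 := by positivity
      nlinarith
    rw [mul_pow, hε, one_mul] at h1
    simp only [hh]
    nlinarith [sq_nonneg (p u * p' u + q u * q' u)]
  rcases (by positivity : 0 ≤ h u).eq_or_lt with h0 | hpos
  · have : α ^ 2 = 0 := le_antisymm (h0 ▸ hlow u hu) (sq_nonneg _)
    have h4 : α ^ 4 = 0 := by rw [show α ^ 4 = (α ^ 2) ^ 2 by ring, this]; ring
    rw [h4]
    simp only [zero_mul, zero_div]
    positivity
  · set b : ℝ := α ^ 4 / (2 * h u) with hb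
    have hb0 : 0 ≤ b := by positivity
    have hbb : ∀ x, 0 ≤ x → x ≤ u → b * x ^ 4 ≤ 2 * (p' x ^ 2 + q' x ^ 2) := fun x hx hxu => by
      have h1 := hhh x hx
      have h2 : h x * (2 * (p' x ^ 2 + q' x ^ 2)) ≤ h u * (2 * (p' x ^ 2 + q' x ^ 2)) := by
        have := hmono x u hx hxu
        gcongr
      rw [hb, div_mul_eq_mul_div, div_le_iff₀ (by positivity)]
      linarith
    have hb1 : ∀ x, 0 ≤ x → x ≤ u → b * x ^ 5 / 5 ≤ 2 * (p x * p' x + q x * q' x) :=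
      fun x hx hxu => by
      have hder : ∀ x, HasDerivAt (fun x => 2 * (p x * p' x + q x * q' x) - b * x ^ 5 / 5)
          (2 * (p' x ^ 2 + q' x ^ 2) - b * x ^ 4) x := fun x => by
        convert! (hhd' x).sub (((hasDerivAt_pow 5 x).const_mul b).div_const 5) using 1
        push_cast
        ring
      have := le_of_hasDerivAt_nonneg hx hder fun y hy hyx =>
        sub_nonneg.2 (hbb y hy (hyx.trans hxu))
      simp only [hp'0, hq0] at this
      nlinarith
    have hb2 : b * u ^ 6 / 30 ≤ h u := by
      have hder : ∀ x, HasDerivAt (fun x => h x - b * x ^ 6 / 30)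
          (2 * (p x * p' x + q x * q' x) - b * x ^ 5 / 5) x := fun x => by
        convert! (hhd x).sub (((hasDerivAt_pow 6 x).const_mul b).div_const 30) using 1
        push_cast
        ring
      have := le_of_hasDerivAt_nonneg hu hder fun y hy hyx => sub_nonneg.2 (hb1 y hy hyx)
      have h3 : 0 ≤ h 0 := by rw [hh0]; positivity
      linarith
    have h5 : b * u ^ 6 / 30 * h u = α ^ 4 * u ^ 6 / 60 := by
      rw [hb]
      field_simp
      ring
    calc _ = b * u ^ 6 / 30 * h u := h5.symm
      _ ≤ h u * h u := by gcongr
      _ = _ := (sq _).symm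

/-- A nonnegative solution of `H'' ≥ 2 y H` vanishing at infinity decays faster than every
exponential, with explicit constants. -/
theorem decay_of_two_mul_le_deriv {H H' H'' : ℝ → ℝ} (hH : ∀ y, HasDerivAt H (H' y) y)
    (hH' : ∀ y, HasDerivAt H' (H'' y) y) (hpos : ∀ y, 0 ≤ H y)
    (hconv : ∀ y, 0 ≤ y → 2 * y * H y ≤ H'' y) (hlim : Tendsto H atTop (nhds 0))
    (hlim' : Tendsto H' atTop (nhds 0)) {n y : ℝ} (hn : 0 ≤ n) (hy : 0 ≤ y) :
    H y ≤ H 0 * Real.exp (n ^ 3 / 2 - n * y) := by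
  have key : ∀ m : ℝ, 0 ≤ m → ∀ x, m ^ 2 / 2 ≤ x → H' x + m * H x ≤ 0 := by
    intro m hm x hx
    have hx0 : 0 ≤ x := le_trans (by positivity) hx
    have hexp : ∀ x, HasDerivAt (fun x => Real.exp (-m * x)) (Real.exp (-m * x) * -m) x :=
      fun x => by
      have : HasDerivAt (fun x => -m * x) (-m) x := by
        simpa using (hasDerivAt_id x).const_mul (-m)
      exact this.exp
    have hder : ∀ x, HasDerivAt (fun x => (H' x + m * H x) * Real.exp (-m * x))
        ((H'' x - m ^ 2 * H x) * Real.exp (-m * x)) x := fun x => by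
      convert! ((hH' x).add ((hH x).const_mul m)).mul (hexp x) using 1
      simp only [Pi.add_apply]
      ring
    have hl : Tendsto (fun x => (H' x + m * H x) * Real.exp (-m * x)) atTop (nhds 0) := by
      have h1 : Tendsto (fun x => ‖H' x + m * H x‖) atTop (nhds 0) := by
        simpa using (hlim'.add (hlim.const_mul m)).norm
      refine squeeze_zero_norm' ?_ h1
      filter_upwards [eventually_ge_atTop 0] with x hx
      rw [norm_mul]
      refine mul_le_of_le_one_right (norm_nonneg _) ?_
      rw [Real.norm_of_nonneg (Real.exp_pos _).le, Real.exp_le_one_iff]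
      nlinarith
    have h2 : (H' x + m * H x) * Real.exp (-m * x) ≤ 0 := by
      refine ge_of_tendsto hl ?_
      filter_upwards [eventually_ge_atTop x] with Y hY
      refine le_of_hasDerivAt_nonneg hY hder fun z hz _ => mul_nonneg ?_ (Real.exp_pos _).le
      have h3 := hconv z (hx0.trans hz)
      have h4 : m ^ 2 * H z ≤ 2 * z * H z :=
        mul_le_mul_of_nonneg_right (by linarith) (hpos z)
      linarith
    exact nonpos_of_mul_nonpos_left h2 (Real.exp_pos _)
  have hanti : ∀ x, 0 ≤ x → H x ≤ H 0 := fun x hx => by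
    have := le_of_hasDerivAt_nonneg (f := fun x => -H x) hx (fun x => (hH x).neg) fun z hz _ => by
      have := key 0 le_rfl z (by simpa using hz)
      linarith
    linarith
  have hH0 := hpos 0
  rcases le_total y (n ^ 2 / 2) with h | h
  · refine (hanti y hy).trans (le_mul_of_one_le_right hH0 (Real.one_le_exp ?_))
    nlinarith
  · have hder : ∀ x, HasDerivAt (fun x => -(H x * Real.exp (n * x)))
        (-((H' x + n * H x) * Real.exp (n * x))) x := fun x => by
      have h1 : HasDerivAt (fun x => n * x) n x := by simpa using (hasDerivAt_id x).const_mul n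
      convert! ((hH x).mul h1.exp).neg using 1
      ring
    have h1 := le_of_hasDerivAt_nonneg h hder fun z hz _ =>
      neg_nonneg.2 (mul_nonpos_of_nonpos_of_nonneg (key n hn z hz) (Real.exp_pos _).le)
    have h2 : H y * Real.exp (n * y) ≤ H 0 * Real.exp (n ^ 3 / 2) := by
      have h3 : H (n ^ 2 / 2) * Real.exp (n * (n ^ 2 / 2)) ≤ H 0 * Real.exp (n ^ 3 / 2) := by
        rw [show n * (n ^ 2 / 2) = n ^ 3 / 2 by ring]
        exact mul_le_mul_of_nonneg_right (hanti _ (by positivity)) (Real.exp_pos _).le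
      linarith
    rw [Real.exp_sub, ← mul_div_assoc, le_div_iff₀ (Real.exp_pos _)]
    exact h2

section

variable {Ai : ℂ → ℂ} (hd : Differentiable ℂ Ai) (him : ∀ x : ℝ, (Ai x).im = 0)
  (hlim : ∀ x : ℝ, Tendsto (fun R : ℝ => ∫ t in (0:ℝ)..R, Real.cos (t ^ 3 / 3 + x * t))
      atTop (nhds (Real.pi * (Ai x).re)))

/-- Superexponential decay of a function and its derivative in the sector `|arg z| ≤ π/6`. -/
def SectorDecay (w : ℂ → ℂ) : Prop :=
  ∀ m : ℝ, ∃ C : ℝ, ∀ z : ℂ, 0 ≤ z.re → 3 * z.im ^ 2 ≤ z.re ^ 2 →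
    ‖w z‖ ≤ C * Real.exp (-m * z.re) ∧ ‖deriv w z‖ ≤ C * Real.exp (-m * z.re)

include hd him hlim in
theorem sectorDecay_airy : SectorDecay Ai := by
  intro m
  obtain ⟨C, hC⟩ := exists_norm_airy_le_sector hd him hlim m
  have hball : ∀ z : ℂ, 0 ≤ z.re → 3 * z.im ^ 2 ≤ z.re ^ 2 → ∀ v : ℂ, ‖v‖ ≤ 1 →
      ‖Ai (z + v)‖ ≤ |C| * Real.exp |m| * Real.exp (-m * z.re) := by
    intro z hz hz' v hv
    have ha := abs_le.1 ((Complex.abs_re_le_norm v).trans hv)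
    have hb := abs_le.1 ((Complex.abs_im_le_norm v).trans hv)
    refine (hC (z + v) ?_ ?_).trans ?_
    · rw [Complex.add_re]; linarith
    · rw [Complex.add_re, Complex.add_im]
      nlinarith [sq_nonneg (z.im - 4 * v.im), mul_nonneg hz (neg_le_iff_add_nonneg'.1 ha.1)]
    · rw [mul_assoc, ← Real.exp_add]
      refine mul_le_mul (le_abs_self C) (Real.exp_le_exp.2 ?_) (Real.exp_pos _).le (abs_nonneg _)
      have : -(m * v.re) ≤ |m| := by
        refine (neg_le_abs _).trans ?_
        rw [abs_mul]
        exact mul_le_of_le_one_right (abs_nonneg _) (abs_le.2 ha)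
      rw [Complex.add_re]
      linarith
  refine ⟨|C| * Real.exp |m|, fun z hz hz' => ⟨?_, ?_⟩⟩
  · simpa using hball z hz hz' 0 (by simp)
  · have := Complex.norm_deriv_le_of_forall_mem_sphere_norm_le (c := z) one_pos
      hd.diffContOnCl (C := |C| * Real.exp |m| * Real.exp (-m * z.re)) (fun v hv => by
        have h1 := hball z hz hz' (v - z) (by
          rw [mem_sphere_iff_norm] at hv; exact hv.le)
        simpa using h1)
    simpa using this

theorem SectorDecay.rayDecay {w : ℂ → ℂ} (hw : SectorDecay w) {ω d : ℂ}
    (hpos : 0 < (ω * d).re) (h3 : 3 * (ω * d).im ^ 2 ≤ (ω * d).re ^ 2) :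
    RayDecay (fun z => w (ω * z)) d := by
  intro m
  obtain ⟨C, hC⟩ := hw (m / (ω * d).re)
  refine ⟨(1 + ‖ω‖) * |C|, fun y hy => ?_⟩
  have hre : (ω * (y * d)).re = y * (ω * d).re := by
    rw [mul_left_comm, Complex.re_ofReal_mul]
  have him : (ω * (y * d)).im = y * (ω * d).im := by
    rw [mul_left_comm, Complex.im_ofReal_mul]
  obtain ⟨h1, h2⟩ := hC (ω * (y * d)) (by rw [hre]; positivity) (by
    rw [hre, him, mul_pow, mul_pow]
    nlinarith [sq_nonneg y])
  have he : -(m / (ω * d).re) * (ω * (y * d)).re = -m * y := by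
    rw [hre]
    field_simp
  rw [he] at h1 h2
  have hE := Real.exp_pos (-m * y)
  have hCC : C * Real.exp (-m * y) ≤ |C| * Real.exp (-m * y) := by
    gcongr
    exact le_abs_self C
  have hω := norm_nonneg ω
  have hnn : 0 ≤ |C| * Real.exp (-m * y) := by positivity
  constructor
  · nlinarith
  · rw [deriv_comp_mul_left, norm_smul]
    have := mul_le_mul_of_nonneg_left (h2.trans hCC) hω
    nlinarith

/-- The primitive sixth root of unity `exp (ε i π / 3)` for `ε = ±1`. -/
def sixthRoot (ε : ℝ) : ℂ := ⟨1 / 2, ε * (√3 / 2)⟩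

theorem sixthRoot_sq {ε : ℝ} (hε : ε ^ 2 = 1) : sixthRoot ε ^ 2 = sixthRoot ε - 1 := by
  have h3 : √3 ^ 2 = 3 := Real.sq_sqrt (by norm_num)
  apply Complex.ext
  · simp [sixthRoot, sq]
    linear_combination (-1 / 4) * h3 * ε ^ 2 - 3 / 4 * hε
  · simp [sixthRoot, sq]
    ring

theorem sixthRoot_cube {ε : ℝ} (hε : ε ^ 2 = 1) : sixthRoot ε ^ 3 = -1 := by
  linear_combination (sixthRoot ε + 1) * sixthRoot_sq hε

theorem sixthRoot_neg (ε : ℝ) : sixthRoot (-ε) = 1 - sixthRoot ε := by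
  apply Complex.ext
  · simp [sixthRoot]
    norm_num
  · simp [sixthRoot]

theorem norm_ofReal_mul_I {ε : ℝ} (hε : ε ^ 2 = 1) : ‖(ε * Complex.I : ℂ)‖ = 1 := by
  rw [norm_mul, Complex.norm_I, mul_one, Complex.norm_real, Real.norm_eq_abs]
  exact (pow_eq_one_iff_of_nonneg (abs_nonneg ε) two_ne_zero).1 (by rw [sq_abs, hε])

/-- The rotated solution of the equation `w'' = z w` which decays in the direction `ε i`. -/
def rotated (w : ℂ → ℂ) (ε : ℝ) (z : ℂ) : ℂ := w (-sixthRoot ε * z)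

theorem Differentiable.rotated {w : ℂ → ℂ} (hw : Differentiable ℂ w) (ε : ℝ) :
    Differentiable ℂ (rotated w ε) :=
  hw.comp (differentiable_id.const_mul _)

theorem deriv_rotated (w : ℂ → ℂ) (ε : ℝ) :
    deriv (rotated w ε) = fun z => -sixthRoot ε * deriv w (-sixthRoot ε * z) := by
  ext z
  exact deriv_comp_mul_left (-sixthRoot ε) w z

theorem rotated_ode {w : ℂ → ℂ} (hode : ∀ z, deriv (deriv w) z = z * w z) {ε : ℝ}
    (hε : ε ^ 2 = 1) (z : ℂ) : deriv (deriv (rotated w ε)) z = z * rotated w ε z := by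
  rw [deriv_rotated, deriv_const_mul_field, deriv_comp_mul_left, hode, rotated, smul_eq_mul]
  linear_combination (-(z * w (-sixthRoot ε * z))) * sixthRoot_cube hε

theorem SectorDecay.rayDecay_rotated {w : ℂ → ℂ} (hw : SectorDecay w) {ε : ℝ} (hε : ε ^ 2 = 1) :
    RayDecay (rotated w ε) (ε * Complex.I) := by
  have h3 : √3 ^ 2 = 3 := Real.sq_sqrt (by norm_num)
  have hre : (-sixthRoot ε * (ε * Complex.I)).re = √3 / 2 := by
    simp [sixthRoot]
    linear_combination (√3 / 2) * hε
  have him : (-sixthRoot ε * (ε * Complex.I)).im = -(ε / 2) := by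
    simp [sixthRoot]
    ring
  refine hw.rayDecay ?_ ?_
  · rw [hre]; positivity
  · rw [hre, him]
    nlinarith

theorem SectorDecay.rayDecay_one {w : ℂ → ℂ} (hw : SectorDecay w) : RayDecay w 1 := by
  simpa using hw.rayDecay (ω := 1) (d := 1) (by simp) (by simp)

include hd him hlim in
theorem deriv_airy_zero (hode : ∀ z, deriv (deriv Ai) z = z * Ai z) :
    deriv Ai 0 = (-(√3 / (2 * Real.pi) * cubicMoment 1) : ℝ) := by
  have hdec := (sectorDecay_airy hd him hlim).rayDecay_one
  have key : ∀ ε : ℝ, ε ^ 2 = 1 → rayLaplace Ai 1 0 =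
      -(sixthRoot ε * deriv Ai 0 * cubicMoment 0 + sixthRoot ε ^ 2 * Ai 0 * cubicMoment 1) :=
    fun ε hε => rayLaplace_zero hd norm_one hdec hode (sixthRoot_cube hε)
      (by simp [sixthRoot])
  have h1 := key 1 (by norm_num)
  have h2 := key (-1) (by norm_num)
  rw [sixthRoot_sq (by norm_num), sixthRoot_neg] at h2
  rw [sixthRoot_sq (by norm_num)] at h1
  have h0 := airy_zero him hlim
  have hne : (2 * sixthRoot 1 - 1 : ℂ) ≠ 0 := by
    intro h
    have := congrArg Complex.im h
    simp [sixthRoot] at this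
  have hH : (cubicMoment 0 : ℂ) ≠ 0 := by
    exact_mod_cast (cubicMoment_pos 0).ne'
  have hk : deriv Ai 0 * cubicMoment 0 + Ai 0 * cubicMoment 1 = 0 := by
    refine (mul_eq_zero.1 (?_ : (2 * sixthRoot 1 - 1) * _ = 0)).resolve_left hne
    linear_combination h1 - h2
  refine mul_right_cancel₀ hH ?_
  rw [h0] at hk
  push_cast at hk ⊢
  linear_combination hk

include hd him hlim in
theorem rayLaplace_airy_zero (hode : ∀ z, deriv (deriv Ai) z = z * Ai z) :
    rayLaplace Ai 1 0 = (√3 / (2 * Real.pi) * cubicMoment 0 * cubicMoment 1 : ℝ) := by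
  have hdec := (sectorDecay_airy hd him hlim).rayDecay_one
  rw [rayLaplace_zero hd norm_one hdec hode (sixthRoot_cube (ε := 1) (by norm_num))
      (by simp [sixthRoot]), airy_zero him hlim, deriv_airy_zero hd him hlim hode,
      sixthRoot_sq (by norm_num)]
  push_cast
  ring

include hd him hlim in
theorem rayLaplace_rotated_zero (hode : ∀ z, deriv (deriv Ai) z = z * Ai z) {ε : ℝ}
    (hε : ε ^ 2 = 1) : rayLaplace (rotated Ai ε) (ε * Complex.I) 0 =
      (sixthRoot ε - 1) * (√3 / (2 * Real.pi) * cubicMoment 0 * cubicMoment 1 : ℝ) := by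
  have hdec := (sectorDecay_airy hd him hlim).rayDecay_rotated hε
  have hre : 0 ≤ (sixthRoot (-ε) * (ε * Complex.I)).re := by
    simp [sixthRoot]
    nlinarith [Real.sqrt_nonneg 3]
  have hε' : (-ε) ^ 2 = 1 := by rw [neg_sq, hε]
  rw [rayLaplace_zero (hd.rotated ε) (norm_ofReal_mul_I hε) hdec (rotated_ode hode hε)
    (sixthRoot_cube hε') hre,
    sixthRoot_sq hε', deriv_rotated, rotated]
  simp only [mul_zero]
  rw [airy_zero him hlim, deriv_airy_zero hd him hlim hode, sixthRoot_neg]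
  push_cast
  linear_combination (√3 / (2 * Real.pi) * cubicMoment 0 * cubicMoment 1 : ℂ) * sixthRoot_sq hε

end

section

variable {w : ℂ → ℂ} (hw : Differentiable ℂ w) (hdec : SectorDecay w)
  (hode : ∀ z, deriv (deriv w) z = z * w z)

theorem add_ofReal_mem_sector {z : ℂ} {y : ℝ} (hz : z.re = 0) (hy : 2 * ‖z‖ ≤ y) :
    0 ≤ (z + y).re ∧ 3 * (z + y).im ^ 2 ≤ (z + y).re ^ 2 := by
  have h0 := norm_nonneg z
  have h1 := Complex.abs_im_le_norm z
  have h2 : z.im ^ 2 ≤ ‖z‖ ^ 2 := by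
    rw [← sq_abs]
    gcongr
  simp only [Complex.add_re, Complex.add_im, Complex.ofReal_re, Complex.ofReal_im, hz, zero_add,
    add_zero]
  exact ⟨by linarith, by nlinarith⟩

include hdec in
theorem SectorDecay.tendsto_add_ofReal {z : ℂ} (hz : z.re = 0) :
    Tendsto (fun y : ℝ => w (z + y)) atTop (nhds 0) ∧
      Tendsto (fun y : ℝ => deriv w (z + y)) atTop (nhds 0) := by
  obtain ⟨C, hC⟩ := hdec 1
  have hb : Tendsto (fun y : ℝ => C * Real.exp (-y)) atTop (nhds 0) := by
    simpa using (Real.tendsto_exp_atBot.comp tendsto_neg_atTop_atBot).const_mul C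
  have key : ∀ y : ℝ, 2 * ‖z‖ ≤ y →
      ‖w (z + y)‖ ≤ C * Real.exp (-y) ∧ ‖deriv w (z + y)‖ ≤ C * Real.exp (-y) := fun y hy => by
    have h := add_ofReal_mem_sector hz hy
    simpa [hz] using hC (z + y) h.1 h.2
  constructor
  · refine squeeze_zero_norm' ?_ hb
    filter_upwards [eventually_ge_atTop (2 * ‖z‖)] with y hy using (key y hy).1
  · refine squeeze_zero_norm' ?_ hb
    filter_upwards [eventually_ge_atTop (2 * ‖z‖)] with y hy using (key y hy).2

theorem HasDerivAt.complex_re {f : ℝ → ℂ} {f' : ℂ} {x : ℝ} (h : HasDerivAt f f' x) :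
    HasDerivAt (fun x => (f x).re) f'.re x :=
  Complex.reCLM.hasFDerivAt.comp_hasDerivAt x h

theorem HasDerivAt.complex_im {f : ℝ → ℂ} {f' : ℂ} {x : ℝ} (h : HasDerivAt f f' x) :
    HasDerivAt (fun x => (f x).im) f'.im x :=
  Complex.imCLM.hasFDerivAt.comp_hasDerivAt x h

theorem hasDerivAt_comp_add_ofReal {f : ℂ → ℂ} (hf : Differentiable ℂ f) (z : ℂ) (y : ℝ) :
    HasDerivAt (fun y : ℝ => f (z + y)) (deriv f (z + y)) y := by
  have h1 : HasDerivAt (fun y : ℝ => (z + y : ℂ)) 1 y := by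
    simpa using (Complex.ofRealCLM.hasDerivAt (x := y)).const_add z
  exact ((hf (z + y)).hasDerivAt.comp y h1).congr_deriv (mul_one _)

include hw hdec hode in
/-- Decay of the recessive solution to the right of the imaginary axis, relative to its value
on the axis. -/
theorem norm_add_ofReal_le {z : ℂ} (hz : z.re = 0) {n y : ℝ} (hn : 0 ≤ n) (hy : 0 ≤ y) :
    ‖w (z + y)‖ ≤ ‖w z‖ * Real.exp (n ^ 3 / 4 - n / 2 * y) := by
  have hv := hasDerivAt_comp_add_ofReal hw z
  have hv' := hasDerivAt_comp_add_ofReal hw.deriv z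
  obtain ⟨hl, hl'⟩ := hdec.tendsto_add_ofReal hz
  have hp := (Complex.continuous_re.tendsto 0).comp hl
  have hq := (Complex.continuous_im.tendsto 0).comp hl
  have hp' := (Complex.continuous_re.tendsto 0).comp hl'
  have hq' := (Complex.continuous_im.tendsto 0).comp hl'
  have h := decay_of_two_mul_le_deriv
    (H := fun y : ℝ => (w (z + y)).re ^ 2 + (w (z + y)).im ^ 2)
    (H' := fun y : ℝ => 2 * ((w (z + y)).re * (deriv w (z + y)).re +
      (w (z + y)).im * (deriv w (z + y)).im))
    (H'' := fun y : ℝ => 2 * ((deriv w (z + y)).re ^ 2 + (deriv w (z + y)).im ^ 2) +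
      2 * y * ((w (z + y)).re ^ 2 + (w (z + y)).im ^ 2))
    (fun y => by
      convert! ((hv y).complex_re.pow 2).add ((hv y).complex_im.pow 2) using 1
      push_cast
      ring)
    (fun y => by
      convert! (((hv y).complex_re.mul (hv' y).complex_re).add
        ((hv y).complex_im.mul (hv' y).complex_im)).const_mul 2 using 1
      rw [hode]
      simp only [Complex.mul_re, Complex.mul_im, Complex.add_re, Complex.add_im, Complex.ofReal_re,
        Complex.ofReal_im, hz]
      ring)
    (fun y => by positivity)
    (fun y _ => le_add_of_nonneg_left (by positivity))
    (by simpa using (hp.pow 2).add (hq.pow 2))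
    (by simpa using ((hp.mul hp').add (hq.mul hq')).const_mul 2) hn hy
  have hsq : ∀ v : ℂ, v.re ^ 2 + v.im ^ 2 = ‖v‖ ^ 2 := fun v => by
    rw [Complex.sq_norm, Complex.normSq_apply]
    ring
  simp only [hsq, Complex.ofReal_zero, add_zero] at h
  refine (sq_le_sq₀ (norm_nonneg _) (by positivity)).1 ?_
  refine h.trans_eq ?_
  rw [mul_pow, ← Real.exp_nat_mul]
  congr 2
  push_cast
  ring

/-- The integral of `exp (-c z) w z` over the horizontal half-line starting at `z`. -/
def halfLaplace (w : ℂ → ℂ) (c z : ℂ) : ℂ :=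
  ∫ y in Ioi (0 : ℝ), Complex.exp (-c * (z + y)) * w (z + y)

include hw hdec hode in
theorem exists_norm_halfLaplace_integrand_le (c : ℝ) : ∃ K : ℝ, ∀ z : ℂ, z.re = 0 →
    ∀ y : ℝ, 0 ≤ y →
      ‖Complex.exp (-c * (z + y)) * w (z + y)‖ ≤ K * ‖w z‖ * Real.exp (-y) := by
  set n : ℝ := 2 * (|c| + 1) with hn
  refine ⟨Real.exp (n ^ 3 / 4), fun z hz y hy => ?_⟩
  have h1 := norm_add_ofReal_le hw hdec hode hz (n := n) (by positivity) hy
  have h2 : ‖Complex.exp (-c * (z + y))‖ = Real.exp (-c * y) := by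
    rw [Complex.norm_exp, ← Complex.ofReal_neg, Complex.re_ofReal_mul]
    simp [hz]
  rw [norm_mul, h2]
  calc _ ≤ Real.exp (-c * y) * (‖w z‖ * Real.exp (n ^ 3 / 4 - n / 2 * y)) := by gcongr
    _ = ‖w z‖ * Real.exp (-c * y + (n ^ 3 / 4 - n / 2 * y)) := by rw [Real.exp_add]; ring
    _ ≤ ‖w z‖ * Real.exp (n ^ 3 / 4 + -y) := by
      have := mul_le_mul_of_nonneg_right (neg_le_abs c) hy
      gcongr ‖w z‖ * Real.exp ?_
      rw [hn]
      linarith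
    _ = _ := by rw [Real.exp_add]; ring

include hw hdec hode in
theorem exists_norm_halfLaplace_le (c : ℝ) : ∃ K : ℝ, 0 ≤ K ∧ ∀ z : ℂ, z.re = 0 →
    ‖halfLaplace w c z‖ ≤ K * ‖w z‖ := by
  obtain ⟨K, hK⟩ := exists_norm_halfLaplace_integrand_le hw hdec hode c
  refine ⟨|K|, abs_nonneg K, fun z hz => ?_⟩
  have : ‖halfLaplace w c z‖ ≤ ∫ y in Ioi (0 : ℝ), K * ‖w z‖ * Real.exp (-y) := by
    refine norm_integral_le_of_norm_le (integrableOn_exp_neg_Ioi_zero.const_mul _) ?_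
    filter_upwards [ae_restrict_mem measurableSet_Ioi] with y hy
    exact hK z hz y (le_of_lt hy)
  rw [integral_const_mul, integral_exp_neg_Ioi_zero, mul_one] at this
  refine this.trans ?_
  gcongr
  exact le_abs_self K

include hw hdec hode in
theorem exists_halfLaplace_eq_neg_primitive (c : ℝ) : ∃ Φ : ℂ → ℂ,
    (∀ z, HasDerivAt Φ (Complex.exp (-c * z) * w z) z) ∧
      ∀ z, z.re = 0 → halfLaplace w c z = -Φ z := by
  have hf : Differentiable ℂ fun z => Complex.exp (-c * z) * w z := by fun_prop
  obtain ⟨Φ, hΦ⟩ := hf.isExactOn_univ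
  replace hΦ : ∀ z, HasDerivAt Φ (Complex.exp (-c * z) * w z) z := fun z => hΦ z (mem_univ z)
  have hΦd : Differentiable ℂ Φ := fun z => (hΦ z).differentiableAt
  obtain ⟨K, hK⟩ := exists_norm_halfLaplace_integrand_le hw hdec hode c
  have hlim : ∀ z : ℂ, z.re = 0 →
      Tendsto (fun y : ℝ => Φ (z + y)) atTop (nhds (Φ z + halfLaplace w c z)) := by
    intro z hz
    have hder : ∀ y : ℝ, HasDerivAt (fun y : ℝ => Φ (z + y))
        (Complex.exp (-c * (z + y)) * w (z + y)) y := fun y => by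
      simpa [(hΦ _).deriv] using hasDerivAt_comp_add_ofReal hΦd z y
    have hI : IntegrableOn (fun y : ℝ => Complex.exp (-c * (z + y)) * w (z + y)) (Ioi 0) := by
      refine Integrable.mono' (integrableOn_exp_neg_Ioi_zero.const_mul (K * ‖w z‖)) ?_ ?_
      · have := hw.continuous
        exact Continuous.aestronglyMeasurable (by fun_prop)
      · filter_upwards [ae_restrict_mem measurableSet_Ioi] with y hy using hK z hz y (le_of_lt hy)
    have h1 := intervalIntegral_tendsto_integral_Ioi 0 hI tendsto_id
    have h2 : ∀ y : ℝ, ∫ t in (0 : ℝ)..y, Complex.exp (-c * (z + t)) * w (z + t) =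
        Φ (z + y) - Φ z := fun y => by
      rw [intervalIntegral.integral_eq_sub_of_hasDerivAt (fun t _ => hder t)]
      · simp
      · have := hw.continuous
        exact Continuous.intervalIntegrable (by fun_prop) _ _
    simp only [id, h2] at h1
    simpa [halfLaplace] using h1.const_add (Φ z)
  have hdiff : ∀ z : ℂ, z.re = 0 →
      Tendsto (fun y : ℝ => Φ (z + y) - Φ (0 + y)) atTop (nhds 0) := by
    intro z hz
    obtain ⟨C, hC⟩ := hdec (|c| + 1)
    have hb : Tendsto (fun y : ℝ => |C| * Real.exp (-y) * ‖z‖) atTop (nhds 0) := by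
      simpa using ((Real.tendsto_exp_atBot.comp
        tendsto_neg_atTop_atBot).const_mul |C|).mul_const ‖z‖
    refine squeeze_zero_norm' ?_ hb
    filter_upwards [eventually_ge_atTop (2 * ‖z‖)] with y hy
    have hy0 : 0 ≤ y := by linarith [norm_nonneg z]
    have h := (convex_segment (𝕜 := ℝ) (0 + (y : ℂ))
      (z + y)).norm_image_sub_le_of_norm_hasDerivWithin_le (f := Φ)
      (fun v _ => (hΦ v).hasDerivWithinAt) (C := |C| * Real.exp (-y)) (fun v hv => ?_)
      (left_mem_segment ℝ _ _) (right_mem_segment ℝ _ _)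
    · simpa using h
    · rw [segment_eq_image'] at hv
      obtain ⟨t, ⟨ht0, ht1⟩, rfl⟩ := hv
      have hv : (0 + (y : ℂ) + t • (z + y - (0 + y)) : ℂ) = t * z + y := by
        simp
        ring
      simp only [hv]
      have hre : (t * z : ℂ).re = 0 := by rw [Complex.re_ofReal_mul, hz, mul_zero]
      have hn : 2 * ‖(t * z : ℂ)‖ ≤ y := by
        rw [norm_mul, Complex.norm_real, Real.norm_of_nonneg ht0]
        nlinarith [norm_nonneg z]
      have hsec := add_ofReal_mem_sector hre hn
      have h1 := (hC _ hsec.1 hsec.2).1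
      have hre' : (t * z + y : ℂ).re = y := by rw [Complex.add_re, hre]; simp
      rw [hre'] at h1
      rw [norm_mul, Complex.norm_exp, ← Complex.ofReal_neg, Complex.re_ofReal_mul, hre']
      calc _ ≤ Real.exp (-c * y) * (|C| * Real.exp (-(|c| + 1) * y)) := by
            gcongr
            refine h1.trans ?_
            gcongr
            exact le_abs_self C
        _ = |C| * Real.exp (-c * y + -(|c| + 1) * y) := by rw [Real.exp_add]; ring
        _ ≤ _ := by
          have := mul_le_mul_of_nonneg_right (neg_le_abs c) hy0
          gcongr
          linarith
  refine ⟨fun z => Φ z - (Φ 0 + halfLaplace w c 0), fun z => (hΦ z).sub_const _, fun z hz => ?_⟩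
  have h1 := tendsto_nhds_unique (hdiff z hz) ((hlim z hz).sub (hlim 0 rfl))
  linear_combination -h1

end

section

variable {w : ℂ → ℂ} (hw : Differentiable ℂ w) (hdec : SectorDecay w)
  (hode : ∀ z, deriv (deriv w) z = z * w z)

include hw hode in
/-- A solution with real data of opposite signs at the origin grows along the imaginary axis. -/
theorem airy_imaginary_lower {a b : ℝ} (ha : w 0 = a) (hb : deriv w 0 = b) (hab : a * b ≤ 0)
    {ε : ℝ} (hε : ε ^ 2 = 1) {u : ℝ} (hu : 0 ≤ u) :
    |a| / 8 * (1 + u) ^ (3 / 2 : ℝ) ≤ ‖w (u * (ε * Complex.I))‖ := by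
  have hεc : (ε : ℂ) ^ 2 = 1 := by exact_mod_cast hε
  have hv := fun u => hasDerivAt_comp_ray hw (ε * Complex.I) u
  have hv' := fun u => (hasDerivAt_comp_ray hw.deriv (ε * Complex.I) u).mul_const (ε * Complex.I)
  have hv'' : ∀ u : ℝ, deriv (deriv w) (u * (ε * Complex.I)) * (ε * Complex.I) * (ε * Complex.I) =
      (ε * u : ℝ) * (-Complex.I * w (u * (ε * Complex.I))) := fun u => by
    rw [hode]
    push_cast
    linear_combination (ε * u * Complex.I * w (u * (ε * Complex.I))) *
      (ε ^ 2 * Complex.I_sq - hεc)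
  have h := airy_imaginary_growth (α := a) (β := b) hε (fun u => (hv u).complex_re)
    (fun u => (hv u).complex_im)
    (fun u => (hv' u).complex_re.congr_deriv (by
      rw [hv'', Complex.re_ofReal_mul]
      simp))
    (fun u => (hv' u).complex_im.congr_deriv (by
      rw [hv'', Complex.im_ofReal_mul]
      simp))
    (by simp [ha]) (by simp [ha]) (by simp [hb]) (by simp [hb, mul_comm]) hab hu
  have hsq : ∀ v : ℂ, v.re ^ 2 + v.im ^ 2 = ‖v‖ ^ 2 := fun v => by
    rw [Complex.sq_norm, Complex.normSq_apply]
    ring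
  rw [hsq] at h
  obtain ⟨h1, h2⟩ := h
  have h3 : a ^ 4 ≤ ‖w (u * (ε * Complex.I))‖ ^ 4 := by
    have := pow_le_pow_left₀ (sq_nonneg a) h1 2
    linarith [pow_mul a 2 2, pow_mul ‖w (u * (ε * Complex.I))‖ 2 2]
  have h4 := add_pow_le zero_le_one hu 6
  refine (pow_le_pow_iff_left₀ (by positivity) (norm_nonneg _) (four_ne_zero)).1 ?_
  have h5 : ((1 + u) ^ (3 / 2 : ℝ)) ^ 4 = (1 + u) ^ 6 := by
    rw [← Real.rpow_natCast, ← Real.rpow_mul (by positivity), ← Real.rpow_natCast]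
    norm_num
  have h6 : |a| ^ 4 = a ^ 4 := by rw [show 4 = 2 * 2 from rfl, pow_mul, sq_abs, ← pow_mul]
  rw [mul_pow, h5, div_pow, h6]
  norm_num at h4 ⊢
  have ha4 : 0 ≤ a ^ 4 := by positivity
  have hu6 : 0 ≤ u ^ 6 := by positivity
  nlinarith [mul_le_mul_of_nonneg_left h4 ha4, mul_nonneg ha4 hu6]

include hw hode in
theorem airy_wronskian {V : ℂ → ℂ} (hV : Differentiable ℂ V)
    (hVode : ∀ z, deriv (deriv V) z = z * V z) (z : ℂ) :
    w z * deriv V z - deriv w z * V z = w 0 * deriv V 0 - deriv w 0 * V 0 := by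
  have hder : ∀ z, HasDerivAt (fun z => w z * deriv V z - deriv w z * V z) 0 z := fun z => by
    convert! ((hw z).hasDerivAt.mul (hV.deriv z).hasDerivAt).sub
      ((hw.deriv z).hasDerivAt.mul (hV z).hasDerivAt) using 1
    rw [hode, hVode]
    ring
  exact is_const_of_deriv_eq_zero (fun z => (hder z).differentiableAt) (fun z => (hder z).deriv) z 0

theorem halfLaplace_zero (c : ℂ) : halfLaplace w c 0 = rayLaplace w 1 c := by
  simp [halfLaplace, rayLaplace]

theorem quotient_identity {A A' V V' P E d k : ℂ} (hA : A ≠ 0) (hW : A * V' - A' * V = -k) :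
    -(d * k) * (-P / A ^ 2) - E * V * d =
      ((-(E * A * d) * V + -P * (V' * d)) * A - -P * V * (A' * d)) / A ^ 2 := by
  field_simp
  linear_combination (d * P) * hW

include hw hdec hode in
/-- Integration of `halfLaplace w c / w ^ 2` over a half of the imaginary axis, using that
`1 / w ^ 2` is, up to a constant, the derivative of `V / w` for the rotated solution `V`. -/
theorem integral_halfLaplace_div_sq {a b : ℝ} (ha : w 0 = a) (hb : deriv w 0 = b)
    (hab : a * b < 0) {ε : ℝ} (hε : ε ^ 2 = 1) (c : ℝ) :
    IntegrableOn (fun u : ℝ => halfLaplace w c (u * (ε * Complex.I)) / w (u * (ε * Complex.I)) ^ 2)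
      (Ioi 0) ∧
    -(ε * Complex.I * ((sixthRoot ε + 1) * (a * b))) *
      (∫ u in Ioi (0 : ℝ), halfLaplace w c (u * (ε * Complex.I)) / w (u * (ε * Complex.I)) ^ 2) =
      rayLaplace (rotated w ε) (ε * Complex.I) c - rayLaplace w 1 c := by
  set d : ℂ := ε * Complex.I with hd
  have hd1 : ‖d‖ = 1 := norm_ofReal_mul_I hε
  have ha0 : a ≠ 0 := by rintro rfl; simp at hab
  have hlow := fun u (hu : 0 ≤ u) => airy_imaginary_lower hw hode ha hb hab.le hε hu
  rw [← hd] at hlow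
  have hne : ∀ u : ℝ, 0 ≤ u → w (u * d) ≠ 0 := fun u hu => norm_pos_iff.1
    (lt_of_lt_of_le (by positivity) (hlow u hu))
  have hre : ∀ u : ℝ, (u * d).re = 0 := fun u => by simp [hd]
  obtain ⟨K, hK0, hK⟩ := exists_norm_halfLaplace_le hw hdec hode c
  obtain ⟨Φ, hΦ, hΦF⟩ := exists_halfLaplace_eq_neg_primitive hw hdec hode c
  have hΦd : Differentiable ℂ Φ := fun z => (hΦ z).differentiableAt
  have hVd := hw.rotated ε
  have hVdec := hdec.rayDecay_rotated hε
  have hVode := rotated_ode hode hε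
  set V := rotated w ε with hV
  have hF : ∀ u : ℝ, halfLaplace w c (u * d) = -Φ (u * d) := fun u => hΦF _ (hre u)
  have hW : ∀ z, w z * deriv V z - deriv w z * V z = -((sixthRoot ε + 1) * (a * b)) := fun z => by
    rw [airy_wronskian hw hode hVd hVode, hV, deriv_rotated]
    simp only [rotated, mul_zero, ha, hb]
    ring
  have hI : IntegrableOn (fun u : ℝ => halfLaplace w c (u * d) / w (u * d) ^ 2) (Ioi 0) := by
    have hi : IntegrableOn (fun u : ℝ => K * (8 / |a|) * (u + 1) ^ (-(3 / 2) : ℝ)) (Ioi 0) :=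
      (integrableOn_add_rpow_Ioi_of_lt (by norm_num) (by norm_num)).const_mul _
    refine Integrable.mono' hi ?_ ?_
    · simp only [hF]
      refine ContinuousOn.aestronglyMeasurable ?_ measurableSet_Ioi
      have h1 := hw.continuous
      have h2 := hΦd.continuous
      refine ContinuousOn.div (by fun_prop) (by fun_prop) fun u hu => ?_
      exact pow_ne_zero 2 (hne u (le_of_lt hu))
    · filter_upwards [ae_restrict_mem measurableSet_Ioi] with u hu
      have hu0 : 0 < u := hu
      have h1 := hlow u hu0.le
      have h2 : 0 < ‖w (u * d)‖ := norm_pos_iff.2 (hne u hu0.le)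
      rw [norm_div, norm_pow, Real.rpow_neg (by positivity), add_comm u 1]
      have h3 : 0 < |a| / 8 * (1 + u) ^ (3 / 2 : ℝ) := by positivity
      calc _ ≤ K * ‖w (u * d)‖ / ‖w (u * d)‖ ^ 2 := by
            gcongr
            exact hK _ (hre u)
        _ = K * (1 / ‖w (u * d)‖) := by field_simp
        _ ≤ K * (1 / (|a| / 8 * (1 + u) ^ (3 / 2 : ℝ))) := by gcongr
        _ = _ := by field_simp
  refine ⟨hI, ?_⟩
  set Q : ℝ → ℂ := fun u => halfLaplace w c (u * d) * V (u * d) / w (u * d) with hQ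
  have hQd : ∀ u ∈ Ici (0 : ℝ), HasDerivAt Q (-(d * ((sixthRoot ε + 1) * (a * b))) *
      (halfLaplace w c (u * d) / w (u * d) ^ 2) - Complex.exp (-c * (u * d)) * V (u * d) * d) u := by
    intro u hu
    have h0 := hne u hu
    simp only [hQ, hF]
    have h1 := hasDerivAt_comp_ray hΦd d u
    rw [(hΦ _).deriv] at h1
    convert! (h1.neg.mul (hasDerivAt_comp_ray hVd d u)).div (hasDerivAt_comp_ray hw d u) h0 using 1
    simp only [Pi.neg_apply, Pi.mul_apply]
    exact quotient_identity h0 (hW _)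
  have hQlim : Tendsto Q atTop (nhds 0) := by
    obtain ⟨C, hC⟩ := hVdec 1
    have hb : Tendsto (fun y : ℝ => K * (C * Real.exp (-1 * y))) atTop (nhds 0) := by
      simpa using ((Real.tendsto_exp_atBot.comp tendsto_neg_atTop_atBot).const_mul C).const_mul K
    refine squeeze_zero_norm' ?_ hb
    filter_upwards [eventually_ge_atTop 0] with u hu
    have h2 : 0 < ‖w (u * d)‖ := norm_pos_iff.2 (hne u hu)
    rw [hQ, norm_div, norm_mul, div_le_iff₀ h2]
    calc _ ≤ K * ‖w (u * d)‖ * (C * Real.exp (-1 * u)) := by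
          gcongr
          · exact hK _ (hre u)
          · exact (hC u hu).1
      _ = _ := by ring
  have hi2 := integrableOn_rayLaplace hVd hd1 hVdec c
  have hi1 := hI.const_mul (-(d * ((sixthRoot ε + 1) * (a * b))))
  have h := integral_Ioi_of_hasDerivAt_of_tendsto' hQd (hi1.sub hi2) hQlim
  rw [integral_sub hi1 hi2, integral_const_mul] at h
  have hQ0 : Q 0 = rayLaplace w 1 c := by
    have hw0 : (a : ℂ) ≠ 0 := by exact_mod_cast ha0
    simp only [hQ, hV, rotated, Complex.ofReal_zero, zero_mul, mul_zero, halfLaplace_zero, ha]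
    field_simp
  rw [hQ0] at h
  simp only [rayLaplace] at h ⊢
  linear_combination h

end

theorem integral_eq_integral_Ioi_add_comp_neg {f : ℝ → ℂ} (h1 : IntegrableOn f (Ioi 0))
    (h2 : IntegrableOn (fun u => f (-u)) (Ioi 0)) :
    ∫ u, f u = (∫ u in Ioi 0, f u) + ∫ u in Ioi 0, f (-u) := by
  have h3 : IntegrableOn f (Iic 0) := by
    rw [integrableOn_Iic_iff_integrableOn_Iio,
      ← (Measure.measurePreserving_neg (volume : Measure ℝ)).integrableOn_comp_preimage
        (Homeomorph.neg ℝ).measurableEmbedding]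
    rw [Set.neg_preimage, neg_Iio, neg_zero]
    exact h2
  rw [integral_comp_neg_Ioi, neg_zero, add_comm, intervalIntegral.integral_Iic_add_Ioi h3 h1]

section

variable {Ai : ℂ → ℂ} (hd : Differentiable ℂ Ai) (him : ∀ x : ℝ, (Ai x).im = 0)
  (hlim : ∀ x : ℝ, Tendsto (fun R : ℝ => ∫ t in (0:ℝ)..R, Real.cos (t ^ 3 / 3 + x * t))
      atTop (nhds (Real.pi * (Ai x).re)))
  (hode : ∀ z, deriv (deriv Ai) z = z * Ai z)

theorem sixthRoot_add_one_ne_zero (ε : ℝ) : sixthRoot ε + 1 ≠ 0 := fun h => by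
  have := congrArg Complex.re h
  norm_num [sixthRoot] at this

include hd him hlim hode in
/-- The two normalized differences of Laplace transforms add up to `2 π exp (-c³ / 3)`. -/
theorem rayLaplace_combination (c : ℂ) :
    (rayLaplace (rotated Ai 1) ((1 : ℝ) * Complex.I) c - rayLaplace Ai 1 c) /
        -((1 : ℝ) * Complex.I * ((sixthRoot 1 + 1) * (Ai 0 * deriv Ai 0))) +
      (rayLaplace (rotated Ai (-1)) ((-1 : ℝ) * Complex.I) c - rayLaplace Ai 1 c) /
        -((-1 : ℝ) * Complex.I * ((sixthRoot (-1) + 1) * (Ai 0 * deriv Ai 0))) =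
      2 * Real.pi * Complex.exp (-c ^ 3 / 3) := by
  have hsec := sectorDecay_airy hd him hlim
  have h1 : (1 : ℝ) ^ 2 = 1 := by norm_num
  have h2 : (-1 : ℝ) ^ 2 = 1 := by norm_num
  have ha := airy_zero him hlim
  have hb := deriv_airy_zero hd him hlim hode
  have hH0 := cubicMoment_pos 0
  have hH1 := cubicMoment_pos 1
  have ha0 : Ai 0 ≠ 0 := by
    rw [ha, Complex.ofReal_ne_zero]
    positivity
  have hb0 : deriv Ai 0 ≠ 0 := by
    rw [hb, Complex.ofReal_ne_zero, neg_ne_zero]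
    positivity
  have hk1 := sixthRoot_add_one_ne_zero 1
  have hk2 := sixthRoot_add_one_ne_zero (-1)
  set S : ℂ → ℂ := fun c =>
    (rayLaplace (rotated Ai 1) ((1 : ℝ) * Complex.I) c - rayLaplace Ai 1 c) /
        -((1 : ℝ) * Complex.I * ((sixthRoot 1 + 1) * (Ai 0 * deriv Ai 0))) +
      (rayLaplace (rotated Ai (-1)) ((-1 : ℝ) * Complex.I) c - rayLaplace Ai 1 c) /
        -((-1 : ℝ) * Complex.I * ((sixthRoot (-1) + 1) * (Ai 0 * deriv Ai 0))) with hS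
  have hder : ∀ c, HasDerivAt S (-c ^ 2 * S c) c := fun c => by
    have d0 := hasDerivAt_rayLaplace hd norm_one hsec.rayDecay_one hode c
    have dr : ∀ ε : ℝ, ε ^ 2 = 1 → _ := fun ε hε => hasDerivAt_rayLaplace (hd.rotated ε)
      (norm_ofReal_mul_I hε) (hsec.rayDecay_rotated hε) (rotated_ode hode hε) c
    convert! (((dr 1 h1).sub d0).div_const _).add (((dr (-1) h2).sub d0).div_const _) using 1
    simp only [hS, deriv_rotated, rotated, mul_zero]
    push_cast
    field_simp
    ring
  have hcst : ∀ c, HasDerivAt (fun c => S c * Complex.exp (c ^ 3 / 3)) 0 c := fun c => by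
    have h3 : HasDerivAt (fun c : ℂ => c ^ 3 / 3) (c ^ 2) c := by
      convert! (hasDerivAt_pow 3 c).div_const 3 using 1
      push_cast
      ring
    convert! (hder c).mul h3.cexp using 1
    ring
  have hc := is_const_of_deriv_eq_zero (fun c => (hcst c).differentiableAt)
    (fun c => (hcst c).deriv) c 0
  have hS0 : S 0 = 2 * Real.pi := by
    simp only [hS]
    rw [rayLaplace_rotated_zero hd him hlim hode h1, rayLaplace_rotated_zero hd him hlim hode h2,
      rayLaplace_airy_zero hd him hlim hode, ha, hb]
    have hκI : sixthRoot 1 - sixthRoot (-1) = √3 * Complex.I := by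
      apply Complex.ext
      · simp [sixthRoot]
      · simp [sixthRoot]
    have h3 : (√3 : ℂ) ≠ 0 := by
      rw [Complex.ofReal_ne_zero]; positivity
    have hpi : (Real.pi : ℂ) ≠ 0 := by exact_mod_cast Real.pi_ne_zero
    have hH0c : (cubicMoment 0 : ℂ) ≠ 0 := by exact_mod_cast hH0.ne'
    have hH1c : (cubicMoment 1 : ℂ) ≠ 0 := by exact_mod_cast hH1.ne'
    have hquot : ∀ ε : ℝ, ε ^ 2 = 1 → (sixthRoot ε - 2) / (sixthRoot ε + 1) = -sixthRoot (-ε) :=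
      fun ε hε => by
      rw [div_eq_iff (sixthRoot_add_one_ne_zero ε), sixthRoot_neg]
      linear_combination -sixthRoot_sq hε
    have hq1 := hquot 1 h1
    have hq2 := hquot (-1) h2
    rw [neg_neg] at hq2
    push_cast
    calc _ = 2 * Real.pi / √3 * (-Complex.I) * ((sixthRoot 1 - 2) / (sixthRoot 1 + 1)
          - (sixthRoot (-1) - 2) / (sixthRoot (-1) + 1)) := by
          field_simp
          linear_combination 3 * (sixthRoot 1 - sixthRoot (-1)) * Complex.I_sq
      _ = 2 * Real.pi / √3 * (-Complex.I) * (√3 * Complex.I) := by rw [hq1, hq2, ← hκI]; ring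
      _ = _ := by
        field_simp
        linear_combination (-1 : ℂ) * Complex.I_sq
  rw [hS0] at hc
  simp only [ne_eq, OfNat.ofNat_ne_zero, not_false_eq_true, zero_pow, zero_div, Complex.exp_zero,
    mul_one] at hc
  have he : Complex.exp (c ^ 3 / 3) * Complex.exp (-c ^ 3 / 3) = 1 := by
    rw [← Complex.exp_add, ← Complex.exp_zero]
    congr 1
    ring
  linear_combination Complex.exp (-c ^ 3 / 3) * hc - S c * he

include hd him hlim hode in
theorem integral_halfLaplace_airy (c : ℝ) :
    ∫ u : ℝ, halfLaplace Ai c (u * Complex.I) / Ai (u * Complex.I) ^ 2 =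
      2 * Real.pi * Complex.exp (-c ^ 3 / 3) := by
  have hsec := sectorDecay_airy hd him hlim
  have ha := airy_zero him hlim
  have hb := deriv_airy_zero hd him hlim hode
  have hH0 := cubicMoment_pos 0
  have hH1 := cubicMoment_pos 1
  have hab : (√3 / (2 * Real.pi) * cubicMoment 0) * (-(√3 / (2 * Real.pi) * cubicMoment 1)) < 0 :=
    mul_neg_of_pos_of_neg (by positivity) (neg_neg_of_pos (by positivity))
  obtain ⟨i1, e1⟩ := integral_halfLaplace_div_sq hd hsec hode ha hb hab (ε := 1) (by norm_num) c
  obtain ⟨i2, e2⟩ := integral_halfLaplace_div_sq hd hsec hode ha hb hab (ε := -1) (by norm_num) c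
  have hcomb := rayLaplace_combination hd him hlim hode c
  rw [← ha, ← hb] at e1 e2
  have hab0 : Ai 0 * deriv Ai 0 ≠ 0 := by
    rw [ha, hb]
    exact_mod_cast hab.ne
  rw [← e1, ← e2, mul_div_cancel_left₀, mul_div_cancel_left₀] at hcomb
  · set f : ℝ → ℂ := fun u => halfLaplace Ai c (u * Complex.I) / Ai (u * Complex.I) ^ 2 with hf
    have hf1 : ∀ u : ℝ, halfLaplace Ai c (u * ((1 : ℝ) * Complex.I)) /
        Ai (u * ((1 : ℝ) * Complex.I)) ^ 2 = f u := fun u => by simp [hf]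
    have hf2 : ∀ u : ℝ, halfLaplace Ai c (u * ((-1 : ℝ) * Complex.I)) /
        Ai (u * ((-1 : ℝ) * Complex.I)) ^ 2 = f (-u) := fun u => by simp [hf]
    simp only [hf1, hf2] at hcomb i1 i2
    rw [integral_eq_integral_Ioi_add_comp_neg i1 i2, hcomb]
  · have := sixthRoot_add_one_ne_zero (-1)
    simp [this, hab0, Complex.I_ne_zero]
  · have := sixthRoot_add_one_ne_zero 1
    simp [this, hab0, Complex.I_ne_zero]

end

/-- Lemma C.1 of the paper. For every `s ∈ ℝ`,
`(1/2π) ∫_ℝ [∫₀^∞ e^{-2^{1/3}s(iu+y)} Ai(iu+y) dy] / Ai(iu)² du = e^{-(2/3)s³}`. -/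
theorem chernoff_stmt_13
    (Ai Bi : ℂ → ℂ) (hAiry : IsAiry Ai Bi) :
    ∀ s : ℝ,
      (1 / (2 * (Real.pi : ℂ))) *
          ∫ u : ℝ,
            (∫ y in Set.Ioi (0:ℝ),
                Complex.exp (-Complex.ofReal ((2:ℝ) ^ ((1:ℝ)/3)) * s * (Complex.I * u + y))
                  * Ai (Complex.I * u + y))
              / Ai (Complex.I * u) ^ 2
        = Complex.ofReal (Real.exp (-(2/3) * s ^ 3)) := by
  obtain ⟨hd, -, hode, -, him, -, hlim, -⟩ := hAiry
  intro s
  have h := integral_halfLaplace_airy hd him hlim hode ((2 : ℝ) ^ ((1 : ℝ) / 3) * s)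
  simp only [halfLaplace] at h
  have hcube : (((2 : ℝ) ^ ((1 : ℝ) / 3) : ℝ) : ℂ) ^ 3 = 2 := by
    rw [← Complex.ofReal_pow, ← Real.rpow_natCast, ← Real.rpow_mul (by norm_num)]
    norm_num
  have hpi : (Real.pi : ℂ) ≠ 0 := by exact_mod_cast Real.pi_ne_zero
  have hexp : Complex.exp (-(((2 : ℝ) ^ ((1 : ℝ) / 3) * s : ℝ) : ℂ) ^ 3 / 3) =
      Complex.ofReal (Real.exp (-(2/3) * s ^ 3)) := by
    rw [Complex.ofReal_exp]
    congr 1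
    push_cast [Complex.ofReal_mul] at hcube ⊢
    linear_combination (-(s : ℂ) ^ 3 / 3) * hcube
  rw [hexp] at h
  simp only [Complex.ofReal_mul, ← neg_mul, mul_comm _ Complex.I] at h
  rw [h]
  field_simp

end
end

section
/- The integral over the imaginary axis of the reciprocal squared Airy function satisfies (1/(2π)) ∫_{u=−∞}^{∞} 1/Ai(iu)² du = 1. -/
open MeasureTheory ProbabilityTheory Filter Set

noncomputable section

/-- The Laplace transform of `s ↦ exp (-s³/3)`. -/
def cubicLaplace (y : ℂ) : ℂ := ∫ s in Ioi (0 : ℝ), Complex.exp (-(s : ℂ) ^ 3 / 3 - y * s)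

lemma norm_exp_cubic (y : ℂ) (s : ℝ) :
    ‖Complex.exp (-(s : ℂ) ^ 3 / 3 - y * s)‖ = Real.exp (-s ^ 3 / 3 - y.re * s) := by
  rw [Complex.norm_exp]
  congr 1
  have : (-(s : ℂ) ^ 3 / 3 - y * s) = ((-s ^ 3 / 3 : ℝ) : ℂ) - y * s := by push_cast; ring
  rw [this, Complex.sub_re, Complex.ofReal_re, Complex.re_mul_ofReal]

lemma cubic_exponent_le {M r s : ℝ} (hM : 0 ≤ M) (hs : 0 ≤ s) (hr : -r ≤ M) :
    s + (-s ^ 3 / 3 - r * s) ≤ 2 * (M + 2) ^ 3 / 3 + -1 * s := by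
  have h1 : 0 ≤ (s - (M + 2)) ^ 2 * (s + 2 * (M + 2)) := by positivity
  have h2 : 0 ≤ (r + M) * s := mul_nonneg (by linarith) hs
  have h3 : 0 ≤ (M + 2) * (M + 1) * s := by positivity
  nlinarith

lemma norm_exp_cubic_le {M : ℝ} {y : ℂ} (hy : ‖y‖ ≤ M) {s : ℝ} (hs : 0 ≤ s) :
    Real.exp s * ‖Complex.exp (-(s : ℂ) ^ 3 / 3 - y * s)‖ ≤
      Real.exp (2 * (M + 2) ^ 3 / 3) * Real.exp (-1 * s) := by
  rw [norm_exp_cubic, ← Real.exp_add, ← Real.exp_add, Real.exp_le_exp]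
  have := (abs_le.1 (Complex.abs_re_le_norm y)).1
  exact cubic_exponent_le ((norm_nonneg y).trans hy) hs (by linarith)

lemma integrableOn_const_mul_exp_neg (C : ℝ) :
    IntegrableOn (fun s : ℝ => C * Real.exp (-1 * s)) (Ioi 0) :=
  (exp_neg_integrableOn_Ioi 0 one_pos).const_mul C

lemma integrableOn_exp_cubic (y : ℂ) :
    IntegrableOn (fun s : ℝ => Complex.exp (-(s : ℂ) ^ 3 / 3 - y * s)) (Ioi 0) := by
  refine (integrableOn_const_mul_exp_neg (Real.exp (2 * (‖y‖ + 2) ^ 3 / 3))).mono'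
    (by fun_prop) ?_
  filter_upwards [ae_restrict_mem measurableSet_Ioi] with s hs
  have hs' : (0 : ℝ) ≤ s := le_of_lt hs
  refine le_trans ?_ (norm_exp_cubic_le le_rfl hs')
  exact le_mul_of_one_le_left (norm_nonneg _) (Real.one_le_exp hs')

lemma hasDerivAt_cubicLaplace (y : ℂ) :
    HasDerivAt cubicLaplace
      (∫ s in Ioi (0 : ℝ), -(s : ℂ) * Complex.exp (-(s : ℂ) ^ 3 / 3 - y * s)) y := by
  refine (hasDerivAt_integral_of_dominated_loc_of_deriv_le (𝕜 := ℂ) (s := Metric.ball y 1)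
    (bound := fun s => Real.exp (2 * (‖y‖ + 1 + 2) ^ 3 / 3) * Real.exp (-1 * s))
    (F := fun y s => Complex.exp (-(s : ℂ) ^ 3 / 3 - y * s))
    (μ := volume.restrict (Ioi (0 : ℝ)))
    (F' := fun y s => -(s : ℂ) * Complex.exp (-(s : ℂ) ^ 3 / 3 - y * s))
    (Metric.ball_mem_nhds y one_pos) (Eventually.of_forall fun z => by fun_prop)
    (integrableOn_exp_cubic y) (by fun_prop) ?_ (integrableOn_const_mul_exp_neg _) ?_).2
  · filter_upwards [ae_restrict_mem measurableSet_Ioi] with s hs z hz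
    have hs' : (0 : ℝ) ≤ s := le_of_lt hs
    have hz' : ‖z‖ ≤ ‖y‖ + 1 := by
      rw [mem_ball_iff_norm] at hz
      linarith [norm_le_norm_add_norm_sub' z y]
    refine le_trans ?_ (norm_exp_cubic_le hz' hs')
    rw [norm_mul, norm_neg, Complex.norm_of_nonneg hs']
    gcongr
    linarith [Real.add_one_le_exp s]
  · refine Eventually.of_forall fun s z _ => ?_
    have := (((hasDerivAt_id z).mul_const (s : ℂ)).const_sub (-(s : ℂ) ^ 3 / 3)).cexp
    exact this.congr_deriv (by simp [mul_comm])

lemma norm_cubicLaplace_le {y : ℂ} (hy : 0 ≤ y.re) :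
    ‖cubicLaplace y‖ ≤ ∫ s in Ioi (0 : ℝ), Real.exp (-s ^ 3 / 3) := by
  have h : IntegrableOn (fun s : ℝ => Real.exp (-s ^ 3 / 3)) (Ioi 0) := by
    refine (integrableOn_exp_cubic 0).norm.congr (Eventually.of_forall fun s => ?_)
    simpa using norm_exp_cubic 0 s
  refine norm_integral_le_of_norm_le h ?_
  filter_upwards [ae_restrict_mem measurableSet_Ioi] with s hs
  have hs' : (0 : ℝ) ≤ s := le_of_lt hs
  rw [norm_exp_cubic, Real.exp_le_exp]
  linarith [mul_nonneg hy hs']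

lemma conj_cubicLaplace (y : ℂ) :
    (starRingEnd ℂ) (cubicLaplace y) = cubicLaplace ((starRingEnd ℂ) y) := by
  unfold cubicLaplace
  rw [← integral_conj]
  congr 1 with s
  rw [← Complex.exp_conj]
  simp [map_ofNat]

lemma integral_pow_mul_exp_cubic (k : ℕ) :
    ∫ s in Ioi (0 : ℝ), (s : ℂ) ^ k * Complex.exp (-(s : ℂ) ^ 3 / 3 - 0 * s) =
      (((1 / 3 : ℝ) ^ (-((k : ℝ) + 1) / 3) * (1 / 3) * Real.Gamma (((k : ℝ) + 1) / 3) : ℝ) : ℂ) := by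
  rw [← integral_rpow_mul_exp_neg_mul_rpow (p := 3) (q := k) (b := 1 / 3)
    (by norm_num) (by linarith [k.cast_nonneg (α := ℝ)]) (by norm_num), ← integral_complex_ofReal]
  congr 1 with s
  rw [Real.rpow_natCast, show (3 : ℝ) = ((3 : ℕ) : ℝ) by norm_num, Real.rpow_natCast]
  push_cast
  congr 2
  ring

lemma cubicLaplace_initial_values :
    ∃ a b : ℝ, cubicLaplace 0 = a ∧ HasDerivAt cubicLaplace b 0 ∧
      a * b = -(2 * Real.pi / (3 * √3)) := by
  refine ⟨(1 / 3 : ℝ) ^ (-(1 / 3) : ℝ) * (1 / 3) * Real.Gamma (1 / 3),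
    -((1 / 3 : ℝ) ^ (-(2 / 3) : ℝ) * (1 / 3) * Real.Gamma (2 / 3)), ?_, ?_, ?_⟩
  · have h := integral_pow_mul_exp_cubic 0
    simp only [pow_zero, one_mul] at h
    rw [cubicLaplace, h]
    norm_num
  · have h := integral_pow_mul_exp_cubic 1
    refine (hasDerivAt_cubicLaplace 0).congr_deriv ?_
    simp only [neg_mul, integral_neg]
    simp only [pow_one] at h
    rw [h]
    norm_num
  have hpow : (1 / 3 : ℝ) ^ (-(1 / 3) : ℝ) * (1 / 3 : ℝ) ^ (-(2 / 3) : ℝ) = 3 := by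
    rw [← Real.rpow_add (by norm_num), show (-(1 / 3) + -(2 / 3) : ℝ) = -1 by norm_num,
      Real.rpow_neg_one]
    norm_num
  have hGamma := Real.Gamma_mul_Gamma_one_sub (1 / 3)
  rw [show Real.pi * (1 / 3) = Real.pi / 3 by ring, Real.sin_pi_div_three,
    show (1 - 1 / 3 : ℝ) = 2 / 3 by norm_num] at hGamma
  have h3 : √3 ≠ 0 := by positivity
  calc _ = -(((1 / 3 : ℝ) ^ (-(1 / 3) : ℝ) * (1 / 3 : ℝ) ^ (-(2 / 3) : ℝ)) *
        (Real.Gamma (1 / 3) * Real.Gamma (2 / 3)) / 9) := by ring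
    _ = _ := by
      rw [hpow, hGamma]
      field_simp
      norm_num

/-- The sixth root of `-1` in the first quadrant, `exp (iπ/6)`. -/
def rayUnit : ℂ := (√3 + Complex.I) / 2

lemma ofReal_sqrt_three_sq : ((√3 : ℝ) : ℂ) ^ 2 = 3 := by
  rw [← Complex.ofReal_pow, Real.sq_sqrt (by norm_num)]
  norm_num

lemma rayUnit_sq : rayUnit ^ 2 = (1 + √3 * Complex.I) / 2 := by
  rw [rayUnit]
  linear_combination (1 / 4 : ℂ) * ofReal_sqrt_three_sq + (1 / 4 : ℂ) * Complex.I_sq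

lemma rayUnit_cube : rayUnit ^ 3 = Complex.I := by
  rw [pow_succ, rayUnit_sq, rayUnit]
  linear_combination (Complex.I / 4) * ofReal_sqrt_three_sq + (√3 / 4 : ℂ) * Complex.I_sq

lemma conj_rayUnit : (starRingEnd ℂ) rayUnit = (√3 - Complex.I) / 2 := by
  simp [rayUnit, map_ofNat, sub_eq_add_neg]

lemma norm_exp_cubic_phase (x R y : ℝ) :
    ‖Complex.exp (Complex.I * ((R + y * Complex.I) ^ 3 / 3 + x * (R + y * Complex.I)))‖ =
      Real.exp (-(R ^ 2 * y) + y ^ 3 / 3 - x * y) := by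
  rw [Complex.norm_exp]
  congr 1
  have : Complex.I * ((R + y * Complex.I) ^ 3 / 3 + x * (R + y * Complex.I)) =
      ((-(R ^ 2 * y) + y ^ 3 / 3 - x * y : ℝ) : ℂ) +
        ((R ^ 3 / 3 - R * y ^ 2 + x * R : ℝ) : ℂ) * Complex.I := by
    push_cast
    linear_combination (R ^ 2 * y + y ^ 3 / 3 * (Complex.I ^ 2 - 1) + x * y +
      R * y ^ 2 * Complex.I : ℂ) * Complex.I_sq
  rw [this, Complex.add_re, Complex.re_ofReal_mul, Complex.ofReal_re, Complex.I_re, mul_zero,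
    add_zero]

lemma tendsto_primitive_sub_vertical {x : ℝ} {H : ℂ → ℂ}
    (hH : ∀ z, HasDerivAt H (Complex.exp (Complex.I * (z ^ 3 / 3 + x * z))) z) :
    Tendsto (fun R : ℝ => H (R + (R / √3 : ℝ) * Complex.I) - H R) atTop (nhds 0) := by
  refine squeeze_zero_norm' ?_ tendsto_inv_atTop_zero
  filter_upwards [eventually_ge_atTop (2 + 2 * |x|)] with R hR
  have hx := abs_nonneg x
  have hR0 : 0 < R := by linarith
  have hpath : ∀ y : ℝ, HasDerivAt (fun y : ℝ => H (R + y * Complex.I) - H R)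
      (Complex.exp (Complex.I * ((R + y * Complex.I) ^ 3 / 3 + x * (R + y * Complex.I))) *
        Complex.I) y := fun y => by
    have h1 : HasDerivAt (fun y : ℝ => (R + y * Complex.I : ℂ)) Complex.I y := by
      simpa using ((hasDerivAt_id y).ofReal_comp.mul_const Complex.I).const_add (R : ℂ)
    exact ((hH _).comp y h1).sub_const _
  have hB : ∀ y : ℝ, HasDerivAt (fun y : ℝ => (1 - Real.exp (-R * y)) / R)
      (Real.exp (-R * y)) y := fun y => by
    have h1 : HasDerivAt (fun y : ℝ => -R * y) (-R) y := by
      simpa using (hasDerivAt_id y).const_mul (-R)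
    exact ((h1.exp.const_sub 1).div_const R).congr_deriv (by field_simp)
  have hle : (0 : ℝ) ≤ R / √3 := by positivity
  have key := image_norm_le_of_norm_deriv_right_le_deriv_boundary
    (a := 0) (b := R / √3) (fun y _ => (hpath y).continuousAt.continuousWithinAt)
    (fun y _ => (hpath y).hasDerivWithinAt) (by simp) hB (fun y hy => by
      rw [norm_mul, Complex.norm_I, mul_one, norm_exp_cubic_phase, Real.exp_le_exp]
      have hy0 := hy.1
      have hy2 : y ^ 2 ≤ R ^ 2 / 3 := by
        have := pow_le_pow_left₀ hy0 hy.2.le 2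
        rwa [div_pow, Real.sq_sqrt (by norm_num)] at this
      have h1 : 0 ≤ y * (R ^ 2 / 3 - y ^ 2) := mul_nonneg hy0 (by linarith)
      have h2 : 0 ≤ y * (|x| + x) := mul_nonneg hy0 (by linarith [neg_abs_le x])
      have h3 : 0 ≤ y * (8 / 9 * R ^ 2 - |x| - R) := mul_nonneg hy0 (by nlinarith)
      nlinarith) (right_mem_Icc.2 hle)
  refine key.trans ?_
  rw [inv_eq_one_div]
  gcongr
  linarith [Real.exp_pos (-R * (R / √3))]

/-- Rotating the ray of integration by `π/6` turns the oscillating integral into an absolutely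
convergent one. -/
lemma tendsto_integral_cos_cubic (x : ℝ) :
    Tendsto (fun R : ℝ => ∫ t in (0:ℝ)..R, Real.cos (t ^ 3 / 3 + x * t)) atTop
      (nhds (rayUnit * cubicLaplace (-Complex.I * rayUnit * x)).re) := by
  obtain ⟨H, hH⟩ := (show Differentiable ℂ
    fun z : ℂ => Complex.exp (Complex.I * (z ^ 3 / 3 + x * z)) by fun_prop).isExactOn_univ
  replace hH : ∀ z, HasDerivAt H (Complex.exp (Complex.I * (z ^ 3 / 3 + x * z))) z :=
    fun z => hH z (mem_univ z)
  have hcos : ∀ R : ℝ, ∫ t in (0:ℝ)..R, Real.cos (t ^ 3 / 3 + x * t) = (H R - H 0).re := by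
    intro R
    have hd : ∀ t : ℝ, HasDerivAt (fun t : ℝ => (H t).re) (Real.cos (t ^ 3 / 3 + x * t)) t := by
      intro t
      refine (hH t).real_of_complex.congr_deriv ?_
      rw [mul_comm Complex.I, show ((t : ℂ) ^ 3 / 3 + x * t) = ((t ^ 3 / 3 + x * t : ℝ) : ℂ) by push_cast; rfl,
        Complex.exp_ofReal_mul_I_re]
    rw [intervalIntegral.integral_eq_sub_of_hasDerivAt (fun t _ => hd t)
      (Continuous.intervalIntegrable (by fun_prop) _ _)]
    simp
  have hray : ∀ r : ℝ, ∫ s in (0:ℝ)..r,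
      rayUnit * Complex.exp (-(s : ℂ) ^ 3 / 3 - -Complex.I * rayUnit * x * s) =
        H (rayUnit * r) - H 0 := by
    intro r
    have hd : ∀ s : ℝ, HasDerivAt (fun s : ℝ => H (rayUnit * s))
        (rayUnit * Complex.exp (-(s : ℂ) ^ 3 / 3 - -Complex.I * rayUnit * x * s)) s := by
      intro s
      have h1 : HasDerivAt (fun s : ℝ => rayUnit * (s : ℂ)) rayUnit s := by
        simpa using (hasDerivAt_id s).ofReal_comp.const_mul rayUnit
      refine ((hH _).comp s h1).congr_deriv ?_
      rw [mul_comm _ rayUnit]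
      congr 2
      linear_combination (Complex.I * s ^ 3 / 3) * rayUnit_cube + (s ^ 3 / 3 : ℂ) * Complex.I_sq
    rw [intervalIntegral.integral_eq_sub_of_hasDerivAt (fun s _ => hd s)
      (Continuous.intervalIntegrable (by fun_prop) _ _)]
    simp
  have hlim : Tendsto (fun R : ℝ => H (rayUnit * (2 * R / √3 : ℝ)) - H 0) atTop
      (nhds (rayUnit * cubicLaplace (-Complex.I * rayUnit * x))) := by
    simp_rw [← hray]
    rw [cubicLaplace, ← integral_const_mul]
    refine intervalIntegral_tendsto_integral_Ioi 0 ((integrableOn_exp_cubic _).const_mul _) ?_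
    exact (tendsto_id.const_mul_atTop two_pos).atTop_div_const (by positivity)
  have hsum := hlim.sub (tendsto_primitive_sub_vertical hH)
  rw [sub_zero] at hsum
  refine ((Complex.continuous_re.tendsto _).comp hsum).congr fun R => ?_
  rw [hcos]
  have h3 : ((√3 : ℝ) : ℂ) ≠ 0 := by simp
  have : rayUnit * (2 * R / √3 : ℝ) = (R + (R / √3 : ℝ) * Complex.I : ℂ) := by
    rw [rayUnit]
    push_cast
    field_simp
  simp only [Function.comp, this]
  congr 1
  ring

lemma le_of_hasDerivAt_nonneg_s14 {φ φ' : ℝ → ℝ} (h : ∀ u, HasDerivAt φ (φ' u) u)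
    (h' : ∀ u, 0 ≤ u → 0 ≤ φ' u) {u : ℝ} (hu : 0 ≤ u) : φ 0 ≤ φ u := by
  refine monotoneOn_of_deriv_nonneg (convex_Ici 0)
    (fun u _ => (h u).continuousAt.continuousWithinAt)
    (fun u _ => (h u).differentiableAt.differentiableWithinAt) (fun u hu => ?_)
    (mem_Ici.2 le_rfl) hu hu
  rw [(h u).deriv]
  rw [interior_Ici] at hu
  exact h' u (le_of_lt hu)

/-- Along the imaginary axis a real solution `w` of the Airy equation, `f u = w (iu)`, grows
at least like `|u|³`, by iterated integration of the derivatives of `‖f‖²`. -/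
lemma normSq_lower_bound {f f₁ : ℝ → ℂ} (hf : ∀ u, HasDerivAt f (f₁ u) u)
    (hf₁ : ∀ u : ℝ, HasDerivAt f₁ (-Complex.I * u * f u) u) {A B : ℝ}
    (h0 : f 0 = A) (h1 : f₁ 0 = Complex.I * B) {u : ℝ} (hu : 0 ≤ u) :
    A ^ 2 * (1 + u ^ 6 / 120) ≤ ‖f u‖ ^ 2 := by
  have ha : ∀ u, HasDerivAt (fun u => (f u).re) (f₁ u).re u := fun u =>
    Complex.reCLM.hasFDerivAt.comp_hasDerivAt u (hf u)
  have hb : ∀ u, HasDerivAt (fun u => (f u).im) (f₁ u).im u := fun u =>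
    Complex.imCLM.hasFDerivAt.comp_hasDerivAt u (hf u)
  have ha₁ : ∀ u, HasDerivAt (fun u => (f₁ u).re) (u * (f u).im) u := by
    intro u
    exact (Complex.reCLM.hasFDerivAt.comp_hasDerivAt u (hf₁ u)).congr_deriv (by simp)
  have hb₁ : ∀ u, HasDerivAt (fun u => (f₁ u).im) (-u * (f u).re) u := by
    intro u
    exact (Complex.imCLM.hasFDerivAt.comp_hasDerivAt u (hf₁ u)).congr_deriv (by simp)
  set a := fun u => (f u).re
  set b := fun u => (f u).im
  set a₁ := fun u => (f₁ u).re
  set b₁ := fun u => (f₁ u).im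
  have a0 : a 0 = A := by simp [a, h0]
  have b0 : b 0 = 0 := by simp [b, h0]
  have a10 : a₁ 0 = 0 := by simp [a₁, h1]
  have b10 : b₁ 0 = B := by simp [b₁, h1]
  have hpow : ∀ (c : ℝ) (n : ℕ) (u : ℝ), HasDerivAt (fun u : ℝ => c * u ^ n) (c * (n * u ^ (n - 1))) u :=
    fun c n u => (hasDerivAt_pow n u).const_mul c
  have hp : ∀ u, HasDerivAt (fun u => a u * a₁ u + b u * b₁ u) (a₁ u ^ 2 + b₁ u ^ 2) u := by
    intro u
    exact (((ha u).mul (ha₁ u)).add ((hb u).mul (hb₁ u))).congr_deriv (by ring)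
  have hg : ∀ u, HasDerivAt (fun u => a u ^ 2 + b u ^ 2) (2 * (a u * a₁ u + b u * b₁ u)) u := by
    intro u
    exact (((ha u).pow 2).add ((hb u).pow 2)).congr_deriv (by simp; ring)
  have hm : ∀ u, HasDerivAt (fun u => a u * b₁ u - b u * a₁ u) (-u * (a u ^ 2 + b u ^ 2)) u := by
    intro u
    exact (((ha u).mul (hb₁ u)).sub ((hb u).mul (ha₁ u))).congr_deriv (by ring)
  have hv : ∀ u, HasDerivAt (fun u => a₁ u ^ 2 + b₁ u ^ 2) (-2 * u * (a u * b₁ u - b u * a₁ u)) u := by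
    intro u
    exact (((ha₁ u).pow 2).add ((hb₁ u).pow 2)).congr_deriv (by simp; ring)
  have p_nonneg : ∀ u, 0 ≤ u → 0 ≤ a u * a₁ u + b u * b₁ u := by
    intro u hu
    have := le_of_hasDerivAt_nonneg_s14 hp (fun u _ => by positivity) hu
    simpa [a10, b0] using this
  have g_ge : ∀ u, 0 ≤ u → A ^ 2 ≤ a u ^ 2 + b u ^ 2 := by
    intro u hu
    have := le_of_hasDerivAt_nonneg_s14 hg (fun u hu => by linarith [p_nonneg u hu]) hu
    simpa [a0, b0] using this
  have m_le : ∀ u, 0 ≤ u → a u * b₁ u - b u * a₁ u ≤ A * B - A ^ 2 / 2 * u ^ 2 := by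
    intro u hu
    have := le_of_hasDerivAt_nonneg_s14 (fun u => ((hpow (A ^ 2 / 2) 2 u).add (hm u)).neg)
      (fun u hu => by
        have := mul_nonneg hu (sub_nonneg.2 (g_ge u hu))
        norm_num; nlinarith) hu
    norm_num [a0, b0, b10] at this
    linarith
  have v_ge : ∀ u, 0 ≤ u → B ^ 2 - A * B * u ^ 2 + A ^ 2 / 4 * u ^ 4 ≤ a₁ u ^ 2 + b₁ u ^ 2 := by
    intro u hu
    have := le_of_hasDerivAt_nonneg_s14
      (fun u => ((hv u).add (hpow (A * B) 2 u)).sub (hpow (A ^ 2 / 4) 4 u))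
      (fun u hu => by
        have := mul_nonneg hu (sub_nonneg.2 (m_le u hu))
        norm_num; nlinarith) hu
    norm_num [a10, b10] at this
    linarith
  have p_ge : ∀ u, 0 ≤ u →
      B ^ 2 * u - A * B / 3 * u ^ 3 + A ^ 2 / 20 * u ^ 5 ≤ a u * a₁ u + b u * b₁ u := by
    intro u hu
    have := le_of_hasDerivAt_nonneg_s14
      (fun u => (((hp u).sub (hpow (B ^ 2) 1 u)).add (hpow (A * B / 3) 3 u)).sub
        (hpow (A ^ 2 / 20) 5 u))
      (fun u hu => by
        have := v_ge u hu
        norm_num; linarith) hu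
    norm_num [a10, b0] at this
    linarith
  have g_ge' : A ^ 2 + B ^ 2 * u ^ 2 - A * B / 6 * u ^ 4 + A ^ 2 / 60 * u ^ 6 ≤ a u ^ 2 + b u ^ 2 := by
    have := le_of_hasDerivAt_nonneg_s14
      (fun u => (((hg u).sub (hpow (B ^ 2) 2 u)).add (hpow (A * B / 6) 4 u)).sub
        (hpow (A ^ 2 / 60) 6 u))
      (fun u hu => by
        have := p_ge u hu
        norm_num; linarith) hu
    norm_num [a0, b0] at this
    linarith
  have hsq : ‖f u‖ ^ 2 = a u ^ 2 + b u ^ 2 := by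
    rw [← Complex.normSq_eq_norm_sq, Complex.normSq_apply]; ring
  rw [hsq]
  refine le_trans ?_ g_ge'
  nlinarith [sq_nonneg (B * u - A / 12 * u ^ 3), sq_nonneg (A * u ^ 3)]

lemma eq_cubicLaplace_of_airy_integral {Ai : ℂ → ℂ} (hd : Differentiable ℂ Ai)
    (him : ∀ x : ℝ, (Ai (x : ℂ)).im = 0)
    (hlim : ∀ x : ℝ, Tendsto (fun R : ℝ => ∫ t in (0:ℝ)..R, Real.cos (t ^ 3 / 3 + x * t))
      atTop (nhds (Real.pi * (Ai (x : ℂ)).re))) (z : ℂ) :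
    Ai z = 1 / (2 * Real.pi) * (rayUnit * cubicLaplace (-Complex.I * rayUnit * z) +
      (starRingEnd ℂ) rayUnit * cubicLaplace (Complex.I * (starRingEnd ℂ) rayUnit * z)) := by
  have hG : Differentiable ℂ cubicLaplace := fun y => (hasDerivAt_cubicLaplace y).differentiableAt
  have hpi : (Real.pi : ℂ) ≠ 0 := Complex.ofReal_ne_zero.2 Real.pi_ne_zero
  have hreal : ∀ x : ℝ, Ai x = 1 / (2 * Real.pi) *
      (rayUnit * cubicLaplace (-Complex.I * rayUnit * x) +
        (starRingEnd ℂ) rayUnit * cubicLaplace (Complex.I * (starRingEnd ℂ) rayUnit * x)) := by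
    intro x
    have h1 := tendsto_nhds_unique (hlim x) (tendsto_integral_cos_cubic x)
    have h2 : Ai x = ((Ai x).re : ℂ) := Complex.ext (by simp) (by simp [him x])
    have h3 := Complex.add_conj (rayUnit * cubicLaplace (-Complex.I * rayUnit * x))
    rw [← h1] at h3
    simp only [map_mul, conj_cubicLaplace, map_neg, Complex.conj_I, neg_neg,
      Complex.conj_ofReal] at h3
    rw [h3, h2]
    push_cast
    field_simp
    simp
  refine congrFun (AnalyticOnNhd.eq_of_frequently_eq (𝕜 := ℂ) (z₀ := 0) (g := fun z =>
      1 / (2 * Real.pi) * (rayUnit * cubicLaplace (-Complex.I * rayUnit * z) +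
        (starRingEnd ℂ) rayUnit * cubicLaplace (Complex.I * (starRingEnd ℂ) rayUnit * z)))
    (fun z _ => hd.analyticAt z) (fun z _ => Differentiable.analyticAt (by fun_prop) z) ?_) z
  have htend : Tendsto (fun x : ℝ => (x : ℂ)) (nhdsWithin 0 {0}ᶜ) (nhdsWithin 0 {0}ᶜ) := by
    refine tendsto_nhdsWithin_of_tendsto_nhds_of_eventually_within _ ?_ ?_
    · exact (Complex.continuous_ofReal.tendsto' 0 0 (by simp)).mono_left nhdsWithin_le_nhds
    · filter_upwards [self_mem_nhdsWithin] with x hx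
      simpa using hx
  exact htend.frequently (Eventually.of_forall hreal).frequently

/-- If `V` is a solution of `w'' = -iuw` which is bounded on the half-line, then reduction of order
computes the integral of `1 / f²` for a growing solution `f` from initial values. -/
lemma integral_Ioi_one_div_sq_mul_wronskian {f f₁ V V₁ : ℝ → ℂ}
    (hf : ∀ u, HasDerivAt f (f₁ u) u)
    (hf₁ : ∀ u : ℝ, HasDerivAt f₁ (-Complex.I * u * f u) u)
    (hV : ∀ u, HasDerivAt V (V₁ u) u)
    (hV₁ : ∀ u : ℝ, HasDerivAt V₁ (-Complex.I * u * V u) u)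
    {c M : ℝ} (hc : 0 < c) (hlow : ∀ u : ℝ, 0 ≤ u → c * (1 + u ^ 2) ≤ ‖f u‖ ^ 2)
    (hM : ∀ u : ℝ, 0 ≤ u → ‖V u‖ ≤ M) :
    IntegrableOn (fun u => 1 / f u ^ 2) (Ioi 0) ∧
      (∫ u in Ioi (0 : ℝ), 1 / f u ^ 2) * (V₁ 0 * f 0 - V 0 * f₁ 0) = -(V 0 / f 0) := by
  have hne : ∀ u : ℝ, 0 ≤ u → f u ≠ 0 := by
    intro u hu h
    have := hlow u hu
    rw [h] at this
    norm_num at this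
    nlinarith [sq_nonneg u, mul_nonneg hc.le (sq_nonneg u)]
  have hfc : Continuous f := continuous_iff_continuousAt.2 fun u => (hf u).continuousAt
  have hint : IntegrableOn (fun u => 1 / f u ^ 2) (Ioi 0) := by
    refine ((integrable_inv_one_add_sq.const_mul c⁻¹).integrableOn (s := Ioi 0)).mono' ?_ ?_
    · exact (ContinuousOn.div continuousOn_const (hfc.pow 2).continuousOn fun u hu =>
        pow_ne_zero 2 (hne u (le_of_lt hu))).aestronglyMeasurable measurableSet_Ioi
    · filter_upwards [ae_restrict_mem measurableSet_Ioi] with u hu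
      rw [norm_div, norm_one, norm_pow, ← mul_inv, one_div]
      exact inv_anti₀ (by positivity) (hlow u (le_of_lt hu))
  refine ⟨hint, ?_⟩
  have hw : ∀ u, V₁ u * f u - V u * f₁ u = V₁ 0 * f 0 - V 0 * f₁ 0 := by
    have hd : ∀ u, HasDerivAt (fun u => V₁ u * f u - V u * f₁ u) 0 u := fun u =>
      (((hV₁ u).mul (hf u)).sub ((hV u).mul (hf₁ u))).congr_deriv (by ring)
    exact fun u => is_const_of_deriv_eq_zero (fun u => (hd u).differentiableAt)
      (fun u => (hd u).deriv) u 0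
  have hquot : ∀ u : ℝ, 0 ≤ u → HasDerivAt (fun u => V u / f u)
      (1 / f u ^ 2 * (V₁ 0 * f 0 - V 0 * f₁ 0)) u := fun u hu =>
    ((hV u).div (hf u) (hne u hu)).congr_deriv (by rw [hw u]; ring)
  have hlim : Tendsto (fun u => V u / f u) atTop (nhds 0) := by
    have htop : Tendsto (fun u => ‖f u‖) atTop atTop := by
      refine tendsto_atTop_mono' _ ?_ (tendsto_id.const_mul_atTop (Real.sqrt_pos.2 hc))
      filter_upwards [eventually_ge_atTop 0] with u hu
      refine abs_le_of_sq_le_sq' ?_ (norm_nonneg _) |>.2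
      simp only [id, mul_pow, Real.sq_sqrt hc.le]
      nlinarith [hlow u hu]
    refine squeeze_zero_norm' ?_ (htop.const_div_atTop M)
    filter_upwards [eventually_ge_atTop 0] with u hu
    rw [norm_div]
    gcongr
    exact hM u hu
  rw [← integral_mul_const, integral_Ioi_of_hasDerivAt_of_tendsto
    (hquot 0 le_rfl).continuousAt.continuousWithinAt (fun u hu => hquot u (le_of_lt hu))
    (hint.mul_const _) hlim, zero_sub]

lemma airy_comp_ray {Ai : ℂ → ℂ} (hd : Differentiable ℂ Ai)
    (hode : ∀ z : ℂ, deriv (deriv Ai) z = z * Ai z) {e : ℂ} (he : e ^ 3 = -Complex.I) (u : ℝ) :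
    HasDerivAt (fun u : ℝ => Ai (e * u)) (e * deriv Ai (e * u)) u ∧
      HasDerivAt (fun u : ℝ => e * deriv Ai (e * u)) (-Complex.I * u * Ai (e * u)) u := by
  have hl : HasDerivAt (fun u : ℝ => e * (u : ℂ)) e u := by
    simpa using (hasDerivAt_id u).ofReal_comp.const_mul e
  have hd' : Differentiable ℂ (deriv Ai) := by
    rw [← differentiableOn_univ] at hd ⊢
    exact hd.deriv isOpen_univ
  constructor
  · exact ((hd (e * u)).hasDerivAt.comp u hl).congr_deriv (mul_comm _ _)
  · refine (((hd' (e * u)).hasDerivAt.comp u hl).const_mul e).congr_deriv ?_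
    rw [hode, ← he]
    ring

lemma airy_integral_Ioi {Ai : ℂ → ℂ} (hd : Differentiable ℂ Ai)
    (hode : ∀ z : ℂ, deriv (deriv Ai) z = z * Ai z)
    (hrep : ∀ z, Ai z = 1 / (2 * Real.pi) * (rayUnit * cubicLaplace (-Complex.I * rayUnit * z) +
      (starRingEnd ℂ) rayUnit * cubicLaplace (Complex.I * (starRingEnd ℂ) rayUnit * z))) :
    IntegrableOn (fun u : ℝ => 1 / Ai (Complex.I * u) ^ 2) (Ioi 0) ∧
      ∫ u in Ioi (0 : ℝ), 1 / Ai (Complex.I * u) ^ 2 = Real.pi * (1 + √3 * Complex.I) := by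
  obtain ⟨a, b, ha, hb, hab⟩ := cubicLaplace_initial_values
  have hpi : (Real.pi : ℂ) ≠ 0 := Complex.ofReal_ne_zero.2 Real.pi_ne_zero
  have h3 : ((√3 : ℝ) : ℂ) ≠ 0 := by simp
  have hpi' := Real.pi_ne_zero
  have h3' : √3 ≠ 0 := by positivity
  set A : ℝ := √3 * a / (2 * Real.pi) with hA
  set B : ℝ := √3 * b / (2 * Real.pi) with hB
  have hAB : A * B = -1 / (2 * Real.pi * √3) := by
    have : A * B = (√3 ^ 2 * (a * b)) / (2 * Real.pi) ^ 2 := by rw [hA, hB]; field_simp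
    rw [this, hab, Real.sq_sqrt (by norm_num)]
    field_simp
  have hA0 : A ≠ 0 := by
    intro h
    rw [h, zero_mul] at hAB
    have : -1 / (2 * Real.pi * √3) ≠ 0 := by positivity
    exact this hAB.symm
  have hAi0 : Ai 0 = A := by
    rw [hrep, mul_zero, mul_zero, ha, conj_rayUnit, rayUnit, hA]
    push_cast
    field_simp
    ring
  have hAi0' : deriv Ai 0 = B := by
    have hc : ∀ k : ℂ, HasDerivAt (fun z => cubicLaplace (k * z)) (b * k) 0 := by
      intro k
      have h1 : HasDerivAt (fun z : ℂ => k * z) k 0 := by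
        simpa using (hasDerivAt_id (0 : ℂ)).const_mul k
      exact HasDerivAt.comp (0 : ℂ) (h₂ := cubicLaplace) (by rwa [mul_zero]) h1
    have := (((hc (-Complex.I * rayUnit)).const_mul rayUnit).add
      ((hc (Complex.I * (starRingEnd ℂ) rayUnit)).const_mul ((starRingEnd ℂ) rayUnit))).const_mul
        (1 / (2 * Real.pi) : ℂ)
    rw [show Ai = _ from funext hrep]
    refine this.deriv.trans ?_
    rw [conj_rayUnit, rayUnit, hB]
    push_cast
    field_simp
    linear_combination (-4 * √3 * b : ℂ) * Complex.I_sq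
  have hI3 : Complex.I ^ 3 = -Complex.I := Complex.I_pow_three
  have he3 : ((starRingEnd ℂ) rayUnit) ^ 3 = -Complex.I := by
    rw [← map_pow, rayUnit_cube, Complex.conj_I]
  have hlow : ∀ u : ℝ, 0 ≤ u → A ^ 2 / 240 * (1 + u ^ 2) ≤ ‖Ai (Complex.I * u)‖ ^ 2 := by
    intro u hu
    refine le_trans ?_ (normSq_lower_bound (A := A) (B := B)
      (fun u => (airy_comp_ray hd hode hI3 u).1)
      (fun u => (airy_comp_ray hd hode hI3 u).2) (by simpa using hAi0) (by simp [hAi0']) hu)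
    have h1 : u ^ 2 ≤ 1 + u ^ 6 := by
      nlinarith [sq_nonneg (u ^ 3 - u), sq_nonneg (u ^ 2 - 1), sq_nonneg (u * (u ^ 2 - 1)), sq_nonneg u]
    have h2 : 0 ≤ A ^ 2 := sq_nonneg A
    have h6 : 0 ≤ u ^ 6 := by positivity
    have : A ^ 2 / 240 * (1 + u ^ 2) = A ^ 2 * ((1 + u ^ 2) / 240) := by ring
    rw [this]
    gcongr
    linarith
  have hbound : ∀ u : ℝ, 0 ≤ u → ‖Ai ((starRingEnd ℂ) rayUnit * u)‖ ≤
      ‖(1 / (2 * Real.pi) : ℂ)‖ * (‖rayUnit‖ * (∫ s in Ioi (0 : ℝ), Real.exp (-s ^ 3 / 3)) +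
        ‖(starRingEnd ℂ) rayUnit‖ * ∫ s in Ioi (0 : ℝ), Real.exp (-s ^ 3 / 3)) := by
    intro u hu
    rw [hrep, norm_mul]
    gcongr
    refine (norm_add_le _ _).trans ?_
    rw [norm_mul, norm_mul]
    gcongr
    · refine norm_cubicLaplace_le (le_of_eq ?_)
      have : -Complex.I * rayUnit * ((starRingEnd ℂ) rayUnit * u) = -(u * Complex.I) := by
        rw [conj_rayUnit, rayUnit]
        linear_combination (-Complex.I * u / 4) * ofReal_sqrt_three_sq +
          (Complex.I * u / 4) * Complex.I_sq
      rw [this]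
      simp
    · refine norm_cubicLaplace_le ?_
      have : Complex.I * (starRingEnd ℂ) rayUnit * ((starRingEnd ℂ) rayUnit * u) = u * rayUnit := by
        rw [conj_rayUnit, rayUnit]
        linear_combination (Complex.I * u / 4) * ofReal_sqrt_three_sq +
          ((Complex.I - 2 * √3) * u / 4) * Complex.I_sq
      rw [this, Complex.re_ofReal_mul]
      refine mul_nonneg hu ?_
      rw [rayUnit]
      simp
      positivity
  obtain ⟨hint, hval⟩ := integral_Ioi_one_div_sq_mul_wronskian
    (fun u => (airy_comp_ray hd hode hI3 u).1) (fun u => (airy_comp_ray hd hode hI3 u).2)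
    (fun u => (airy_comp_ray hd hode he3 u).1) (fun u => (airy_comp_ray hd hode he3 u).2)
    (by positivity) hlow hbound
  refine ⟨hint, ?_⟩
  have hABc : (A : ℂ) * B * (2 * Real.pi * √3) = -1 := by
    have : A * B * (2 * Real.pi * √3) = -1 := by rw [hAB]; field_simp
    exact_mod_cast this
  have hA0c : (A : ℂ) ≠ 0 := Complex.ofReal_ne_zero.2 hA0
  simp only [Complex.ofReal_zero, mul_zero, hAi0, hAi0', div_self hA0c, conj_rayUnit] at hval
  set J := ∫ u in Ioi (0 : ℝ), 1 / Ai (Complex.I * u) ^ 2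
  have hJ : J * (√3 - 3 * Complex.I) = 4 * Real.pi * √3 := by
    linear_combination (-4 * Real.pi * √3 : ℂ) * hval + J * (√3 - 3 * Complex.I) * hABc
  have h12 : (12 : ℂ) ≠ 0 := by norm_num
  refine mul_left_cancel₀ h12 ?_
  linear_combination (√3 + 3 * Complex.I) * hJ + (4 * Real.pi - J) * ofReal_sqrt_three_sq +
    9 * J * Complex.I_sq

/-- Appendix D of the paper. The integral over the imaginary axis of the
reciprocal squared Airy function satisfies `(1/2π) ∫_ℝ 1/Ai(iu)² du = 1`. -/
theorem chernoff_stmt_14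
    (Ai Bi : ℂ → ℂ) (hAiry : IsAiry Ai Bi) :
    (1 / (2 * (Real.pi : ℂ))) * ∫ u : ℝ, 1 / Ai (Complex.I * u) ^ 2 = 1 := by
  obtain ⟨hd, -, hode, -, him, -, hlim, -⟩ := hAiry
  have hrep := eq_cubicLaplace_of_airy_integral hd him hlim
  obtain ⟨hint, hval⟩ := airy_integral_Ioi hd hode hrep
  have hconj : ∀ u : ℝ, 1 / Ai (Complex.I * (-u : ℝ)) ^ 2 =
      (starRingEnd ℂ) (1 / Ai (Complex.I * u) ^ 2) := by
    intro u
    have : Ai (Complex.I * (-u : ℝ)) = (starRingEnd ℂ) (Ai (Complex.I * u)) := by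
      rw [hrep, hrep (Complex.I * u)]
      simp only [map_mul, map_add, map_div₀, map_one, map_ofNat, conj_cubicLaplace, map_neg,
        Complex.conj_I, Complex.conj_ofReal, Complex.conj_conj, neg_neg, Complex.ofReal_neg]
      rw [add_comm]
      simp only [mul_neg, neg_mul]
    rw [this]
    simp
  have hneg : ∫ u in Iic (0 : ℝ), 1 / Ai (Complex.I * u) ^ 2 =
      (starRingEnd ℂ) (Real.pi * (1 + √3 * Complex.I)) := by
    have h := integral_comp_neg_Ioi 0 fun u : ℝ => 1 / Ai (Complex.I * u) ^ 2
    rw [neg_zero] at h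
    simp_rw [← h, hconj]
    rw [integral_conj, hval]
  have hintneg : IntegrableOn (fun u : ℝ => 1 / Ai (Complex.I * u) ^ 2) (Iic 0) := by
    rw [integrableOn_Iic_iff_integrableOn_Iio,
      ← (Measure.measurePreserving_neg volume).integrableOn_comp_preimage
        (MeasurableEquiv.neg ℝ).measurableEmbedding]
    have hpre : (Neg.neg : ℝ → ℝ) ⁻¹' Iio 0 = Ioi 0 := by ext; simp
    rw [hpre]
    exact ((Complex.conjCLE.toContinuousLinearMap.restrictScalars ℝ).integrable_comp hint).congr
      (Eventually.of_forall fun u => (hconj u).symm)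
  rw [← intervalIntegral.integral_Iic_add_Ioi hintneg hint, hneg, hval]
  have hpi : (Real.pi : ℂ) ≠ 0 := Complex.ofReal_ne_zero.2 Real.pi_ne_zero
  simp only [map_mul, map_add, map_one, Complex.conj_I, Complex.conj_ofReal]
  field_simp
  ring

end
end

section
/- For every λ > 0, the function u_λ(x) = Ai(2^{−1/3}λ − 4^{1/3}x)/Ai(2^{−1/3}λ) is the unique nonnegative solution of the boundary value problem (1/2)u''(x) − (λ − 2x)u(x) = 0 for x < 0, with lim_{x↑0} u(x) = 1 and u(x) ≤ 1 for all x ≤ 0. -/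
open MeasureTheory ProbabilityTheory Filter Set

noncomputable section

/-- A convex function on a left half-line that is bounded above is monotone. -/
lemma ConvexOn.monotoneOn_Iio_of_le {h : ℝ → ℝ} {b C : ℝ} (hc : ConvexOn ℝ (Iio b) h)
    (hC : ∀ x < b, h x ≤ C) : MonotoneOn h (Iio b) := by
  intro x hx y hy hxy
  rcases hxy.eq_or_lt with rfl | hxy
  · exact le_rfl
  by_contra! hlt
  have hs : 0 < (h x - h y) / (y - x) := div_pos (by linarith) (by linarith)
  obtain ⟨N, hN⟩ := exists_nat_gt ((C - h x) / ((h x - h y) / (y - x)))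
  rw [div_lt_iff₀ hs] at hN
  have hz : x - ((N : ℝ) + 1) < x := by have := N.cast_nonneg (α := ℝ); linarith
  have hzb : x - ((N : ℝ) + 1) < b := hz.trans hx
  have key := hc.slope_mono_adjacent (mem_Iio.2 hzb) hy hz hxy
  have hN1 : (0 : ℝ) < N + 1 := by positivity
  rw [show x - (x - ((N : ℝ) + 1)) = N + 1 by ring, div_le_iff₀ hN1,
    show (h y - h x) / (y - x) = -((h x - h y) / (y - x)) by ring] at key
  have := hC _ hzb
  nlinarith

/-- The square of a bounded solution of `w'' = k w` with `k ≥ 0` on a left half-line is monotone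
there. -/
lemma monotoneOn_sq_of_bounded_solution {w w' k : ℝ → ℝ} {b C : ℝ}
    (h1 : ∀ x < b, HasDerivAt w (w' x) x) (h2 : ∀ x < b, HasDerivAt w' (k x * w x) x)
    (hk : ∀ x < b, 0 ≤ k x) (hC : ∀ x < b, |w x| ≤ C) :
    MonotoneOn (fun x => w x ^ 2) (Iio b) := by
  refine ConvexOn.monotoneOn_Iio_of_le (C := C ^ 2) ?_ fun x hx => sq_le_sq' ?_ ?_
  · refine convexOn_of_hasDerivWithinAt2_nonneg (convex_Iio b)
      (f' := fun x => 2 * (w x * w' x)) (f'' := fun x => 2 * (w' x ^ 2 + k x * w x ^ 2))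
      (fun x hx => ((h1 x hx).pow 2).continuousAt.continuousWithinAt) ?_ ?_ ?_ <;>
      rw [interior_Iio] <;> intro x hx
    · exact (((h1 x hx).pow 2).congr_deriv (by push_cast; ring)).hasDerivWithinAt
    · exact ((((h1 x hx).mul (h2 x hx)).const_mul 2).congr_deriv (by ring)).hasDerivWithinAt
    · have := hk x hx
      positivity
  · exact (abs_le.1 (hC x hx)).1
  · exact (abs_le.1 (hC x hx)).2

/-- First-derivative (van der Corput) bound for the oscillatory Airy integral. -/
lemma abs_integral_cos_airy_phase_le {x T R : ℝ} (hT : 0 ≤ T) (hTR : T ≤ R)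
    (hp : 0 < T ^ 2 + x) :
    |∫ t in T..R, Real.cos (t ^ 3 / 3 + x * t)| ≤ 2 / (T ^ 2 + x) := by
  have hpos : ∀ t ∈ uIcc T R, 0 < t ^ 2 + x := by
    intro t ht
    rw [uIcc_of_le hTR] at ht
    nlinarith [ht.1]
  have hφ : ∀ t : ℝ, HasDerivAt (fun t => t ^ 3 / 3 + x * t) (t ^ 2 + x) t := fun t =>
    (((hasDerivAt_pow 3 t).div_const 3).add ((hasDerivAt_id t).const_mul x)).congr_deriv
      (by push_cast; ring)
  have hψ : ∀ t : ℝ, HasDerivAt (fun t => t ^ 2 + x) (2 * t) t := fun t =>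
    ((hasDerivAt_pow 2 t).add_const x).congr_deriv (by push_cast; ring)
  set g : ℝ → ℝ := fun t => 2 * t / (t ^ 2 + x) ^ 2
  have hF : ∀ t ∈ uIcc T R, HasDerivAt (fun t => Real.sin (t ^ 3 / 3 + x * t) / (t ^ 2 + x))
      (Real.cos (t ^ 3 / 3 + x * t) - Real.sin (t ^ 3 / 3 + x * t) * g t) t := fun t ht => by
    have hne := (hpos t ht).ne'
    refine ((hφ t).sin.div (hψ t) hne).congr_deriv ?_
    simp only [g]
    field_simp
  have hG : ∀ t ∈ uIcc T R, HasDerivAt (fun t => -(t ^ 2 + x)⁻¹) (g t) t := fun t ht =>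
    ((hψ t).inv (hpos t ht).ne').neg.congr_deriv (by simp only [g]; ring)
  have hgc : ContinuousOn g (uIcc T R) := by
    refine ContinuousOn.div (by fun_prop) (by fun_prop) fun t ht => ?_
    exact pow_ne_zero 2 (hpos t ht).ne'
  have hcos : Continuous fun t : ℝ => Real.cos (t ^ 3 / 3 + x * t) := by fun_prop
  have hsin : Continuous fun t : ℝ => Real.sin (t ^ 3 / 3 + x * t) := by fun_prop
  have iG : IntervalIntegrable g volume T R := hgc.intervalIntegrable
  have iC := hcos.intervalIntegrable (μ := volume) T R
  have iS : IntervalIntegrable (fun t => Real.sin (t ^ 3 / 3 + x * t) * g t) volume T R :=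
    (hsin.continuousOn.mul hgc).intervalIntegrable
  have eF := intervalIntegral.integral_eq_sub_of_hasDerivAt hF (iC.sub iS)
  have eG := intervalIntegral.integral_eq_sub_of_hasDerivAt hG iG
  rw [intervalIntegral.integral_sub iC iS] at eF
  have bS : |∫ t in T..R, Real.sin (t ^ 3 / 3 + x * t) * g t| ≤ ∫ t in T..R, g t := by
    rw [← Real.norm_eq_abs]
    refine intervalIntegral.norm_integral_le_of_norm_le hTR (ae_of_all _ fun t ht => ?_) iG
    have h0 : 0 ≤ g t := div_nonneg (by linarith [ht.1]) (by positivity)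
    rw [norm_mul, Real.norm_eq_abs, Real.norm_eq_abs, abs_of_nonneg h0]
    exact mul_le_of_le_one_left h0 (Real.abs_sin_le_one _)
  have bF : ∀ t ∈ uIcc T R,
      |Real.sin (t ^ 3 / 3 + x * t) / (t ^ 2 + x)| ≤ (t ^ 2 + x)⁻¹ := fun t ht => by
    rw [abs_div, abs_of_pos (hpos t ht), ← one_div]
    exact div_le_div_of_nonneg_right (Real.abs_sin_le_one _) (hpos t ht).le
  have b1 := abs_le.1 (bF T left_mem_uIcc)
  have b2 := abs_le.1 (bF R right_mem_uIcc)
  have b3 := abs_le.1 bS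
  rw [abs_le, div_eq_mul_inv]
  constructor <;> linarith [b1.1, b1.2, b2.1, b2.2, b3.1, b3.2]

/-- The Airy integral at the origin is bounded below by a positive constant. -/
lemma integral_cos_cube_ge {R : ℝ} (hR : 3 / 2 ≤ R) :
    (1 / 4 : ℝ) ≤ ∫ t in (0 : ℝ)..R, Real.cos (t ^ 3 / 3 + 0 * t) := by
  have hcos : Continuous fun t : ℝ => Real.cos (t ^ 3 / 3 + 0 * t) := by fun_prop
  rw [← intervalIntegral.integral_add_adjacent_intervals
    (hcos.intervalIntegrable (μ := volume) 0 (3 / 2)) (hcos.intervalIntegrable (3 / 2) R)]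
  have h1 := (abs_le.1 (abs_integral_cos_airy_phase_le (x := 0) (T := 3 / 2)
    (by norm_num) hR (by norm_num))).1
  have hpoly : Continuous fun t : ℝ => 1 - t ^ 6 / 18 := by fun_prop
  have h2 : ∫ t in (0 : ℝ)..(3 / 2), (1 - t ^ 6 / 18)
      ≤ ∫ t in (0 : ℝ)..(3 / 2), Real.cos (t ^ 3 / 3 + 0 * t) := by
    refine intervalIntegral.integral_mono_on (by norm_num) (hpoly.intervalIntegrable _ _)
      (hcos.intervalIntegrable _ _) fun t _ => ?_
    refine le_trans (le_of_eq ?_) (Real.one_sub_sq_div_two_le_cos (x := t ^ 3 / 3 + 0 * t))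
    ring
  have h3 : ∫ t in (0 : ℝ)..(3 / 2), (1 - t ^ 6 / 18) = 3 / 2 - (3 / 2) ^ 7 / 126 := by
    have hd : ∀ t ∈ uIcc (0 : ℝ) (3 / 2),
        HasDerivAt (fun t : ℝ => t - t ^ 7 / 126) (1 - t ^ 6 / 18) t := fun t _ =>
      ((hasDerivAt_id t).sub ((hasDerivAt_pow 7 t).div_const 126)).congr_deriv
        (by push_cast; ring)
    rw [intervalIntegral.integral_eq_sub_of_hasDerivAt hd (hpoly.intervalIntegrable _ _)]
    norm_num
  rw [h3] at h2
  norm_num at h1 h2 ⊢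
  linarith

namespace IsAiry

variable {Ai Bi : ℂ → ℂ}

lemma ofReal_re (h : IsAiry Ai Bi) (x : ℝ) : (((Ai x).re : ℝ) : ℂ) = Ai x :=
  Complex.ext rfl (by simp [h.2.2.2.2.1 x])

lemma hasDerivAt_re (h : IsAiry Ai Bi) (x : ℝ) :
    HasDerivAt (fun y : ℝ => (Ai y).re) (deriv Ai x).re x :=
  (h.1 x).hasDerivAt.real_of_complex

lemma hasDerivAt_deriv_re (h : IsAiry Ai Bi) (x : ℝ) :
    HasDerivAt (fun y : ℝ => (deriv Ai y).re) (x * (Ai x).re) x := by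
  have hd : Differentiable ℂ (deriv Ai) :=
    (h.1.contDiff (n := 2)).differentiable_deriv_two
  refine (hd x).hasDerivAt.real_of_complex.congr_deriv ?_
  simp [h.2.2.1 x]

lemma abs_re_le (h : IsAiry Ai Bi) {x : ℝ} (hx : 0 < x) : |(Ai x).re| ≤ 2 / x := by
  have hb : |Real.pi * (Ai x).re| ≤ 2 / x := by
    refine le_of_tendsto (h.2.2.2.2.2.2.1 x).abs ?_
    filter_upwards [eventually_ge_atTop 0] with R hR
    simpa using abs_integral_cos_airy_phase_le le_rfl hR (by simpa using hx)
  rw [abs_mul, abs_of_pos Real.pi_pos] at hb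
  nlinarith [abs_nonneg (Ai x).re, Real.pi_gt_three]

lemma re_zero_pos (h : IsAiry Ai Bi) : 0 < (Ai (0 : ℝ)).re := by
  have hb : (1 / 4 : ℝ) ≤ Real.pi * (Ai (0 : ℝ)).re := by
    refine ge_of_tendsto (h.2.2.2.2.2.2.1 0) ?_
    filter_upwards [eventually_ge_atTop (3 / 2)] with R hR using integral_cos_cube_ge hR
  exact pos_of_mul_pos_right (by linarith) Real.pi_pos.le

lemma antitoneOn_re_sq (h : IsAiry Ai Bi) :
    AntitoneOn (fun x : ℝ => (Ai x).re ^ 2) (Ioi 0) := by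
  intro p hp q hq hpq
  have hp' : 0 < p := hp
  have hneg : ∀ x : ℝ, HasDerivAt (fun y : ℝ => -y) (-1) x := hasDerivAt_neg
  have hm := monotoneOn_sq_of_bounded_solution (w := fun x : ℝ => (Ai ((-x : ℝ) : ℂ)).re)
    (w' := fun x : ℝ => -(deriv Ai ((-x : ℝ) : ℂ)).re) (k := fun x => -x)
    (b := -(p / 2)) (C := 2 / (p / 2))
    (fun x _ => ((h.hasDerivAt_re (-x)).comp x (hneg x)).congr_deriv (by ring))
    (fun x _ => ((h.hasDerivAt_deriv_re (-x)).comp x (hneg x)).neg.congr_deriv (by ring))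
    (fun x hx => by linarith)
    (fun x hx => (h.abs_re_le (by linarith)).trans
      (div_le_div_of_nonneg_left (by norm_num) (by linarith) (by linarith)))
  have := hm (a := -q) (b := -p) (by simp only [mem_Iio]; linarith)
    (by simp only [mem_Iio]; linarith) (by linarith)
  simpa only [neg_neg] using this

lemma re_ne_zero (h : IsAiry Ai Bi) {x : ℝ} (hx : 0 < x) : (Ai x).re ≠ 0 := by
  intro h0
  have hz : ∀ y : ℝ, x ≤ y → Ai y = 0 := by
    intro y hy
    have hle := h.antitoneOn_re_sq (mem_Ioi.2 hx) (mem_Ioi.2 (hx.trans_le hy)) hy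
    simp only [h0] at hle
    have : (Ai y).re = 0 := pow_eq_zero_iff two_ne_zero |>.1
      (le_antisymm (by simpa using hle) (sq_nonneg _))
    rw [← h.ofReal_re, this, Complex.ofReal_zero]
  have han : AnalyticOnNhd ℂ Ai univ := h.1.differentiableOn.analyticOnNhd isOpen_univ
  have hfr : ∃ᶠ z in nhdsWithin (x : ℂ) {(x : ℂ)}ᶜ, Ai z = 0 := by
    have ht : Tendsto (fun y : ℝ => (y : ℂ)) (nhdsWithin x (Ioi x))
        (nhdsWithin (x : ℂ) {(x : ℂ)}ᶜ) := by
      refine tendsto_nhdsWithin_iff.2 ⟨?_, ?_⟩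
      · exact (Complex.continuous_ofReal.tendsto x).mono_left nhdsWithin_le_nhds
      · filter_upwards [self_mem_nhdsWithin] with y hy
        simpa using (ne_of_gt hy)
    refine ht.frequently (Eventually.frequently ?_)
    filter_upwards [self_mem_nhdsWithin] with y hy using hz y (le_of_lt hy)
  have hall := han.eqOn_zero_of_preconnected_of_frequently_eq_zero isPreconnected_univ
    (mem_univ _) hfr (mem_univ ((0 : ℝ) : ℂ))
  have := h.re_zero_pos
  rw [hall] at this
  simp at this

lemma re_div_mem_Icc (h : IsAiry Ai Bi) {x y : ℝ} (hx : 0 < x) (hxy : x ≤ y) :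
    (Ai y).re / (Ai x).re ∈ Icc (0 : ℝ) 1 := by
  have hc : Continuous fun t : ℝ => (Ai t).re :=
    Complex.continuous_re.comp (h.1.continuous.comp Complex.continuous_ofReal)
  have hpos : ∀ z : ℝ, 0 < z → 0 < (Ai z).re := by
    intro z hz
    by_contra! hle
    obtain ⟨t, ht, h0⟩ := intermediate_value_Icc' hz.le hc.continuousOn ⟨hle, h.re_zero_pos.le⟩
    rcases ht.1.eq_or_lt with rfl | ht0
    · exact h.re_zero_pos.ne' h0
    · exact h.re_ne_zero ht0 h0
  have hy := hpos y (hx.trans_le hxy)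
  have hx' := hpos x hx
  have hle := h.antitoneOn_re_sq (mem_Ioi.2 hx) (mem_Ioi.2 (hx.trans_le hxy)) hxy
  exact ⟨by positivity, (div_le_one hx').2 (le_of_sq_le_sq hle hx'.le)⟩

end IsAiry

/-- Appendix A of the paper. For every `λ > 0`, the function
`u_λ(x) = Ai(2^{-1/3}λ - 4^{1/3}x)/Ai(2^{-1/3}λ)` is the unique nonnegative solution of the
boundary value problem `(1/2)u''(x) - (λ - 2x)u(x) = 0` for `x < 0`, with
`lim_{x↑0} u(x) = 1` and `u(x) ≤ 1` for all `x ≤ 0`. -/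
theorem chernoff_stmt_17
    (Ai Bi : ℂ → ℂ) (hAiry : IsAiry Ai Bi)
    (lam : ℝ) (hlam : 0 < lam)
    -- `u_λ(x) = Ai(2^{-1/3}λ - 4^{1/3}x)/Ai(2^{-1/3}λ)`
    (uLam : ℝ → ℝ)
    (huLam : ∀ x : ℝ,
      Complex.ofReal (uLam x)
        = Ai (Complex.ofReal ((2:ℝ) ^ (-(1/3) : ℝ) * lam)
              - Complex.ofReal ((4:ℝ) ^ ((1:ℝ)/3)) * x)
          / Ai (Complex.ofReal ((2:ℝ) ^ (-(1/3) : ℝ) * lam))) :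
    -- `u_λ` solves the boundary value problem
    ((∀ x : ℝ, x < 0 →
        DifferentiableAt ℝ uLam x ∧ DifferentiableAt ℝ (deriv uLam) x ∧
        (1/2) * deriv (deriv uLam) x - (lam - 2 * x) * uLam x = 0) ∧
      Tendsto uLam (nhdsWithin 0 (Set.Iio 0)) (nhds 1) ∧
      (∀ x : ℝ, x ≤ 0 → 0 ≤ uLam x ∧ uLam x ≤ 1)) ∧
    -- and it is the unique nonnegative solution
    (∀ u : ℝ → ℝ,
      ((∀ x : ℝ, x < 0 →
          DifferentiableAt ℝ u x ∧ DifferentiableAt ℝ (deriv u) x ∧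
          (1/2) * deriv (deriv u) x - (lam - 2 * x) * u x = 0) ∧
        Tendsto u (nhdsWithin 0 (Set.Iio 0)) (nhds 1) ∧
        (∀ x : ℝ, x ≤ 0 → 0 ≤ u x ∧ u x ≤ 1)) →
      ∀ x : ℝ, x < 0 → u x = uLam x) := by
  set a : ℝ := (2 : ℝ) ^ (-(1 / 3) : ℝ) * lam with ha
  set c : ℝ := (4 : ℝ) ^ ((1 : ℝ) / 3) with hcdef
  have ha0 : 0 < a := by positivity
  have hc0 : 0 < c := by positivity
  have h4 : c = (2 : ℝ) ^ ((2 : ℝ) / 3) := by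
    rw [hcdef, show (4 : ℝ) = (2 : ℝ) ^ (2 : ℝ) by norm_num, ← Real.rpow_mul (by norm_num)]
    norm_num
  have hc3 : c ^ 3 = 4 := by
    rw [hcdef, ← Real.rpow_natCast, ← Real.rpow_mul (by norm_num)]
    norm_num
  have hca : c ^ 2 * a = 2 * lam := by
    rw [ha, h4, ← Real.rpow_natCast, ← Real.rpow_mul (by norm_num), ← mul_assoc,
      ← Real.rpow_add (by norm_num)]
    norm_num
  have hfa := hAiry.re_ne_zero ha0
  have hu : ∀ x : ℝ, uLam x = (Ai ((a - c * x : ℝ) : ℂ)).re / (Ai a).re := by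
    intro x
    apply Complex.ofReal_injective
    rw [huLam x, Complex.ofReal_div, hAiry.ofReal_re, hAiry.ofReal_re]
    push_cast
    rfl
  have hlin : ∀ x : ℝ, HasDerivAt (fun x : ℝ => a - c * x) (-c) x := fun x =>
    (((hasDerivAt_id x).const_mul c).const_sub a).congr_deriv (by ring)
  have hd1 : ∀ x : ℝ, HasDerivAt uLam
      (-c * (deriv Ai ((a - c * x : ℝ) : ℂ)).re / (Ai a).re) x := by
    intro x
    rw [show uLam = fun x : ℝ => (Ai ((a - c * x : ℝ) : ℂ)).re / (Ai a).re from funext hu]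
    refine (((hAiry.hasDerivAt_re (a - c * x)).comp x (hlin x)).div_const
      (Ai a).re).congr_deriv ?_
    ring
  have hd1' : deriv uLam = fun x : ℝ => -c * (deriv Ai ((a - c * x : ℝ) : ℂ)).re / (Ai a).re :=
    funext fun x => (hd1 x).deriv
  have hd2 : ∀ x : ℝ, HasDerivAt (deriv uLam) (2 * (lam - 2 * x) * uLam x) x := by
    intro x
    rw [hd1', hu]
    refine ((((hAiry.hasDerivAt_deriv_re (a - c * x)).comp x (hlin x)).const_mul
      (-c)).div_const (Ai a).re).congr_deriv ?_
    have : 2 * (lam - 2 * x) = c ^ 2 * (a - c * x) := by linear_combination -hca + x * hc3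
    rw [this]
    ring
  have hu01 : ∀ x : ℝ, x ≤ 0 → 0 ≤ uLam x ∧ uLam x ≤ 1 := by
    intro x hx
    rw [hu]
    exact hAiry.re_div_mem_Icc ha0 (by nlinarith)
  have hu0 : uLam 0 = 1 := by rw [hu]; simp [hfa]
  have hulim : Tendsto uLam (nhdsWithin 0 (Set.Iio 0)) (nhds 1) := by
    have := (hd1 0).continuousAt.tendsto
    rw [hu0] at this
    exact this.mono_left nhdsWithin_le_nhds
  refine ⟨⟨fun x _ => ⟨(hd1 x).differentiableAt, (hd2 x).differentiableAt, ?_⟩, hulim, hu01⟩, ?_⟩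
  · rw [(hd2 x).deriv]
    ring
  rintro u ⟨hode, hlim, hb⟩ x hx
  have hm := monotoneOn_sq_of_bounded_solution (w := fun x => u x - uLam x)
    (w' := fun x => deriv u x - deriv uLam x) (k := fun x => 2 * (lam - 2 * x)) (b := 0) (C := 1)
    (fun y hy => (hode y hy).1.hasDerivAt.sub (hd1 y).differentiableAt.hasDerivAt)
    (fun y hy => ((hode y hy).2.1.hasDerivAt.sub (hd2 y)).congr_deriv
      (by linear_combination 2 * (hode y hy).2.2))
    (fun y hy => by linarith)
    (fun y hy => abs_le.2 (by
      have h1 := hb y hy.le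
      have h2 := hu01 y hy.le
      constructor <;> linarith [h1.1, h1.2, h2.1, h2.2]))
  have hsq : (u x - uLam x) ^ 2 ≤ 0 := by
    have ht : Tendsto (fun y => (u y - uLam y) ^ 2) (nhdsWithin 0 (Set.Iio 0)) (nhds 0) := by
      simpa using (hlim.sub hulim).pow 2
    refine ge_of_tendsto ht ?_
    filter_upwards [Ioo_mem_nhdsLT hx] with y hy
    exact hm hx hy.2 hy.1.le
  exact sub_eq_zero.1 (pow_eq_zero_iff two_ne_zero |>.1 (le_antisymm hsq (sq_nonneg _)))

end
end

section
/- For every s ∈ ℝ, ∫_{u=−∞}^{∞} e^{−2^{1/3}isu} [ 2^{1/3} Ai'(iu) + 2^{2/3} s·Ai(iu) ] / Ai(iu)² du = 0; equivalently, ∫_{u=−∞}^{∞} 2^{2/3} s · e^{−2^{1/3}isu}/Ai(iu) du = −2^{1/3} ∫_{u=−∞}^{∞} e^{−2^{1/3}isu} Ai'(iu)/Ai(iu)² du. -/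
open MeasureTheory ProbabilityTheory Filter Set

noncomputable section

open Asymptotics

theorem nonneg_of_hasDerivAt_nonneg {f f' : ℝ → ℝ} {a : ℝ} (hf : ∀ x, HasDerivAt f (f' x) x)
    (ha : 0 ≤ f a) (hf' : ∀ x, a ≤ x → 0 ≤ f' x) : ∀ x, a ≤ x → 0 ≤ f x := by
  intro x hx
  have hmono : MonotoneOn f (Ici a) := by
    refine monotoneOn_of_deriv_nonneg (convex_Ici a)
      (fun y _ => (hf y).continuousAt.continuousWithinAt)
      (fun y _ => (hf y).differentiableAt.differentiableWithinAt) fun y hy => ?_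
    rw [(hf y).deriv]
    exact hf' y (interior_subset hy)
  exact ha.trans (hmono self_mem_Ici hx hx)

/-- A positive linear system satisfied by the quadratic expressions `‖y‖²`, `Re (ȳ y')`, `‖y'‖²`
and `-Im (ȳ y')` of a solution of `y'' = -i u y`: `g` is bounded below and grows
exponentially, while `h` is dominated by `g` up to a polynomial factor. -/
theorem airy_quadratic_system_growth {g p h V : ℝ → ℝ}
    (hg : ∀ u, HasDerivAt g (2 * p u) u) (hp : ∀ u, HasDerivAt p (h u) u)
    (hh : ∀ u, HasDerivAt h (2 * u * V u) u) (hV : ∀ u, HasDerivAt V (u * g u) u)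
    (hh0 : ∀ u, 0 ≤ h u) (hp0 : p 0 = 0) (hg0 : 0 < g 0) :
    (∀ u, 0 ≤ u → g 0 ≤ g u) ∧
      ∃ C u₀ : ℝ, 0 < C ∧ 1 ≤ u₀ ∧ ∀ u, u₀ ≤ u →
        Real.exp u ≤ C * u ^ 5 * g u ∧ h u ≤ C * u ^ 4 * g u := by
  have hpn : ∀ u, 0 ≤ u → 0 ≤ p u :=
    nonneg_of_hasDerivAt_nonneg hp hp0.ge fun u _ => hh0 u
  have hgn : ∀ u, 0 ≤ u → g 0 ≤ g u := by
    intro u hu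
    have := nonneg_of_hasDerivAt_nonneg (a := 0) (fun u => (hg u).sub_const (g 0)) (by simp)
      (fun x hx => by have := hpn x hx; positivity) u hu
    linarith
  refine ⟨hgn, ?_⟩
  have hVlow : ∀ u, 0 ≤ u → V 0 + g 0 * u ^ 2 / 2 ≤ V u := by
    intro u hu
    have := nonneg_of_hasDerivAt_nonneg (a := 0)
      (fun u => ((hV u).sub_const (V 0)).sub (((hasDerivAt_pow 2 u).const_mul (g 0)).div_const 2))
      (by simp)
      (fun x hx => by
        have := mul_le_mul_of_nonneg_left (hgn x hx) hx
        norm_num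
        linarith) u hu
    simp only [Pi.sub_apply] at this
    linarith
  set u₀ : ℝ := 1 + 2 * |V 0| / g 0 with hu₀
  have hu1 : 1 ≤ u₀ := by
    have : 0 ≤ 2 * |V 0| / g 0 := by positivity
    linarith
  have hVn : ∀ u, u₀ ≤ u → 0 ≤ V u := by
    intro u hu
    have h1 := hVlow u (by linarith)
    have h2 : g 0 + 2 * |V 0| ≤ g 0 * u := by
      calc g 0 + 2 * |V 0| = g 0 * u₀ := by rw [hu₀]; field_simp
        _ ≤ g 0 * u := by gcongr
    have h3 : g 0 * u ≤ g 0 * u ^ 2 := by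
      gcongr
      nlinarith
    have := neg_abs_le (V 0)
    linarith
  have hu0' : 0 ≤ u₀ := by linarith
  have hgpos : ∀ u, u₀ ≤ u → 0 < g u := fun u hu => hg0.trans_le (hgn u (by linarith))
  have hG := hgpos u₀ le_rfl
  obtain ⟨K, hK1, hKV, hKh, hKp⟩ : ∃ K : ℝ, 1 ≤ K ∧ V u₀ ≤ K * g u₀ ∧ h u₀ ≤ K * g u₀ ∧
      p u₀ ≤ K * g u₀ := by
    have hV' := div_nonneg (hVn u₀ le_rfl) hG.le
    have hh' := div_nonneg (hh0 u₀) hG.le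
    have hp' := div_nonneg (hpn u₀ hu0') hG.le
    refine ⟨1 + V u₀ / g u₀ + h u₀ / g u₀ + p u₀ / g u₀, by linarith, ?_, ?_, ?_⟩ <;>
      · rw [← div_le_iff₀ hG]
        linarith
  have hbase : ∀ {X : ℝ} (n : ℕ), X ≤ K * g u₀ → X ≤ K * u₀ ^ n * g u₀ := by
    intro X n hX
    refine hX.trans ?_
    gcongr
    exact le_mul_of_one_le_right (by linarith) (one_le_pow₀ hu1)
  have hder : ∀ (n : ℕ) (u : ℝ), HasDerivAt (fun u => K * u ^ n * g u)
      (K * (n * u ^ (n - 1)) * g u + K * u ^ n * (2 * p u)) u :=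
    fun n u => ((hasDerivAt_pow n u).const_mul K).mul (hg u)
  have hpos : ∀ (n : ℕ) u, u₀ ≤ u → 0 ≤ K * u ^ n * (2 * p u) := by
    intro n u hu
    have := hpn u (by linarith)
    have : 0 ≤ u := by linarith
    positivity
  have hVup : ∀ u, u₀ ≤ u → V u ≤ K * u ^ 2 * g u := by
    intro u hu
    have := nonneg_of_hasDerivAt_nonneg (fun u => (hder 2 u).sub (hV u))
      (sub_nonneg.2 (hbase 2 hKV))
      (fun x hx => by
        have h1 := hpos 2 x hx
        have h2 : 0 ≤ x * g x := mul_nonneg (by linarith) (hgpos x hx).le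
        norm_num
        nlinarith) u hu
    simpa using this
  have hhup : ∀ u, u₀ ≤ u → h u ≤ K * u ^ 4 * g u := by
    intro u hu
    have := nonneg_of_hasDerivAt_nonneg (fun u => (hder 4 u).sub (hh u))
      (sub_nonneg.2 (hbase 4 hKh))
      (fun x hx => by
        have h1 := hpos 4 x hx
        have hx0 : 0 ≤ x := by linarith
        have h2 : 0 ≤ K * x ^ 3 * g x := by have := (hgpos x hx).le; positivity
        have h3 : 2 * x * V x ≤ 2 * x * (K * x ^ 2 * g x) := by
          have := hVup x hx
          gcongr
        norm_num
        nlinarith) u hu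
    simpa using this
  have hpup : ∀ u, u₀ ≤ u → p u ≤ K * u ^ 5 * g u := by
    intro u hu
    have := nonneg_of_hasDerivAt_nonneg (fun u => (hder 5 u).sub (hp u))
      (sub_nonneg.2 (hbase 5 hKp))
      (fun x hx => by
        have h1 := hpos 5 x hx
        have hx0 : 0 ≤ x := by linarith
        have h2 : 0 ≤ K * x ^ 4 * g x := by have := (hgpos x hx).le; positivity
        have h3 := hhup x hx
        norm_num
        nlinarith) u hu
    simpa using this
  set c : ℝ := Real.exp (-u₀) * g u₀ with hc
  have hcpos : 0 < c := by positivity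
  have hexp : ∀ u, u₀ ≤ u → c * Real.exp u ≤ g u + p u + h u + V u := by
    intro u hu
    have := nonneg_of_hasDerivAt_nonneg (a := u₀)
      (fun u => ((((Real.hasDerivAt_exp (-u)).comp u (hasDerivAt_neg u)).mul
        ((((hg u).add (hp u)).add (hh u)).add (hV u))).sub_const c))
      (by
        have h1 := hpn u₀ hu0'
        have h2 := hh0 u₀
        have h3 := hVn u₀ le_rfl
        simp only [Pi.mul_apply, Function.comp_apply, Pi.add_apply, hc, sub_nonneg]
        gcongr
        linarith)
      (fun x hx => by
        have h1 := hpn x (by linarith)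
        have h3 := mul_nonneg (sub_nonneg.2 (hu1.trans hx)) (hVn x hx)
        have h5 := hVn x hx
        have h4 := mul_nonneg (sub_nonneg.2 (hu1.trans hx)) (hgpos x hx).le
        have : 0 ≤ Real.exp (-x) * (p x + (x - 1) * V x + x * V x + (x - 1) * g x) := by
          have : 0 ≤ x := by linarith
          positivity
        simp only [Function.comp_apply, Pi.add_apply]
        linarith) u hu
    simp only [Pi.mul_apply, Function.comp_apply, Pi.add_apply, sub_nonneg] at this
    calc c * Real.exp u ≤ Real.exp (-u) * (g u + p u + h u + V u) * Real.exp u := by gcongr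
      _ = g u + p u + h u + V u := by
        rw [mul_comm, ← mul_assoc, ← Real.exp_add]
        simp
  refine ⟨K + 4 * K / c, u₀, by positivity, hu1, fun u hu => ⟨?_, ?_⟩⟩
  · have hu' : 1 ≤ u := hu1.trans hu
    have hgu := (hgpos u hu).le
    have m : ∀ n ≤ 5, K * u ^ n * g u ≤ K * u ^ 5 * g u := by
      intro n hn
      gcongr
    have m0 : g u ≤ K * u ^ 5 * g u :=
      le_mul_of_one_le_left hgu (one_le_mul_of_one_le_of_one_le hK1 (one_le_pow₀ hu'))
    have key : c * Real.exp u ≤ 4 * K * u ^ 5 * g u := by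
      linarith [hexp u hu, hpup u hu, hhup u hu, hVup u hu, m 4 (by norm_num), m 2 (by norm_num)]
    have : Real.exp u ≤ 4 * K / c * u ^ 5 * g u := by
      rw [show 4 * K / c * u ^ 5 * g u = 4 * K * u ^ 5 * g u / c by ring, le_div_iff₀ hcpos]
      linarith
    refine this.trans ?_
    have : 0 ≤ K * u ^ 5 * g u := hgu.trans m0
    linarith
  · refine (hhup u hu).trans ?_
    have hgu := (hgpos u hu).le
    have : 0 ≤ 4 * K / c * u ^ 4 * g u := by positivity
    linarith

/-- Decay of the reciprocal of a solution of `y'' = -i u y`, written in real and imaginary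
parts, whose initial values satisfy `y 0 ≠ 0` and `Re (ȳ 0 * y' 0) = 0`. -/
theorem airy_imaginary_axis_decay {a b c d : ℝ → ℝ}
    (ha : ∀ u, HasDerivAt a (c u) u) (hb : ∀ u, HasDerivAt b (d u) u)
    (hc : ∀ u, HasDerivAt c (u * b u) u) (hd : ∀ u, HasDerivAt d (-(u * a u)) u)
    (h0 : a 0 * c 0 + b 0 * d 0 = 0) (hne : 0 < a 0 ^ 2 + b 0 ^ 2) :
    (∀ u, 0 ≤ u → 0 < a u ^ 2 + b u ^ 2) ∧
      (fun u => (Real.sqrt (a u ^ 2 + b u ^ 2))⁻¹) =O[atTop] (fun u => Real.exp (-(1/4) * u)) ∧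
      (fun u => Real.sqrt (c u ^ 2 + d u ^ 2) / (a u ^ 2 + b u ^ 2)) =O[atTop]
        (fun u => Real.exp (-(1/4) * u)) := by
  obtain ⟨hlow, C, u₀, hC, hu₀, hbd⟩ := airy_quadratic_system_growth
    (g := fun u => a u ^ 2 + b u ^ 2) (p := fun u => a u * c u + b u * d u)
    (h := fun u => c u ^ 2 + d u ^ 2) (V := fun u => b u * c u - a u * d u)
    (fun u => (((ha u).pow 2).add ((hb u).pow 2)).congr_deriv (by norm_num; ring))
    (fun u => (((ha u).mul (hc u)).add ((hb u).mul (hd u))).congr_deriv (by ring))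
    (fun u => (((hc u).pow 2).add ((hd u).pow 2)).congr_deriv (by norm_num; ring))
    (fun u => (((hb u).mul (hc u)).sub ((ha u).mul (hd u))).congr_deriv (by ring))
    (fun u => by positivity) h0 hne
  have hpos : ∀ u, 0 ≤ u → 0 < a u ^ 2 + b u ^ 2 := fun u hu => hne.trans_le (hlow u hu)
  have hpow : ∀ᶠ u : ℝ in atTop, u ^ 9 ≤ Real.exp (1/2 * u) := by
    filter_upwards [(isLittleO_pow_exp_pos_mul_atTop (k := 9) (b := 1/2) (by norm_num)).bound
      one_pos, eventually_ge_atTop 0] with u hu hu0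
    simpa [abs_of_nonneg hu0] using hu
  have hexp : ∀ u : ℝ, Real.exp u = Real.exp (1/2 * u) * Real.exp (1/2 * u) := by
    intro u
    rw [← Real.exp_add]
    ring_nf
  have hquarter : ∀ u : ℝ, Real.exp (-(1/4) * u) ^ 2 * Real.exp (1/2 * u) = 1 := by
    intro u
    rw [sq, ← Real.exp_add, ← Real.exp_add, ← Real.exp_zero]
    ring_nf
  have hinv : ∀ᶠ u : ℝ in atTop,
      (a u ^ 2 + b u ^ 2)⁻¹ * u ^ 4 ≤ C * Real.exp (-(1/4) * u) ^ 2 := by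
    filter_upwards [hpow, eventually_ge_atTop u₀] with u h9 hu
    have hu0 : 0 < u := by linarith
    have hg := hpos u hu0.le
    obtain ⟨h1, -⟩ := hbd u hu
    rw [inv_mul_le_iff₀ hg]
    refine le_of_mul_le_mul_right (a := Real.exp (1/2 * u) * u ^ 5) ?_ (by positivity)
    calc u ^ 4 * (Real.exp (1/2 * u) * u ^ 5) = u ^ 9 * Real.exp (1/2 * u) := by ring
      _ ≤ Real.exp (1/2 * u) * Real.exp (1/2 * u) := by gcongr
      _ = Real.exp u := (hexp u).symm
      _ ≤ C * u ^ 5 * (a u ^ 2 + b u ^ 2) := h1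
      _ = (a u ^ 2 + b u ^ 2) * (C * (Real.exp (-(1/4) * u) ^ 2 * Real.exp (1/2 * u))) *
          u ^ 5 := by rw [hquarter]; ring
      _ = _ := by ring
  refine ⟨hpos, IsBigO.of_bound (Real.sqrt C) ?_, IsBigO.of_bound C ?_⟩
  · filter_upwards [hinv, eventually_ge_atTop u₀] with u h1 hu
    have hu1 : 1 ≤ u := by linarith
    have hg := hpos u (by linarith)
    rw [Real.norm_of_nonneg (by positivity), Real.norm_of_nonneg (by positivity),
      ← Real.sqrt_inv]
    refine Real.sqrt_le_iff.2 ⟨by positivity, ?_⟩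
    rw [mul_pow, Real.sq_sqrt hC.le]
    exact (le_mul_of_one_le_right (by positivity) (one_le_pow₀ hu1)).trans h1
  · filter_upwards [hinv, eventually_ge_atTop u₀] with u h1 hu
    have hu0 : 0 < u := by linarith
    have hg := hpos u hu0.le
    obtain ⟨-, h2⟩ := hbd u hu
    rw [Real.norm_of_nonneg (by positivity), Real.norm_of_nonneg (by positivity),
      div_le_iff₀ hg]
    refine Real.sqrt_le_iff.2 ⟨by positivity, ?_⟩
    rw [inv_mul_le_iff₀ hg] at h1
    calc c u ^ 2 + d u ^ 2 ≤ C * u ^ 4 * (a u ^ 2 + b u ^ 2) := h2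
      _ ≤ C * ((a u ^ 2 + b u ^ 2) * (C * Real.exp (-(1/4) * u) ^ 2)) *
          (a u ^ 2 + b u ^ 2) := by gcongr
      _ = _ := by ring

/-- Two integrations by parts turn `∫ cos (t³/3)` into an increasing function plus boundary
terms, so that the improper integral is positive. -/
theorem pos_of_tendsto_integral_cos_cube {L : ℝ}
    (hL : Tendsto (fun R : ℝ => ∫ t in (0:ℝ)..R, Real.cos (t ^ 3 / 3)) atTop (nhds L)) :
    0 < L := by
  have hcont : Continuous fun t : ℝ => Real.cos (t ^ 3 / 3) := by fun_prop
  set P : ℝ → ℝ := fun R => (∫ t in (0:ℝ)..R, Real.cos (t ^ 3 / 3)) -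
    Real.sin (R ^ 3 / 3) / R ^ 2 - 2 * ((1 - Real.cos (R ^ 3 / 3)) / R ^ 5) with hP
  have hder : ∀ R : ℝ, R ≠ 0 → HasDerivAt P (10 * (1 - Real.cos (R ^ 3 / 3)) / R ^ 6) R := by
    intro R hR
    have hcube : HasDerivAt (fun R : ℝ => R ^ 3 / 3) (R ^ 2) R :=
      ((hasDerivAt_pow 3 R).div_const 3).congr_deriv (by norm_num)
    have h1 : HasDerivAt (fun R => ∫ t in (0:ℝ)..R, Real.cos (t ^ 3 / 3))
        (Real.cos (R ^ 3 / 3)) R :=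
      intervalIntegral.integral_hasDerivAt_right (hcont.intervalIntegrable _ _)
        hcont.stronglyMeasurable.stronglyMeasurableAtFilter hcont.continuousAt
    refine ((h1.sub (hcube.sin.div (hasDerivAt_pow 2 R) (by positivity))).sub
      (((hcube.cos.const_sub 1).div (hasDerivAt_pow 5 R) (by positivity)).const_mul 2)).congr_deriv
        ?_
    field_simp
    norm_num
    ring
  have hmono : MonotoneOn P (Ici 1) := by
    refine monotoneOn_of_deriv_nonneg (convex_Ici 1) ?_ ?_ ?_
    · intro x hx
      exact (hder x (zero_lt_one.trans_le hx).ne').continuousAt.continuousWithinAt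
    · intro x hx
      exact (hder x (zero_lt_one.trans_le (interior_subset hx)).ne').differentiableAt
        |>.differentiableWithinAt
    · intro x hx
      rw [(hder x (zero_lt_one.trans_le (interior_subset hx)).ne').deriv]
      have := Real.cos_le_one (x ^ 3 / 3)
      have : 0 ≤ 1 - Real.cos (x ^ 3 / 3) := by linarith
      positivity
  have hP1 : 1 / 2 ≤ P 1 := by
    have h1 : (17 / 18 : ℝ) ≤ ∫ t in (0:ℝ)..1, Real.cos (t ^ 3 / 3) := by
      have : ∫ _ in (0:ℝ)..1, (17 / 18 : ℝ) ≤ ∫ t in (0:ℝ)..1, Real.cos (t ^ 3 / 3) := by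
        refine intervalIntegral.integral_mono_on zero_le_one (by simp)
          (hcont.intervalIntegrable _ _) fun t ht => ?_
        have h2 := Real.one_sub_sq_div_two_le_cos (x := t ^ 3 / 3)
        have h3 : t ^ 3 ≤ 1 := pow_le_one₀ ht.1 ht.2
        have h4 : 0 ≤ t ^ 3 := pow_nonneg ht.1 3
        nlinarith
      simpa using this
    have h2 : Real.sin (1 / 3) ≤ 1 / 3 := Real.sin_le (by norm_num)
    have h3 := Real.one_sub_sq_div_two_le_cos (x := 1 / 3)
    simp only [hP, one_pow, div_one]
    linarith
  have hinv : ∀ n : ℕ, n ≠ 0 → Tendsto (fun R : ℝ => (R ^ n)⁻¹) atTop (nhds 0) :=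
    fun n hn => (tendsto_pow_atTop hn).inv_tendsto_atTop
  have hPL : Tendsto P atTop (nhds (L - 0 - 2 * 0)) := by
    refine (hL.sub ?_).sub (Tendsto.const_mul 2 ?_)
    · refine squeeze_zero_norm (fun R => ?_) (hinv 2 two_ne_zero)
      rw [norm_div, Real.norm_of_nonneg (sq_nonneg R), ← one_div]
      gcongr
      exact Real.abs_sin_le_one _
    · refine squeeze_zero_norm' (a := fun R : ℝ => 2 * (R ^ 5)⁻¹) ?_
        (by simpa using (hinv 5 (by norm_num)).const_mul 2)
      filter_upwards [eventually_ge_atTop 0] with R hR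
      rw [norm_div, Real.norm_of_nonneg (pow_nonneg hR 5), div_eq_mul_inv]
      gcongr
      rw [Real.norm_eq_abs, abs_le]
      constructor <;> linarith [Real.cos_le_one (R ^ 3 / 3), Real.neg_one_le_cos (R ^ 3 / 3)]
  have : 1 / 2 ≤ L - 0 - 2 * 0 := ge_of_tendsto hPL <| by
    filter_upwards [eventually_ge_atTop 1] with R hR
    exact hP1.trans (hmono self_mem_Ici hR hR)
  linarith

/-- An entire solution of the Airy equation that is real on the real axis and nonzero at the
origin has no zeros on the half-lines `± i ℝ₊`, and `1 / w` and `w' / w²` decay exponentially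
there. -/
theorem airy_half_line_decay {w : ℂ → ℂ} (hw : Differentiable ℂ w)
    (hode : ∀ z, deriv (deriv w) z = z * w z) (hreal : ∀ x : ℝ, (w x).im = 0) (h0 : w 0 ≠ 0)
    {ε : ℝ} (hε : ε ^ 2 = 1) :
    (∀ u : ℝ, 0 ≤ u → w (Complex.I * ((ε * u : ℝ) : ℂ)) ≠ 0) ∧
      (fun u : ℝ => (w (Complex.I * ((ε * u : ℝ) : ℂ)))⁻¹) =O[atTop] (fun u => Real.exp (-(1/4) * u)) ∧
      (fun u : ℝ => deriv w (Complex.I * ((ε * u : ℝ) : ℂ)) / w (Complex.I * ((ε * u : ℝ) : ℂ)) ^ 2) =O[atTop]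
        (fun u => Real.exp (-(1/4) * u)) := by
  have hline : ∀ u : ℝ, HasDerivAt (fun u : ℝ => Complex.I * ((ε * u : ℝ) : ℂ)) (Complex.I * ε) u := by
    intro u
    simpa using ((Complex.ofRealCLM.hasDerivAt (x := u)).const_mul (ε : ℂ)).const_mul Complex.I
  have hy : ∀ u : ℝ, HasDerivAt (fun u : ℝ => w (Complex.I * ((ε * u : ℝ) : ℂ)))
      (deriv w (Complex.I * ((ε * u : ℝ) : ℂ)) * (Complex.I * ε)) u := fun u =>
    (hw _).hasDerivAt.comp u (hline u)
  have hy' : ∀ u : ℝ, HasDerivAt (fun u : ℝ => deriv w (Complex.I * ((ε * u : ℝ) : ℂ)))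
      (Complex.I * ((ε * u : ℝ) : ℂ) * w (Complex.I * ((ε * u : ℝ) : ℂ)) * (Complex.I * ε)) u := fun u => by
    have hdw : Differentiable ℂ (deriv w) := fun z =>
      (hw.analyticAt z).deriv.differentiableAt
    rw [← hode]
    exact (hdw _).hasDerivAt.comp u (hline u)
  have hre : ∀ {f : ℝ → ℂ} {f' : ℂ} {u : ℝ}, HasDerivAt f f' u →
      HasDerivAt (fun u => (f u).re) f'.re u := fun hf =>
    (Complex.reCLM.hasFDerivAt.comp_hasDerivAt _ hf)
  have him : ∀ {f : ℝ → ℂ} {f' : ℂ} {u : ℝ}, HasDerivAt f f' u →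
      HasDerivAt (fun u => (f u).im) f'.im u := fun hf =>
    (Complex.imCLM.hasFDerivAt.comp_hasDerivAt _ hf)
  have hd0 : (deriv w 0).im = 0 := by
    have h1 := him ((hw ((0 : ℝ) : ℂ)).hasDerivAt.comp_ofReal)
    simp only [hreal] at h1
    simpa using h1.unique (hasDerivAt_const (0 : ℝ) (0 : ℝ))
  have hw0 : (w 0).im = 0 := by simpa using hreal 0
  have hnorm : ∀ z : ℂ, Real.sqrt (z.re ^ 2 + (ε * z.im) ^ 2) = ‖z‖ := by
    intro z
    rw [mul_pow, hε, one_mul, Complex.norm_eq_sqrt_sq_add_sq]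
  have hnorm' : ∀ z : ℂ, z.re ^ 2 + (ε * z.im) ^ 2 = ‖z‖ ^ 2 := by
    intro z
    rw [← hnorm, Real.sq_sqrt (by positivity)]
  have hnorm'' : ∀ z : ℂ, Real.sqrt ((-(ε * z.im)) ^ 2 + z.re ^ 2) = ‖z‖ := by
    intro z
    rw [← hnorm]
    ring_nf
  obtain ⟨hpos, hO1, hO2⟩ := airy_imaginary_axis_decay
    (a := fun u : ℝ => (w (Complex.I * ((ε * u : ℝ) : ℂ))).re)
    (b := fun u : ℝ => ε * (w (Complex.I * ((ε * u : ℝ) : ℂ))).im)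
    (c := fun u : ℝ => -(ε * (deriv w (Complex.I * ((ε * u : ℝ) : ℂ))).im))
    (d := fun u : ℝ => (deriv w (Complex.I * ((ε * u : ℝ) : ℂ))).re)
    (fun u => (hre (hy u)).congr_deriv (by simp; ring))
    (fun u => ((him (hy u)).const_mul ε).congr_deriv (by
      simp [-Complex.ofReal_mul]
      linear_combination (deriv w (Complex.I * ((ε * u : ℝ) : ℂ))).re * hε))
    (fun u => ((him (hy' u)).const_mul ε).neg.congr_deriv (by
      simp [-Complex.ofReal_mul]
      linear_combination (u * ε * (w (Complex.I * ((ε * u : ℝ) : ℂ))).im) * hε))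
    (fun u => (hre (hy' u)).congr_deriv (by
      simp [-Complex.ofReal_mul]
      linear_combination (u * (w (Complex.I * ((ε * u : ℝ) : ℂ))).re) * hε))
    (by simp [hd0, hw0])
    (by
      rw [hnorm']
      have : 0 < ‖w 0‖ := norm_pos_iff.2 h0
      simpa using pow_pos this 2)
  simp only [hnorm', hnorm'', Real.sqrt_sq (norm_nonneg _)] at hpos hO1 hO2
  refine ⟨fun u hu h => ?_, (isBigO_norm_left.1 ?_), (isBigO_norm_left.1 ?_)⟩
  · exact absurd (hpos u hu) (by rw [h]; simp)
  · simpa only [norm_inv] using hO1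
  · simpa only [norm_div, norm_pow] using hO2

/-- A continuous function on `ℝ` decaying exponentially in both directions is integrable. -/
theorem integrable_of_isBigO_exp_neg_both {f : ℝ → ℂ} (hf : Continuous f) {b : ℝ} (hb : 0 < b)
    (hpos : f =O[atTop] fun u => Real.exp (-b * u))
    (hneg : (fun u => f (-u)) =O[atTop] fun u => Real.exp (-b * u)) : Integrable f := by
  have key : ∀ {g : ℝ → ℂ}, Continuous g → g =O[atTop] (fun u => Real.exp (-b * u)) →
      IntegrableOn g (Ioi 0) := fun hg hO =>
    (integrable_norm_iff hg.aestronglyMeasurable).1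
      (integrable_of_isBigO_exp_neg hb hg.norm.continuousOn hO.norm_left)
  have h1 := key hf hpos
  have h2 := key (hf.comp continuous_neg) hneg
  have h3 : IntegrableOn f (Iic 0) := by
    rw [integrableOn_Iic_iff_integrableOn_Iio]
    rw [← neg_zero] at h2
    simpa using h2.comp_neg_Iio
  rw [← integrableOn_univ, ← Iic_union_Ioi (a := (0 : ℝ))]
  exact h3.union h1

/-- Appendix C of the paper. For every `s ∈ ℝ`,
`∫_ℝ e^{-2^{1/3}isu} [2^{1/3} Ai'(iu) + 2^{2/3} s Ai(iu)]/Ai(iu)² du = 0`;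
equivalently,
`∫_ℝ 2^{2/3} s e^{-2^{1/3}isu}/Ai(iu) du = -2^{1/3} ∫_ℝ e^{-2^{1/3}isu} Ai'(iu)/Ai(iu)² du`. -/
theorem chernoff_stmt_19
    (Ai Bi : ℂ → ℂ) (hAiry : IsAiry Ai Bi) :
    ∀ s : ℝ,
      (∫ u : ℝ,
          Complex.exp (-Complex.ofReal ((2:ℝ) ^ ((1:ℝ)/3)) * Complex.I * s * u) *
            ((Complex.ofReal ((2:ℝ) ^ ((1:ℝ)/3)) * deriv Ai (Complex.I * u)
                + Complex.ofReal ((2:ℝ) ^ ((2:ℝ)/3)) * s * Ai (Complex.I * u))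
              / Ai (Complex.I * u) ^ 2))
        = 0 ∧
      (∫ u : ℝ,
          Complex.ofReal ((2:ℝ) ^ ((2:ℝ)/3)) * s *
            Complex.exp (-Complex.ofReal ((2:ℝ) ^ ((1:ℝ)/3)) * Complex.I * s * u)
              / Ai (Complex.I * u))
        = -Complex.ofReal ((2:ℝ) ^ ((1:ℝ)/3)) *
            ∫ u : ℝ,
              Complex.exp (-Complex.ofReal ((2:ℝ) ^ ((1:ℝ)/3)) * Complex.I * s * u) *
                deriv Ai (Complex.I * u) / Ai (Complex.I * u) ^ 2 := by
  obtain ⟨hA, -, hode, -, hreal, -, hint, -⟩ := hAiry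
  intro s
  have hA0 : Ai 0 ≠ 0 := by
    intro h
    have := hint 0
    simp only [zero_mul, add_zero, Complex.ofReal_zero, h, Complex.zero_re, mul_zero] at this
    exact (pos_of_tendsto_integral_cos_cube this).false
  obtain ⟨hne1, hinv1, hquot1⟩ := airy_half_line_decay hA hode hreal hA0 (ε := 1) (by norm_num)
  obtain ⟨hne2, hinv2, hquot2⟩ := airy_half_line_decay hA hode hreal hA0 (ε := -1) (by norm_num)
  simp only [one_mul] at hne1 hinv1 hquot1
  have hneg : ∀ u : ℝ, (-1 : ℝ) * u = -u := neg_one_mul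
  simp only [hneg] at hne2 hinv2 hquot2
  have hne : ∀ u : ℝ, Ai (Complex.I * u) ≠ 0 := by
    intro u
    rcases le_total 0 u with hu | hu
    · exact hne1 u hu
    · simpa using hne2 (-u) (by linarith)
  set k : ℝ := (2:ℝ) ^ ((1:ℝ)/3) with hk
  have hk2 : (2:ℝ) ^ ((2:ℝ)/3) = k ^ 2 := by
    rw [hk, ← Real.rpow_natCast, ← Real.rpow_mul (by norm_num)]
    norm_num
  rw [hk2]
  set E : ℝ → ℂ := fun u => Complex.exp (-(k : ℂ) * Complex.I * s * u) with hE
  have hEnorm : ∀ u, ‖E u‖ = 1 := by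
    intro u
    simp [hE, Complex.norm_exp]
  have hAc : Continuous fun u : ℝ => Ai (Complex.I * u) :=
    hA.continuous.comp (by fun_prop)
  have hdA : Differentiable ℂ (deriv Ai) := fun z => (hA.analyticAt z).deriv.differentiableAt
  have hdAc : Continuous fun u : ℝ => deriv Ai (Complex.I * u) :=
    hdA.continuous.comp (by fun_prop)
  have hEc : Continuous E := by fun_prop
  have hmulE : ∀ {f g : ℝ → ℂ} {r : ℝ → ℝ}, (∀ u, ‖g u‖ = ‖f u‖) → f =O[atTop] r →
      g =O[atTop] r := fun hfg hf =>
    isBigO_norm_left.1 (hf.norm_left.congr_left fun u => (hfg u).symm)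
  have hF1 : (fun u : ℝ => E u / Ai (Complex.I * u)) =O[atTop] fun u => Real.exp (-(1/4) * u) :=
    hmulE (fun u => by simp [hEnorm]) hinv1
  have hF2 : (fun u : ℝ => E (-u) / Ai (Complex.I * (-u : ℝ))) =O[atTop]
      fun u => Real.exp (-(1/4) * u) :=
    hmulE (fun u => by simp [hEnorm]) hinv2
  have hH1 : (fun u : ℝ => E u * deriv Ai (Complex.I * u) / Ai (Complex.I * u) ^ 2) =O[atTop]
      fun u => Real.exp (-(1/4) * u) :=
    hmulE (fun u => by simp [hEnorm]) hquot1
  have hH2 : (fun u : ℝ => E (-u) * deriv Ai (Complex.I * (-u : ℝ)) /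
      Ai (Complex.I * (-u : ℝ)) ^ 2) =O[atTop] fun u => Real.exp (-(1/4) * u) :=
    hmulE (fun u => by simp [hEnorm]) hquot2
  have hIF : Integrable fun u : ℝ => E u / Ai (Complex.I * u) :=
    integrable_of_isBigO_exp_neg_both (hEc.div hAc hne) (by norm_num) hF1 hF2
  have hIH : Integrable fun u : ℝ => E u * deriv Ai (Complex.I * u) / Ai (Complex.I * u) ^ 2 :=
    integrable_of_isBigO_exp_neg_both ((hEc.mul hdAc).div (hAc.pow 2) fun u => pow_ne_zero 2 (hne u))
      (by norm_num) hH1 hH2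
  have hexp0 : Tendsto (fun u : ℝ => Real.exp (-(1/4) * u)) atTop (nhds 0) :=
    Real.tendsto_exp_atBot.comp (tendsto_id.const_mul_atTop_of_neg (by norm_num))
  have hT1 := hF1.trans_tendsto hexp0
  have hT2 : Tendsto (fun u : ℝ => E u / Ai (Complex.I * u)) atBot (nhds 0) := by
    simpa [Function.comp_def] using (hF2.trans_tendsto hexp0).comp tendsto_neg_atBot_atTop
  have hder : ∀ u : ℝ, HasDerivAt (fun u : ℝ => E u / Ai (Complex.I * u))
      (-Complex.I * (k * s * (E u / Ai (Complex.I * u)) +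
        E u * deriv Ai (Complex.I * u) / Ai (Complex.I * u) ^ 2)) u := by
    intro u
    have hof : HasDerivAt (fun u : ℝ => (u : ℂ)) 1 u := Complex.ofRealCLM.hasDerivAt
    have h1 : HasDerivAt E (E u * (-(k : ℂ) * Complex.I * s * 1)) u :=
      (hof.const_mul _).cexp
    have h2 : HasDerivAt (fun u : ℝ => Ai (Complex.I * u))
        (deriv Ai (Complex.I * u) * (Complex.I * 1)) u :=
      (hA _).hasDerivAt.comp u (hof.const_mul Complex.I)
    refine (h1.div h2 (hne u)).congr_deriv ?_
    have := hne u
    field_simp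
    ring
  have hzero := integral_of_hasDerivAt_of_tendsto hder
    (((hIF.const_mul (k * s : ℂ)).add hIH).const_mul (-Complex.I)) hT2 hT1
  rw [integral_const_mul, sub_zero, mul_eq_zero,
    or_iff_right (neg_ne_zero.2 Complex.I_ne_zero)] at hzero
  constructor
  · rw [← mul_zero (k : ℂ), ← hzero, ← integral_const_mul]
    congr 1
    ext u
    have := hne u
    push_cast
    simp only [hE]
    field_simp
    ring
  · rw [integral_add (hIF.const_mul _) hIH, integral_const_mul] at hzero
    have : (fun u : ℝ => ((k ^ 2 : ℝ) : ℂ) * s * E u / Ai (Complex.I * u)) =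
        fun u : ℝ => (k : ℂ) * (k * s) * (E u / Ai (Complex.I * u)) := by
      ext u
      push_cast
      ring
    change (∫ u : ℝ, ((k ^ 2 : ℝ) : ℂ) * s * E u / Ai (Complex.I * u)) = _
    rw [this, integral_const_mul]
    linear_combination (k : ℂ) * hzero

end
end
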